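/- R(K_8, C_5) = 29. That is: (i) for every coloring of the edges of the complete graph on 29 vertices with 2 colors, either color 1 contains a subgraph isomorphic to the complete graph K_8 or color 2 contains a subgraph isomorphic to the cycle C_5; and (ii) there exists a 2-coloring of the edges of the complete graph on 28 vertices with neither a K_8 in color 1 nor a C_5 in color 2. -/

import Mathlib

/-- The coloring `c` of the edges of the complete graph on `Fin n` with `k` colors contains a
copy of `G` all of whose edges have color `i`. -/
def HasMonoCopy {V : Type} {n k : ℕ} (G : SimpleGraph V)
    (c : Sym2 (Fin n) → Fin k) (i : Fin k) : Prop :=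
  ∃ f : V → Fin n, Function.Injective f ∧ ∀ u v : V, G.Adj u v → c s(f u, f v) = i

section Graphs

set_option linter.unusedSectionVars false

open scoped Classical

section Basics

variable {V : Type} {G : SimpleGraph V}

/-- `G` has no cycle of length five as a (not necessarily induced) subgraph. -/
def C5Free (G : SimpleGraph V) : Prop :=
  ∀ a b c d e, G.Adj a b → G.Adj b c → G.Adj c d → G.Adj d e → G.Adj e a →
    a ≠ c → a ≠ d → b ≠ d → b ≠ e → c ≠ e → False

/-- `G` has no complete subgraph on four vertices. -/
def K4Free (G : SimpleGraph V) : Prop :=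
  ∀ a b c d, G.Adj a b → G.Adj a c → G.Adj a d → G.Adj b c → G.Adj b d → G.Adj c d → False

/-- The finite set `s` is independent in `G`. -/
def Indep (G : SimpleGraph V) (s : Finset V) : Prop :=
  ∀ x ∈ s, ∀ y ∈ s, ¬ G.Adj x y

/-- The independence number of `G` is at most `k`. -/
def AlphaLE (G : SimpleGraph V) (k : ℕ) : Prop :=
  ∀ s : Finset V, Indep G s → s.card ≤ k

theorem Indep.mono {s t : Finset V} (h : Indep G t) (hst : s ⊆ t) : Indep G s :=
  fun x hx y hy => h x (hst hx) y (hst hy)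

theorem Indep.insert {s : Finset V} {v : V} (h : Indep G s) (hv : ∀ x ∈ s, ¬ G.Adj v x) :
    Indep G (insert v s) := by
  intro x hx y hy hxy
  rcases Finset.mem_insert.1 hx with rfl | hxs <;> rcases Finset.mem_insert.1 hy with rfl | hys
  · exact G.irrefl hxy
  · exact hv y hys hxy
  · exact hv x hxs hxy.symm
  · exact h x hxs y hys hxy

theorem Indep.union {s t : Finset V} (hs : Indep G s) (ht : Indep G t)
    (h : ∀ x ∈ s, ∀ y ∈ t, ¬ G.Adj x y) : Indep G (s ∪ t) := by
  intro x hx y hy hxy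
  rcases Finset.mem_union.1 hx with hx | hx <;> rcases Finset.mem_union.1 hy with hy | hy
  · exact hs x hx y hy hxy
  · exact h x hx y hy hxy
  · exact h y hy x hx hxy.symm
  · exact ht x hx y hy hxy

theorem Indep.singleton (v : V) : Indep G {v} := by
  intro x hx y hy
  rw [Finset.mem_singleton.1 hx, Finset.mem_singleton.1 hy]
  exact G.irrefl

theorem Indep.pair {u v : V} (h : ¬ G.Adj u v) : Indep G {u, v} :=
  (Indep.singleton v).insert (by simpa using h)

theorem C5Free.comap {W : Type} (h : C5Free G) {f : W → V} (hf : Function.Injective f) :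
    C5Free (G.comap f) := by
  intro a b c d e h1 h2 h3 h4 h5 n1 n2 n3 n4 n5
  exact h _ _ _ _ _ h1 h2 h3 h4 h5 (hf.ne n1) (hf.ne n2) (hf.ne n3) (hf.ne n4) (hf.ne n5)

theorem K4Free.comap {W : Type} (h : K4Free G) (f : W → V) : K4Free (G.comap f) :=
  fun _ _ _ _ => h _ _ _ _

theorem Indep.map_subtype {W : Finset V} {s : Finset {x // x ∈ W}}
    (h : Indep (G.comap (Subtype.val : {x // x ∈ W} → V)) s) :
    Indep G (s.map (Function.Embedding.subtype _)) := by
  intro x hx y hy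
  obtain ⟨x, hxs, rfl⟩ := Finset.mem_map.1 hx
  obtain ⟨y, hys, rfl⟩ := Finset.mem_map.1 hy
  exact h x hxs y hys

/-- Every independent subset of a finite set extends to a maximal one. -/
theorem exists_maximal_indep {I₀ W : Finset V} (h₀ : Indep G I₀) (hW : I₀ ⊆ W) :
    ∃ I, I₀ ⊆ I ∧ I ⊆ W ∧ Indep G I ∧ ∀ w ∈ W, w ∉ I → ∃ y ∈ I, G.Adj w y := by
  obtain ⟨I, hI, hmax⟩ := Finset.exists_max_image
    (W.powerset.filter fun I => I₀ ⊆ I ∧ Indep G I) Finset.card ⟨I₀, by simp [hW, h₀]⟩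
  simp only [Finset.mem_filter, Finset.mem_powerset] at hI hmax
  refine ⟨I, hI.2.1, hI.1, hI.2.2, fun w hw hwI => ?_⟩
  by_contra! hno
  have := hmax (insert w I) ⟨Finset.insert_subset hw hI.1,
    hI.2.1.trans (Finset.subset_insert _ _), hI.2.2.insert hno⟩
  rw [Finset.card_insert_of_notMem hwI] at this
  omega

variable [Fintype V]

/-- The neighbours of `v`, as a finite set. -/
noncomputable def nbrs (G : SimpleGraph V) (v : V) : Finset V :=
  Finset.univ.filter fun w => G.Adj v w

/-- The closed neighbourhood of a set of vertices. -/
noncomputable def closedNbrs (G : SimpleGraph V) (S : Finset V) : Finset V :=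
  Finset.univ.filter fun w => w ∈ S ∨ ∃ s ∈ S, G.Adj s w

/-- The neighbours of `a` outside the closed neighbourhood of `v`. -/
noncomputable def children (G : SimpleGraph V) (v a : V) : Finset V :=
  Finset.univ.filter fun w => G.Adj a w ∧ ¬ G.Adj v w ∧ w ≠ v

@[simp] theorem mem_nbrs {v w : V} : w ∈ nbrs G v ↔ G.Adj v w := by simp [nbrs]

@[simp] theorem mem_closedNbrs {S : Finset V} {w : V} :
    w ∈ closedNbrs G S ↔ w ∈ S ∨ ∃ s ∈ S, G.Adj s w := by simp [closedNbrs]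

@[simp] theorem mem_children {v a w : V} :
    w ∈ children G v a ↔ G.Adj a w ∧ ¬ G.Adj v w ∧ w ≠ v := by simp [children]

theorem closedNbrs_singleton (v : V) : closedNbrs G {v} = insert v (nbrs G v) := by
  ext w; simp

theorem card_closedNbrs_singleton (v : V) :
    (closedNbrs G {v}).card = (nbrs G v).card + 1 := by
  rw [closedNbrs_singleton, Finset.card_insert_of_notMem (by simp)]

theorem card_nbrs_eq {v a : V} (h : G.Adj v a) :
    (nbrs G a).card = (children G v a).card + (nbrs G v ∩ nbrs G a).card + 1 := by
  have : nbrs G a = insert v (children G v a ∪ (nbrs G v ∩ nbrs G a)) := by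
    ext w
    have := h.symm
    by_cases hw : w = v <;> by_cases h2 : G.Adj v w <;> simp_all
  conv_lhs => rw [this]
  rw [Finset.card_insert_of_notMem (by simp), Finset.card_union_of_disjoint]
  rw [Finset.disjoint_left]
  intro w; simp; tauto

theorem AlphaLE.comap_compl_closedNbrs {k : ℕ} {S : Finset V} (h : AlphaLE G k)
    (hS : Indep G S) :
    AlphaLE (G.comap (Subtype.val : {x // x ∈ (closedNbrs G S)ᶜ} → V)) (k - S.card) := by
  intro s hs
  have h1 := h (S ∪ s.map (Function.Embedding.subtype _)) (hS.union hs.map_subtype (by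
    intro x hx y hy hxy
    obtain ⟨y, -, rfl⟩ := Finset.mem_map.1 hy
    have := y.2
    simp only [Finset.mem_compl, mem_closedNbrs] at this
    exact this (Or.inr ⟨x, hx, hxy⟩)))
  rw [Finset.card_union_of_disjoint, Finset.card_map] at h1
  · omega
  · rw [Finset.disjoint_left]
    intro x hx hy
    obtain ⟨y, -, rfl⟩ := Finset.mem_map.1 hy
    have := y.2
    simp only [Finset.mem_compl, mem_closedNbrs] at this
    exact this (Or.inl hx)

/-- Every `C₅`-free and `K₄`-free graph with independence number at most `k` has at most `n`
vertices. -/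
def K4FreeBound (k n : ℕ) : Prop :=
  ∀ (V : Type) [Fintype V] (G : SimpleGraph V), C5Free G → K4Free G → AlphaLE G k →
    Fintype.card V ≤ n

theorem K4FreeBound.card_le_add {k m : ℕ} {S : Finset V} (hB : K4FreeBound (k - S.card) m)
    (hC : C5Free G) (hK : K4Free G) (hα : AlphaLE G k) (hS : Indep G S) :
    Fintype.card V ≤ m + (closedNbrs G S).card := by
  have := hB _ _ (hC.comap Subtype.val_injective) (hK.comap _) (hα.comap_compl_closedNbrs hS)
  rw [Fintype.card_coe, Finset.card_compl] at this
  omega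

theorem C5Free.no_path_in_nbrs (hC : C5Free G) {v a b c d : V} (ha : G.Adj v a)
    (hb : G.Adj v b) (hc : G.Adj v c) (hd : G.Adj v d) (hab : G.Adj a b) (hbc : G.Adj b c)
    (hcd : G.Adj c d) (hac : a ≠ c) (had : a ≠ d) (hbd : b ≠ d) : False :=
  hC v a b c d ha hab hbc hcd hd.symm hb.ne hc.ne hac had hbd

/-- Two distinct parents of a vertex at distance two from `v` have no other neighbours
among the neighbours of `v`. -/
theorem C5Free.eq_of_two_parents (hC : C5Free G) {v a b c w : V} (ha : G.Adj v a)
    (hb : G.Adj v b) (hc : G.Adj v c) (hw : ¬ G.Adj v w) (hwv : w ≠ v) (haw : G.Adj a w)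
    (hbw : G.Adj b w) (hab : a ≠ b) (hac : G.Adj a c) : c = b := by
  by_contra hcb
  refine hC v c a w b hc hac.symm haw hbw.symm hb.symm ha.ne hwv.symm ?_ hcb hab
  rintro rfl; exact hw hc

/-- Adjacent vertices at distance two from `v` have the same parents. -/
theorem C5Free.parents_eq (hC : C5Free G) {v a b w w' : V} (ha : G.Adj v a)
    (hb : G.Adj v b) (hw : ¬ G.Adj v w) (hwv : w ≠ v) (hw' : ¬ G.Adj v w') (hwv' : w' ≠ v)
    (haw : G.Adj a w) (hbw : G.Adj b w') (hww : G.Adj w w') : a = b := by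
  by_contra hab
  refine hC v a w w' b ha haw hww hbw.symm hb.symm hwv.symm hwv'.symm ?_ hab ?_
  · rintro rfl; exact hw' ha
  · rintro rfl; exact hw hb

/-- A set of vertices at distance two from `v` splits into two independent sets, the first of
which may be prescribed in part. -/
theorem exists_indep_split (hC : C5Free G) (hK : K4Free G) {v : V} {I₀ U : Finset V}
    (hU : ∀ w ∈ U, ∃ a, G.Adj v a ∧ w ∈ children G v a) (h₀ : Indep G I₀) (h₀U : I₀ ⊆ U) :
    ∃ I, I₀ ⊆ I ∧ I ⊆ U ∧ Indep G I ∧ Indep G (U \ I) := by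
  obtain ⟨I, h1, h2, h3, h4⟩ := exists_maximal_indep h₀ h₀U
  refine ⟨I, h1, h2, h3, fun w hw w' hw' hww => ?_⟩
  simp only [Finset.mem_sdiff] at hw hw'
  obtain ⟨y, hy, hwy⟩ := h4 w hw.1 hw.2
  obtain ⟨y', hy', hwy'⟩ := h4 w' hw'.1 hw'.2
  obtain ⟨a, hva, ha⟩ := hU w hw.1
  obtain ⟨b, hvb, hb⟩ := hU w' hw'.1
  obtain ⟨c, hvc, hc⟩ := hU y (h2 hy)
  obtain ⟨d, hvd, hd⟩ := hU y' (h2 hy')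
  rw [mem_children] at ha hb hc hd
  obtain rfl := hC.parents_eq hva hvb ha.2.1 ha.2.2 hb.2.1 hb.2.2 ha.1 hb.1 hww
  obtain rfl := hC.parents_eq hva hvc ha.2.1 ha.2.2 hc.2.1 hc.2.2 ha.1 hc.1 hwy
  obtain rfl := hC.parents_eq hva hvd hb.2.1 hb.2.2 hd.2.1 hd.2.2 hb.1 hd.1 hwy'
  by_cases hyy : y = y'
  · subst hyy
    exact hK a w w' y ha.1 hb.1 hc.1 hww hwy hwy'
  · refine hC.no_path_in_nbrs hc.1 ha.1 hb.1 hd.1 hwy.symm hww hwy' ?_ hyy ?_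
    · rintro rfl; exact hw'.2 hy
    · rintro rfl; exact hw.2 hy'

theorem card_le_of_nonadj (hα : AlphaLE G k) {v : V} {I : Finset V} (hI : Indep G I)
    (hv : ∀ w ∈ I, ¬ G.Adj v w ∧ w ≠ v) : I.card + 1 ≤ k := by
  have := hα _ (hI.insert fun x hx => (hv x hx).1)
  rwa [Finset.card_insert_of_notMem fun h => (hv v h).2 rfl] at this

theorem card_biUnion_children_le (hC : C5Free G) (hK : K4Free G) {k : ℕ} (hα : AlphaLE G k)
    {v : V} {A : Finset V} (hA : A ⊆ nbrs G v) :
    (A.biUnion (children G v)).card + 2 ≤ 2 * k := by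
  have hU : ∀ w ∈ A.biUnion (children G v), ∃ a, G.Adj v a ∧ w ∈ children G v a := by
    intro w hw
    obtain ⟨a, ha, haw⟩ := Finset.mem_biUnion.1 hw
    exact ⟨a, mem_nbrs.1 (hA ha), haw⟩
  obtain ⟨I, -, h2, h3, h4⟩ := exists_indep_split hC hK hU (I₀ := ∅)
    (fun x hx => by simp at hx) (by simp)
  have key : ∀ J ⊆ A.biUnion (children G v), ∀ w ∈ J, ¬ G.Adj v w ∧ w ≠ v := by
    intro J hJ w hw
    obtain ⟨a, -, haw⟩ := hU w (hJ hw)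
    exact (mem_children.1 haw).2
  have e1 := card_le_of_nonadj hα h3 (key _ h2)
  have e2 := card_le_of_nonadj hα h4 (key _ Finset.sdiff_subset)
  have e3 := Finset.card_sdiff_add_card_eq_card h2
  omega

/-- If every vertex has at most two parents in `A`, then the numbers of children of the vertices
of `A` sum to at most `2 * (k - 1)`. -/
theorem sum_card_children_le (hC : C5Free G) (hK : K4Free G) {k : ℕ} (hα : AlphaLE G k)
    {v : V} {A : Finset V} (hA : A ⊆ nbrs G v)
    (hpar : ∀ w, (A.filter fun a => w ∈ children G v a).card ≤ 2) :
    ∑ a ∈ A, (children G v a).card + 2 ≤ 2 * k := by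
  set U := A.biUnion (children G v) with hUdef
  have hU : ∀ w ∈ U, ∃ a, G.Adj v a ∧ w ∈ children G v a := by
    intro w hw
    obtain ⟨a, ha, haw⟩ := Finset.mem_biUnion.1 hw
    exact ⟨a, mem_nbrs.1 (hA ha), haw⟩
  set S := U.filter fun w => 1 < (A.filter fun a => w ∈ children G v a).card with hS
  have hiso : ∀ w ∈ S, ∀ w' ∈ U, ¬ G.Adj w w' := by
    intro w hw w' hw' hww
    obtain ⟨hwU, h2⟩ := Finset.mem_filter.1 hw
    obtain ⟨a, ha, b, hb, hab⟩ := Finset.one_lt_card.1 h2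
    obtain ⟨c, hc, hcw⟩ := hU w' hw'
    simp only [Finset.mem_filter, mem_children] at ha hb hcw
    have ha' := mem_nbrs.1 (hA ha.1)
    have hb' := mem_nbrs.1 (hA hb.1)
    have h1 := hC.parents_eq ha' hc ha.2.2.1 ha.2.2.2 hcw.2.1 hcw.2.2 ha.2.1 hcw.1 hww
    have h2 := hC.parents_eq hb' hc ha.2.2.1 ha.2.2.2 hcw.2.1 hcw.2.2 hb.2.1 hcw.1 hww
    exact hab (h1.trans h2.symm)
  have hSU : S ⊆ U := Finset.filter_subset _ _
  obtain ⟨I, h1, h2, h3, h4⟩ := exists_indep_split hC hK hU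
    (fun x hx y hy => hiso x hx y (hSU hy)) hSU
  have key : ∀ J ⊆ U, ∀ w ∈ J, ¬ G.Adj v w ∧ w ≠ v := by
    intro J hJ w hw
    obtain ⟨a, -, haw⟩ := hU w (hJ hw)
    exact (mem_children.1 haw).2
  have hsub : U \ I ∪ S ⊆ U := Finset.union_subset Finset.sdiff_subset hSU
  have e1 := card_le_of_nonadj hα h3 (key _ h2)
  have e2 := card_le_of_nonadj hα (h4.union (fun x hx y hy => hiso x hx y (hSU hy))
    fun x hx y hy h => hiso y hy x (Finset.sdiff_subset hx) h.symm) (key _ hsub)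
  rw [Finset.card_union_of_disjoint (Finset.disjoint_left.2 fun x hx hx' =>
    (Finset.mem_sdiff.1 hx).2 (h1 hx'))] at e2
  have e3 := Finset.card_sdiff_add_card_eq_card h2
  have e4 : ∑ a ∈ A, (children G v a).card =
      ∑ w ∈ U, (A.filter fun a => w ∈ children G v a).card := by
    refine Eq.trans ?_ (Finset.sum_card_bipartiteAbove_eq_sum_card_bipartiteBelow
      (fun a w => w ∈ children G v a))
    refine Finset.sum_congr rfl fun a ha => ?_
    congr 1
    ext w
    simp only [Finset.bipartiteAbove, Finset.mem_filter, hUdef, Finset.mem_biUnion]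
    exact ⟨fun h => ⟨⟨a, ha, h⟩, h⟩, fun h => h.2⟩
  have e5 : ∑ w ∈ U, (A.filter fun a => w ∈ children G v a).card ≤
      ∑ w ∈ U, (1 + if w ∈ S then 1 else 0) := by
    refine Finset.sum_le_sum fun w hw => ?_
    have := hpar w
    split_ifs with hwS
    · omega
    · have : ¬ 1 < (A.filter fun a => w ∈ children G v a).card := fun h =>
        hwS (Finset.mem_filter.2 ⟨hw, h⟩)
      omega
  rw [Finset.sum_add_distrib, Finset.sum_ite_mem, Finset.inter_eq_right.2 hSU] at e5
  simp only [Finset.sum_const, smul_eq_mul, mul_one] at e5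
  omega

end Basics

section K4FreeChain

variable {V : Type} [Fintype V] {G : SimpleGraph V} {k : ℕ}

theorem card_parents_le_two (hC : C5Free G) {v : V} {A : Finset V} (hA : A ⊆ nbrs G v)
    (hZ : (A.filter fun a => nbrs G v ∩ nbrs G a = ∅).card ≤ 2) (w : V) :
    (A.filter fun a => w ∈ children G v a).card ≤ 2 := by
  refine le_trans (not_lt.1 fun h => ?_) le_rfl
  refine absurd (lt_of_lt_of_le h (Finset.card_le_card ?_)) (not_lt.2 hZ)
  intro a ha
  have key : ∀ c, G.Adj v c → G.Adj a c → ∀ b ∈ A.filter (fun a => w ∈ children G v a),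
      a ≠ b → c = b := by
    intro c hvc hac b hb hab
    simp only [Finset.mem_filter, mem_children] at ha hb
    exact hC.eq_of_two_parents (mem_nbrs.1 (hA ha.1)) (mem_nbrs.1 (hA hb.1)) hvc ha.2.2.1
      ha.2.2.2 ha.2.1 hb.2.1 hab hac
  refine Finset.mem_filter.2 ⟨(Finset.mem_filter.1 ha).1, ?_⟩
  rw [Finset.eq_empty_iff_forall_notMem]
  intro c hc
  simp only [Finset.mem_inter, mem_nbrs] at hc
  have : 1 < ((A.filter fun a => w ∈ children G v a).erase a).card := by
    rw [Finset.card_erase_of_mem ha]; omega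
  obtain ⟨b, hb, b', hb', hne⟩ := Finset.one_lt_card.1 this
  rw [Finset.mem_erase] at hb hb'
  exact hne ((key c hc.1 hc.2 b hb.2 hb.1.symm).symm.trans (key c hc.1 hc.2 b' hb'.2 hb'.1.symm))

theorem not_indep_nbrs_erase (hC : C5Free G) (hK : K4Free G) (hα : AlphaLE G k) {v z : V}
    {j m : ℕ} (hj : j + 1 ≤ (nbrs G v).card) (hB : K4FreeBound (k - j) m)
    (hn : m + 2 * k + j < Fintype.card V) : ¬ Indep G ((nbrs G v).erase z) := by
  intro hI
  have : j ≤ ((nbrs G v).erase z).card := by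
    have := Finset.pred_card_le_card_erase (s := nbrs G v) (a := z)
    omega
  obtain ⟨S, hS, rfl⟩ := Finset.exists_subset_card_eq this
  have hSv : S ⊆ nbrs G v := hS.trans (Finset.erase_subset _ _)
  have e1 := hB.card_le_add hC hK hα (hI.mono hS)
  have e2 := card_biUnion_children_le hC hK hα hSv
  have e3 : closedNbrs G S ⊆ insert v (insert z (S ∪ S.biUnion (children G v))) := by
    intro w hw
    simp only [Finset.mem_insert, Finset.mem_union, Finset.mem_biUnion, mem_children]
    rw [mem_closedNbrs] at hw
    rcases hw with hw | ⟨s, hs, hsw⟩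
    · tauto
    · by_cases hwv : w = v
      · tauto
      by_cases hwz : w = z
      · tauto
      refine Or.inr (Or.inr (Or.inr ⟨s, hs, hsw, fun hvw => ?_, hwv⟩))
      exact hI s (hS hs) w (Finset.mem_erase.2 ⟨hwz, mem_nbrs.2 hvw⟩) hsw
  have e4 := Finset.card_le_card e3
  have e5 := Finset.card_insert_le v (insert z (S ∪ S.biUnion (children G v)))
  have e6 := Finset.card_insert_le z (S ∪ S.biUnion (children G v))
  have e7 := Finset.card_union_le S (S.biUnion (children G v))
  omega

theorem inter_nbrs_eq_singleton (hC : C5Free G) (hK : K4Free G) {v x y y' : V}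
    (hx : G.Adj v x) (hy : G.Adj v y) (hy' : G.Adj v y') (hxy : G.Adj x y)
    (hxy' : G.Adj x y') (hne : y ≠ y') : nbrs G v ∩ nbrs G y = {x} := by
  ext c
  simp only [Finset.mem_inter, mem_nbrs, Finset.mem_singleton]
  refine ⟨fun ⟨hc, hyc⟩ => ?_, fun h => h ▸ ⟨hx, hxy.symm⟩⟩
  by_contra hcx
  by_cases hcy : c = y'
  · subst hcy; exact hK v x y c hx hy hy' hxy hxy' hyc
  · exact hC.no_path_in_nbrs hy' hx hy hc hxy'.symm hxy hyc hne.symm (Ne.symm hcy) (Ne.symm hcx)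

theorem inter_nbrs_eq_of_le_one {v a b : V} (h : (nbrs G v ∩ nbrs G a).card ≤ 1)
    (hb : G.Adj v b) (hab : G.Adj a b) : nbrs G v ∩ nbrs G a = {b} := by
  symm
  refine Finset.eq_of_subset_of_card_le ?_ (by simpa using h)
  simp [hb, hab]

theorem exists_two_leaves (hC : C5Free G) (hK : K4Free G) {v x y : V}
    (hx : G.Adj v x) (hy : G.Adj v y) (hxy : G.Adj x y) :
    ∃ l₁ l₂ c₁ c₂, l₁ ≠ l₂ ∧ G.Adj v l₁ ∧ G.Adj v l₂ ∧ nbrs G v ∩ nbrs G l₁ = {c₁} ∧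
      nbrs G v ∩ nbrs G l₂ = {c₂} ∧ (c₁ = x ∨ c₁ = y) ∧ (c₂ = x ∨ c₂ = y) := by
  have star : ∀ {x}, G.Adj v x → 1 < (nbrs G v ∩ nbrs G x).card →
      ∃ l₁ l₂, l₁ ≠ l₂ ∧ G.Adj v l₁ ∧ G.Adj v l₂ ∧ nbrs G v ∩ nbrs G l₁ = {x} ∧
      nbrs G v ∩ nbrs G l₂ = {x} := by
    intro x hx h
    obtain ⟨a, ha, b, hb, hab⟩ := Finset.one_lt_card.1 h
    simp only [Finset.mem_inter, mem_nbrs] at ha hb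
    exact ⟨a, b, hab, ha.1, hb.1, inter_nbrs_eq_singleton hC hK hx ha.1 hb.1 ha.2 hb.2 hab,
      inter_nbrs_eq_singleton hC hK hx hb.1 ha.1 hb.2 ha.2 hab.symm⟩
  by_cases h1 : 1 < (nbrs G v ∩ nbrs G x).card
  · obtain ⟨l₁, l₂, h⟩ := star hx h1
    exact ⟨l₁, l₂, x, x, by tauto⟩
  by_cases h2 : 1 < (nbrs G v ∩ nbrs G y).card
  · obtain ⟨l₁, l₂, h⟩ := star hy h2
    exact ⟨l₁, l₂, y, y, by tauto⟩
  exact ⟨x, y, y, x, hxy.ne, hx, hy, inter_nbrs_eq_of_le_one (not_lt.1 h1) hy hxy,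
    inter_nbrs_eq_of_le_one (not_lt.1 h2) hx hxy.symm, Or.inr rfl, Or.inl rfl⟩

/-- If no vertex meets all edges among the neighbours of `v`, then there are four neighbours of
`v` having a single neighbour each in the neighbourhood of `v`, and these are not all equal. -/
theorem exists_four_leaves (hC : C5Free G) (hK : K4Free G) {v : V}
    (h : ∀ z, ¬ Indep G ((nbrs G v).erase z)) :
    ∃ L ⊆ nbrs G v, L.card = 4 ∧ (∀ l ∈ L, (nbrs G v ∩ nbrs G l).card = 1) ∧
      ∀ c, ∃ l ∈ L, nbrs G v ∩ nbrs G l ≠ {c} := by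
  have edge : ∀ z, ∃ x y, G.Adj v x ∧ G.Adj v y ∧ G.Adj x y ∧ x ≠ z ∧ y ≠ z := by
    intro z
    have := h z
    unfold Indep at this
    push Not at this
    obtain ⟨x, hx, y, hy, hxy⟩ := this
    simp only [Finset.mem_erase, mem_nbrs] at hx hy
    exact ⟨x, y, hx.2, hy.2, hxy, hx.1, hy.1⟩
  obtain ⟨x, y, hx, hy, hxy, -, -⟩ := edge v
  have two : ∃ a b, G.Adj v a ∧ G.Adj v b ∧ G.Adj a b ∧ a ≠ x ∧ a ≠ y ∧ b ≠ x ∧ b ≠ y := by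
    by_contra! hno
    have aux : ∀ z z', G.Adj v z → (∀ a b, G.Adj v a → G.Adj v b → G.Adj a b → a ≠ z → a ≠ z' →
        b ≠ z → b = z') → ∃ c, G.Adj v c ∧ G.Adj z' c ∧ c ≠ z := by
      intro z z' hz hno
      obtain ⟨a, b, ha, hb, hab, haz, hbz⟩ := edge z
      by_cases h1 : a = z'
      · exact ⟨b, hb, h1 ▸ hab, hbz⟩
      · exact ⟨a, ha, (hno a b ha hb hab haz h1 hbz) ▸ hab.symm, haz⟩
    obtain ⟨c, hc, hyc, hcx⟩ := aux x y hx hno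
    obtain ⟨d, hd, hxd, hdy⟩ := aux y x hy (by
      intro a b ha hb hab h1 h2 h3
      by_contra h4
      exact h3 (hno a b ha hb hab h2 h1 h4))
    by_cases hcd : c = d
    · subst hcd; exact hK v x y c hx hy hc hxy hxd hyc
    · exact hC.no_path_in_nbrs hc hy hx hd hyc.symm hxy.symm hxd hcx hcd (Ne.symm hdy)
  obtain ⟨a, b, ha, hb, hab, hax, hay, hbx, hby⟩ := two
  obtain ⟨l₁, l₂, c₁, c₂, h12, hl₁, hl₂, hc₁, hc₂, hx₁, hx₂⟩ := exists_two_leaves hC hK hx hy hxy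
  obtain ⟨l₃, l₄, c₃, c₄, h34, hl₃, hl₄, hc₃, hc₄, hx₃, hx₄⟩ := exists_two_leaves hC hK ha hb hab
  have ne : ∀ {l l' c c'}, nbrs G v ∩ nbrs G l = {c} → nbrs G v ∩ nbrs G l' = {c'} →
      (c = x ∨ c = y) → (c' = a ∨ c' = b) → l ≠ l' := by
    rintro l l' c c' h1 h2 h3 h4 rfl
    rw [h1] at h2
    have := Finset.singleton_injective h2
    grind
  refine ⟨{l₁, l₂, l₃, l₄}, ?_, ?_, ?_, ?_⟩
  · intro l hl
    simp only [Finset.mem_insert, Finset.mem_singleton] at hl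
    rcases hl with rfl | rfl | rfl | rfl <;> simpa
  · have h13 := ne hc₁ hc₃ hx₁ hx₃
    have h14 := ne hc₁ hc₄ hx₁ hx₄
    have h23 := ne hc₂ hc₃ hx₂ hx₃
    have h24 := ne hc₂ hc₄ hx₂ hx₄
    simp [h12, h13, h14, h23, h24, h34]
  · intro l hl
    simp only [Finset.mem_insert, Finset.mem_singleton] at hl
    rcases hl with rfl | rfl | rfl | rfl <;> simp [*]
  · intro c
    by_cases hc : c₁ = c
    · refine ⟨l₃, by simp, fun h => ?_⟩
      rw [hc₃] at h
      have := Finset.singleton_injective h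
      grind
    · refine ⟨l₁, by simp, fun h => ?_⟩
      rw [hc₁] at h
      exact hc (Finset.singleton_injective h)

theorem filter_inter_nbrs_eq_empty {v : V} {L : Finset V}
    (hL : ∀ l ∈ L, (nbrs G v ∩ nbrs G l).card = 1) :
    (L.filter fun a => nbrs G v ∩ nbrs G a = ∅) = ∅ := by
  refine Finset.filter_eq_empty_iff.2 fun l hl h => ?_
  have := hL l hl
  simp [h] at this

theorem sum_children_four_leaves {d : ℕ} (hd : ∀ v, d + 2 ≤ (nbrs G v).card) {v : V}
    {L : Finset V} (hLv : L ⊆ nbrs G v) (hL4 : L.card = 4)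
    (hL : ∀ l ∈ L, (nbrs G v ∩ nbrs G l).card = 1) :
    4 * d ≤ ∑ l ∈ L, (children G v l).card := by
  rw [← hL4, ← smul_eq_mul]
  refine Finset.card_nsmul_le_sum _ _ _ fun l hl => ?_
  have e1 := card_nbrs_eq (mem_nbrs.1 (hLv hl))
  have e2 := hL l hl
  have e3 := hd l
  omega

theorem K4FreeBound.le_card_nbrs {m : ℕ} (hB : K4FreeBound (k - 1) m)
    (hC : C5Free G) (hK : K4Free G) (hα : AlphaLE G k) (v : V) :
    Fintype.card V ≤ m + (nbrs G v).card + 1 := by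
  have := K4FreeBound.card_le_add (S := {v}) (by simpa using hB) hC hK hα (Indep.singleton v)
  rw [card_closedNbrs_singleton] at this
  omega

/-- One step of the bound for `K₄`-free graphs. -/
theorem K4FreeBound.step {k m m' n j d : ℕ} (hB₁ : K4FreeBound (k - 1) m)
    (hB : K4FreeBound (k - j) m') (hd : n + 1 = m + (d + 2) + 1) (hj : j ≤ d + 1)
    (hn : m' + 2 * k + j < n + 1) (hk : 2 * k < 4 * d + 2) : K4FreeBound k n := by
  intro V _ G hC hK hα
  by_contra! hcard
  have hdeg : ∀ v, d + 2 ≤ (nbrs G v).card := by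
    intro v
    have := hB₁.le_card_nbrs hC hK hα v
    omega
  obtain ⟨v⟩ : Nonempty V := Fintype.card_pos_iff.1 (by omega)
  obtain ⟨L, hLv, hL4, hL, -⟩ := exists_four_leaves hC hK (v := v) fun z =>
    not_indep_nbrs_erase hC hK hα (by have := hdeg v; omega) hB (by omega)
  have e1 := sum_children_four_leaves hdeg hLv hL4 hL
  have e2 := sum_card_children_le hC hK hα hLv
    (card_parents_le_two hC hLv (by simp [filter_inter_nbrs_eq_empty hL]))
  omega

theorem k4FreeBound_zero : K4FreeBound 0 0 := by
  intro V _ G _ _ hα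
  by_contra! h
  obtain ⟨v⟩ : Nonempty V := Fintype.card_pos_iff.1 h
  have := hα _ (Indep.singleton v)
  simp at this

theorem k4FreeBound_one : K4FreeBound 1 3 := by
  intro V _ G _ hK hα
  by_contra! h
  have adj : ∀ x y, x ≠ y → G.Adj x y := by
    intro x y hxy
    by_contra hno
    have := hα _ (Indep.pair hno)
    rw [Finset.card_pair hxy] at this
    omega
  obtain ⟨f⟩ : Nonempty (Fin 4 ↪ V) :=
    Function.Embedding.nonempty_of_card_le (by rw [Fintype.card_fin]; omega)
  exact hK (f 0) (f 1) (f 2) (f 3) (adj _ _ (by simp)) (adj _ _ (by simp)) (adj _ _ (by simp))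
    (adj _ _ (by simp)) (adj _ _ (by simp)) (adj _ _ (by simp))

theorem k4FreeBound_two : K4FreeBound 2 6 :=
  K4FreeBound.step (m := 3) (m' := 0) (j := 2) (d := 1) k4FreeBound_one k4FreeBound_zero
    (by omega) (by omega) (by omega) (by omega)

theorem k4FreeBound_three : K4FreeBound 3 10 :=
  K4FreeBound.step (m := 6) (m' := 0) (j := 3) (d := 2) k4FreeBound_two k4FreeBound_zero
    (by omega) (by omega) (by omega) (by omega)

theorem k4FreeBound_four : K4FreeBound 4 14 :=
  K4FreeBound.step (m := 10) (m' := 3) (j := 3) (d := 2) k4FreeBound_three k4FreeBound_one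
    (by omega) (by omega) (by omega) (by omega)

end K4FreeChain

section K4FreeFive

variable {V : Type} [Fintype V] {G : SimpleGraph V} {k : ℕ}

theorem exists_indep_half (hC : C5Free G) (hK : K4Free G) {v a : V} (ha : G.Adj v a) :
    ∃ I ⊆ children G v a, Indep G I ∧ (children G v a).card ≤ 2 * I.card := by
  obtain ⟨I, -, h2, h3, h4⟩ := exists_indep_split hC hK (v := v) (I₀ := ∅)
    (U := children G v a) (fun w hw => ⟨a, ha, hw⟩) (fun x hx => by simp at hx) (by simp)
  have e3 := Finset.card_sdiff_add_card_eq_card h2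
  rcases le_total I.card (children G v a \ I).card with h | h
  · exact ⟨_, Finset.sdiff_subset, h4, by omega⟩
  · exact ⟨_, h2, h3, by omega⟩

theorem disjoint_children (hC : C5Free G) {v a b c : V} (ha : G.Adj v a)
    (hb : G.Adj v b) (hc : G.Adj v c) (hab : a ≠ b) (hac : G.Adj a c) (hcb : c ≠ b) :
    Disjoint (children G v a) (children G v b) := by
  rw [Finset.disjoint_left]
  intro w hw hw'
  rw [mem_children] at hw hw'
  exact hcb (hC.eq_of_two_parents ha hb hc hw.2.1 hw.2.2 hw.1 hw'.1 hab hac)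

theorem nonadj_children (hC : C5Free G) {v a b : V} (ha : G.Adj v a) (hb : G.Adj v b)
    (hab : a ≠ b) {w w' : V} (hw : w ∈ children G v a) (hw' : w' ∈ children G v b) :
    ¬ G.Adj w w' := by
  rw [mem_children] at hw hw'
  exact fun h => hab (hC.parents_eq ha hb hw.2.1 hw.2.2 hw'.2.1 hw'.2.2 hw.1 hw'.1 h)

/-- In an extremal `K₄`-free graph for independence number five, the neighbourhood of every vertex
induces a matching. -/
theorem card_inter_nbrs_le_one (hC : C5Free G) (hK : K4Free G) (hα : AlphaLE G 5)
    (hdeg : ∀ v, 4 ≤ (nbrs G v).card)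
    (hpair : ∀ a b, a ≠ b → ¬ G.Adj a b → 9 ≤ (closedNbrs G {a, b}).card) {v c : V}
    (hc : G.Adj v c) : (nbrs G v ∩ nbrs G c).card ≤ 1 := by
  by_contra! hcard
  have leaf : ∀ l ∈ nbrs G v ∩ nbrs G c, nbrs G v ∩ nbrs G l = {c} := by
    intro l hl
    obtain ⟨b, hb, hbl⟩ := Finset.exists_mem_ne hcard l
    simp only [Finset.mem_inter, mem_nbrs] at hl hb
    exact inter_nbrs_eq_singleton hC hK hc hl.1 hb.1 hl.2 hb.2 hbl.symm
  have nonadj : ∀ l ∈ nbrs G v ∩ nbrs G c, ∀ l' ∈ nbrs G v ∩ nbrs G c, ¬ G.Adj l l' := by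
    intro l hl l' hl' hll
    have h1 := leaf l hl
    have h2 : l' ∈ nbrs G v ∩ nbrs G l := by
      simp only [Finset.mem_inter, mem_nbrs] at hl' ⊢
      exact ⟨hl'.1, hll⟩
    rw [h1, Finset.mem_singleton] at h2
    subst h2
    simp at hl'
  have disj : ∀ l ∈ nbrs G v ∩ nbrs G c, ∀ l' ∈ nbrs G v ∩ nbrs G c, l ≠ l' →
      Disjoint (children G v l) (children G v l') := by
    intro l hl l' hl' hll
    simp only [Finset.mem_inter, mem_nbrs] at hl hl'
    exact disjoint_children hC hl.1 hl'.1 hc hll hl.2.symm hl'.2.ne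
  have five : ∀ l ∈ nbrs G v ∩ nbrs G c, ∀ l' ∈ nbrs G v ∩ nbrs G c, l ≠ l' →
      5 ≤ (children G v l).card + (children G v l').card := by
    intro l hl l' hl' hll
    have e1 := hpair l l' hll (nonadj l hl l' hl')
    have e2 : closedNbrs G {l, l'} ⊆ {v, c, l, l'} ∪ (children G v l ∪ children G v l') := by
      intro w hw
      have h1 := leaf l hl
      have h2 := leaf l' hl'
      simp only [Finset.ext_iff, Finset.mem_inter, mem_nbrs, Finset.mem_singleton] at h1 h2
      have h1 := h1 w
      have h2 := h2 w
      simp only [mem_closedNbrs, Finset.mem_insert, Finset.mem_singleton, Finset.mem_union,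
        mem_children] at hw ⊢
      rcases hw with hw | ⟨s, rfl | rfl, hw⟩ <;> tauto
    have e3 := Finset.card_le_card e2
    have e4 := Finset.card_union_le {v, c, l, l'} (children G v l ∪ children G v l')
    have e5 := Finset.card_union_le (children G v l) (children G v l')
    have e6 := Finset.card_le_four (a := v) (b := c) (c := l) (d := l')
    omega
  rcases lt_or_eq_of_le (Nat.succ_le_of_lt hcard) with h3 | h2
  · obtain ⟨l₁, l₂, l₃, h₁, h₂, h₃, h12, h13, h23⟩ := Finset.two_lt_card_iff.1 h3
    have f12 := five _ h₁ _ h₂ h12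
    have f13 := five _ h₁ _ h₃ h13
    have f23 := five _ h₂ _ h₃ h23
    have d12 := disj _ h₁ _ h₂ h12
    have d13 := disj _ h₁ _ h₃ h13
    have d23 := disj _ h₂ _ h₃ h23
    simp only [Finset.mem_inter, mem_nbrs] at h₁ h₂ h₃
    obtain ⟨I₁, s₁, i₁, c₁⟩ := exists_indep_half hC hK h₁.1
    obtain ⟨I₂, s₂, i₂, c₂⟩ := exists_indep_half hC hK h₂.1
    obtain ⟨I₃, s₃, i₃, c₃⟩ := exists_indep_half hC hK h₃.1
    have hI : Indep G (I₁ ∪ (I₂ ∪ I₃)) := by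
      refine i₁.union (i₂.union i₃ fun x hx y hy =>
        nonadj_children hC h₂.1 h₃.1 h23 (s₂ hx) (s₃ hy)) fun x hx y hy => ?_
      rcases Finset.mem_union.1 hy with hy | hy
      · exact nonadj_children hC h₁.1 h₂.1 h12 (s₁ hx) (s₂ hy)
      · exact nonadj_children hC h₁.1 h₃.1 h13 (s₁ hx) (s₃ hy)
    have e1 := card_le_of_nonadj hα hI (v := v) (by
      intro w hw
      simp only [Finset.mem_union] at hw
      rcases hw with hw | hw | hw
      · exact (mem_children.1 (s₁ hw)).2
      · exact (mem_children.1 (s₂ hw)).2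
      · exact (mem_children.1 (s₃ hw)).2)
    rw [Finset.card_union_of_disjoint, Finset.card_union_of_disjoint] at e1
    · omega
    · exact d23.mono s₂ s₃
    · rw [Finset.disjoint_union_right]
      exact ⟨d12.mono s₁ s₂, d13.mono s₁ s₃⟩
  · obtain ⟨l₁, l₂, h12, heq⟩ := Finset.card_eq_two.1 h2.symm
    have m₁ : l₁ ∈ nbrs G v ∩ nbrs G c := by simp [heq]
    have m₂ : l₂ ∈ nbrs G v ∩ nbrs G c := by simp [heq]
    have f12 := five _ m₁ _ m₂ h12
    have g₁ := leaf _ m₁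
    have g₂ := leaf _ m₂
    simp only [Finset.mem_inter, mem_nbrs] at m₁ m₂
    have e1 := card_nbrs_eq hc
    have e2 := hdeg c
    have : ¬ nbrs G v ⊆ {c, l₁, l₂} := fun h => by
      have := Finset.card_le_card h
      have := Finset.card_le_three (a := c) (b := l₁) (c := l₂)
      have := hdeg v
      omega
    obtain ⟨z, hz, hz'⟩ := Finset.not_subset.1 this
    rw [mem_nbrs] at hz
    simp only [Finset.mem_insert, Finset.mem_singleton, not_or] at hz'
    have hcl₁ := m₁.2.ne
    have hcl₂ := m₂.2.ne
    by_cases hiso : nbrs G v ∩ nbrs G z = ∅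
    · have hA : ({l₁, l₂, c, z} : Finset V) ⊆ nbrs G v := by
        intro a ha
        simp only [Finset.mem_insert, Finset.mem_singleton] at ha
        rcases ha with rfl | rfl | rfl | rfl <;> simp [*]
      have := sum_card_children_le hC hK hα hA (card_parents_le_two hC hA (by
        refine (Finset.card_le_card (t := {z}) ?_).trans (by simp)
        intro a ha
        simp only [Finset.mem_filter, Finset.mem_insert, Finset.mem_singleton] at ha ⊢
        rcases ha with ⟨rfl | rfl | rfl | rfl, h⟩
        · simp [h] at g₁
        · simp [h] at g₂
        · simp [h] at hcard
        · rfl))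
      rw [Finset.sum_insert (by grind), Finset.sum_insert (by grind),
        Finset.sum_insert (by grind), Finset.sum_singleton] at this
      have e3 := card_nbrs_eq hz
      have e4 := hdeg z
      rw [hiso, Finset.card_empty] at e3
      omega
    · obtain ⟨z', hz1⟩ := Finset.nonempty_iff_ne_empty.2 hiso
      simp only [Finset.mem_inter, mem_nbrs] at hz1
      simp only [Finset.ext_iff, Finset.mem_inter, mem_nbrs, Finset.mem_singleton,
        Finset.mem_insert] at g₁ g₂ heq
      have hz'c : z' ≠ c := by
        rintro rfl
        have := (heq z).1 ⟨hz, hz1.2.symm⟩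
        tauto
      obtain ⟨n₁, n₂, c₁, c₂, hn12, hn₁, hn₂, hc₁, hc₂, hx₁, hx₂⟩ :=
        exists_two_leaves hC hK hz hz1.1 hz1.2
      have e3 := card_nbrs_eq hn₁
      have e4 := card_nbrs_eq hn₂
      have e5 := hdeg n₁
      have e6 := hdeg n₂
      rw [hc₁, Finset.card_singleton] at e3
      rw [hc₂, Finset.card_singleton] at e4
      have ne : ∀ n c', nbrs G v ∩ nbrs G n = {c'} → (c' = z ∨ c' = z') →
          n ≠ l₁ ∧ n ≠ l₂ ∧ n ≠ c := by
        intro n c' h1 h2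
        simp only [Finset.ext_iff, Finset.mem_inter, mem_nbrs, Finset.mem_singleton] at h1
        refine ⟨?_, ?_, ?_⟩ <;> rintro rfl <;> grind
      have n1 := ne _ _ hc₁ hx₁
      have n2 := ne _ _ hc₂ hx₂
      have hA : ({l₁, l₂, c, n₁, n₂} : Finset V) ⊆ nbrs G v := by
        intro a ha
        simp only [Finset.mem_insert, Finset.mem_singleton] at ha
        rcases ha with rfl | rfl | rfl | rfl | rfl <;> simp [*]
      have := sum_card_children_le hC hK hα hA (card_parents_le_two hC hA (by
        rw [Finset.filter_eq_empty_iff.2, Finset.card_empty]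
        · omega
        intro a ha
        simp only [Finset.mem_insert, Finset.mem_singleton] at ha
        rcases ha with rfl | rfl | rfl | rfl | rfl
        · exact Finset.ne_empty_of_mem (a := c) (by simp [hc, m₁.2.symm])
        · exact Finset.ne_empty_of_mem (a := c) (by simp [hc, m₂.2.symm])
        · exact Finset.ne_empty_of_mem (a := l₁) (by simp [m₁])
        · simp [hc₁]
        · simp [hc₂]))
      rw [Finset.sum_insert (by grind), Finset.sum_insert (by grind),
        Finset.sum_insert (by grind), Finset.sum_insert (by grind), Finset.sum_singleton] at this
      omega

/-- The number of ordered triangles of a finite graph is a multiple of three. -/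
theorem three_dvd_card_triangles (G : SimpleGraph V) :
    3 ∣ ∑ v, ∑ a ∈ nbrs G v, (nbrs G v ∩ nbrs G a).card := by
  let T := {t : V × V × V // G.Adj t.1 t.2.1 ∧ G.Adj t.1 t.2.2 ∧ G.Adj t.2.1 t.2.2}
  let f : Function.End T := fun t =>
    ⟨(t.1.2.1, t.1.2.2, t.1.1), t.2.2.2, t.2.1.symm, t.2.2.1.symm⟩
  have hf : f ^ 3 ^ 1 = 1 := rfl
  have : Fact (Nat.Prime 3) := ⟨Nat.prime_three⟩
  have h1 := Equiv.Perm.card_fixedPoints_modEq hf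
  have h2 : Fintype.card (Function.fixedPoints f) = 0 := by
    rw [Fintype.card_eq_zero_iff]
    refine ⟨fun t => ?_⟩
    have h : f t.1 = t.1 := t.2
    have : t.1.1.2.1 = t.1.1.1 := congrArg (fun t : T => t.1.1) h
    exact t.1.2.1.ne this.symm
  rw [h2] at h1
  have h3 : Fintype.card T = ∑ v, ∑ a ∈ nbrs G v, (nbrs G v ∩ nbrs G a).card := by
    rw [Fintype.card_subtype, Finset.card_filter, Fintype.sum_prod_type]
    refine Finset.sum_congr rfl fun v _ => ?_
    rw [Fintype.sum_prod_type, nbrs, Finset.sum_filter]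
    refine Finset.sum_congr rfl fun a _ => ?_
    split_ifs with h
    · rw [← Finset.card_filter]
      congr 1
      ext b
      simp [h]
    · simp [h]
  rw [← h3]
  exact (Nat.modEq_zero_iff_dvd).1 h1

theorem k4FreeBound_five : K4FreeBound 5 18 := by
  intro V _ G hC hK hα
  by_contra! hcard
  obtain ⟨s, -, hs⟩ := Finset.exists_subset_card_eq (s := (Finset.univ : Finset V)) (n := 19)
    (by rw [Finset.card_univ]; omega)
  wlog hV : Fintype.card V = 19 generalizing V
  · refine this {x // x ∈ s} (G.comap Subtype.val) (hC.comap Subtype.val_injective) (hK.comap _)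
      (fun t ht => ?_) (by simp [hs]) Finset.univ (by simp [hs]) (by simp [hs])
    have := hα _ ht.map_subtype
    rwa [Finset.card_map] at this
  have hdeg : ∀ v, 4 ≤ (nbrs G v).card := by
    intro v
    have := k4FreeBound_four.le_card_nbrs (k := 5) hC hK hα v
    omega
  have hle : ∀ {v c}, G.Adj v c → (nbrs G v ∩ nbrs G c).card ≤ 1 := by
    intro v c
    refine card_inter_nbrs_le_one hC hK hα hdeg (fun a b hab hnab => ?_)
    have := K4FreeBound.card_le_add (S := {a, b})
      (by rw [Finset.card_pair hab]; exact k4FreeBound_three) hC hK hα (Indep.pair hnab)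
    omega
  have hcount : ∀ v, ∑ a ∈ nbrs G v, (nbrs G v ∩ nbrs G a).card = 4 := by
    intro v
    have hZ : ((nbrs G v).filter fun a => nbrs G v ∩ nbrs G a = ∅).card ≤ 2 := by
      by_contra! h3
      obtain ⟨S, hS, hS3⟩ := Finset.exists_subset_card_eq (Nat.succ_le_of_lt h3)
      have hSv : S ⊆ nbrs G v := hS.trans (Finset.filter_subset _ _)
      have hiso : ∀ s ∈ S, ∀ w, G.Adj v w → ¬ G.Adj s w := by
        intro s hs w hw hsw
        have h1 := (Finset.mem_filter.1 (hS hs)).2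
        have : w ∈ nbrs G v ∩ nbrs G s := by simp [hw, hsw]
        simp [h1] at this
      have e1 := K4FreeBound.card_le_add (S := S) (by rw [hS3]; exact k4FreeBound_two) hC hK hα
        (fun x hx y hy => hiso x hx y (mem_nbrs.1 (hSv hy)))
      have e2 := card_biUnion_children_le hC hK hα hSv
      have e3 : closedNbrs G S ⊆ insert v (S ∪ S.biUnion (children G v)) := by
        intro w hw
        simp only [Finset.mem_insert, Finset.mem_union, Finset.mem_biUnion, mem_children]
        rw [mem_closedNbrs] at hw
        rcases hw with hw | ⟨s, hs, hsw⟩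
        · tauto
        · by_cases hwv : w = v
          · tauto
          exact Or.inr (Or.inr ⟨s, hs, hsw, fun hvw => hiso s hs w hvw hsw, hwv⟩)
      have e4 := Finset.card_le_card e3
      have e5 := Finset.card_insert_le v (S ∪ S.biUnion (children G v))
      have e7 := Finset.card_union_le S (S.biUnion (children G v))
      omega
    have e1 := sum_card_children_le hC hK hα le_rfl (card_parents_le_two hC le_rfl hZ)
    have e2 : ∑ a ∈ nbrs G v, 3 ≤ ∑ a ∈ nbrs G v,
        ((children G v a).card + (nbrs G v ∩ nbrs G a).card) := by
      refine Finset.sum_le_sum fun a ha => ?_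
      have e3 := card_nbrs_eq (mem_nbrs.1 ha)
      have e4 := hdeg a
      omega
    have e3 : ∑ a ∈ nbrs G v, (nbrs G v ∩ nbrs G a).card ≤ ∑ a ∈ nbrs G v, 1 :=
      Finset.sum_le_sum fun a ha => hle (mem_nbrs.1 ha)
    rw [Finset.sum_add_distrib] at e2
    simp only [Finset.sum_const, smul_eq_mul] at e2 e3
    have e4 := hdeg v
    omega
  have := three_dvd_card_triangles G
  simp only [hcount, Finset.sum_const, Finset.card_univ, hV, smul_eq_mul] at this
  omega

theorem k4FreeBound_six : K4FreeBound 6 23 :=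
  K4FreeBound.step (m := 18) (m' := 6) (j := 4) (d := 3) k4FreeBound_five k4FreeBound_two
    (by omega) (by omega) (by omega) (by omega)

theorem k4FreeBound_seven : K4FreeBound 7 28 := by
  intro V _ G hC hK hα
  by_contra! hcard
  have hdeg : ∀ v, 3 + 2 ≤ (nbrs G v).card := by
    intro v
    have := k4FreeBound_six.le_card_nbrs (k := 7) hC hK hα v
    omega
  obtain ⟨v⟩ : Nonempty V := Fintype.card_pos_iff.1 (by omega)
  obtain ⟨L, hLv, hL4, hL, hLc⟩ := exists_four_leaves hC hK (v := v) fun z =>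
    not_indep_nbrs_erase (j := 4) hC hK hα (hdeg v) k4FreeBound_three (by omega)
  have e1 := sum_children_four_leaves hdeg hLv hL4 hL
  have big : ∀ z ∈ nbrs G v, z ∉ L → 4 ≤ (nbrs G v ∩ nbrs G z).card := by
    intro z hz hzL
    have hA : insert z L ⊆ nbrs G v := Finset.insert_subset hz hLv
    have e2 := sum_card_children_le hC hK hα hA (card_parents_le_two hC hA (by
      rw [Finset.filter_insert, filter_inter_nbrs_eq_empty hL]
      split_ifs <;> simp))
    rw [Finset.sum_insert hzL] at e2
    have e3 := card_nbrs_eq (mem_nbrs.1 hz)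
    have e4 := hdeg z
    omega
  obtain ⟨z, hz, hzL⟩ := Finset.exists_mem_notMem_of_card_lt_card (s := L) (t := nbrs G v)
    (by have := hdeg v; omega)
  have hz4 := big z hz hzL
  have star : ∀ l ∈ nbrs G v ∩ nbrs G z, nbrs G v ∩ nbrs G l = {z} := by
    intro l hl
    obtain ⟨b, hb, hbl⟩ := Finset.exists_mem_ne (by omega : 1 < (nbrs G v ∩ nbrs G z).card) l
    simp only [Finset.mem_inter, mem_nbrs] at hl hb hz
    exact inter_nbrs_eq_singleton hC hK hz hl.1 hb.1 hl.2 hb.2 hbl.symm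
  have hsub : nbrs G v ∩ nbrs G z ⊆ L := by
    intro l hl
    by_contra hlL
    have := big l (Finset.mem_inter.1 hl).1 hlL
    rw [star l hl] at this
    simp at this
  have heq := Finset.eq_of_subset_of_card_le hsub (by omega)
  obtain ⟨l, hl, hne⟩ := hLc z
  exact hne (star l (heq ▸ hl))

end K4FreeFive

section Ports

variable {V : Type} [Fintype V] {G : SimpleGraph V} {k : ℕ} {q : Fin 4 → V}

/-- The vertices `q i` form a complete graph. -/
def IsK4 (G : SimpleGraph V) (q : Fin 4 → V) : Prop := ∀ i j, i ≠ j → G.Adj (q i) (q j)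

/-- The neighbours of `q i` outside the complete graph `q`. -/
noncomputable def portX (G : SimpleGraph V) (q : Fin 4 → V) (i : Fin 4) : Finset V :=
  Finset.univ.filter fun x => G.Adj (q i) x ∧ ∀ j, x ≠ q j

/-- The vertices at distance two from `q i` reached through `portX G q i`. -/
noncomputable def portT (G : SimpleGraph V) (q : Fin 4 → V) (i : Fin 4) : Finset V :=
  (portX G q i).biUnion (children G (q i))

@[simp] theorem mem_portX {i : Fin 4} {x : V} :
    x ∈ portX G q i ↔ G.Adj (q i) x ∧ ∀ j, x ≠ q j := by simp [portX]

theorem mem_portT {i : Fin 4} {t : V} :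
    t ∈ portT G q i ↔ ∃ x ∈ portX G q i, t ∈ children G (q i) x := by simp [portT]

theorem exists_two_others {i j : Fin 4} (h : i ≠ j) :
    ∃ l m : Fin 4, l ≠ i ∧ l ≠ j ∧ m ≠ i ∧ m ≠ j ∧ l ≠ m := by
  revert i j; decide

theorem exists_other (i j l : Fin 4) : ∃ m : Fin 4, i ≠ m ∧ j ≠ m ∧ l ≠ m := by
  revert i j l; decide

namespace IsK4

theorem ne (hq : IsK4 G q) {i j : Fin 4} (h : i ≠ j) : q i ≠ q j := (hq i j h).ne

theorem adj_of_mem {i : Fin 4} {x : V} (hx : x ∈ portX G q i) : G.Adj (q i) x :=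
  (mem_portX.1 hx).1

theorem children_subset {i : Fin 4} {x : V} (hx : x ∈ portX G q i) :
    children G (q i) x ⊆ portT G q i := fun _ ht => mem_portT.2 ⟨x, hx, ht⟩

theorem not_adj_X (hq : IsK4 G q) (hC : C5Free G) {i j : Fin 4} (hij : i ≠ j) {x : V}
    (hx : x ∈ portX G q i) : ¬ G.Adj (q j) x := by
  intro h
  obtain ⟨l, m, hli, hlj, hmi, hmj, hlm⟩ := exists_two_others hij
  rw [mem_portX] at hx
  exact hC x (q i) (q l) (q m) (q j) hx.1.symm (hq _ _ hli.symm) (hq _ _ hlm) (hq _ _ hmj) h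
    (hx.2 l) (hx.2 m) (hq.ne hmi.symm) (hq.ne hij) (hq.ne hlj)

theorem X_ne_X (hq : IsK4 G q) (hC : C5Free G) {i j : Fin 4} (hij : i ≠ j) {x y : V}
    (hx : x ∈ portX G q i) (hy : y ∈ portX G q j) : x ≠ y := by
  rintro rfl
  exact hq.not_adj_X hC hij hx (adj_of_mem hy)

theorem not_adj_XX (hq : IsK4 G q) (hC : C5Free G) {i j : Fin 4} (hij : i ≠ j) {x y : V}
    (hx : x ∈ portX G q i) (hy : y ∈ portX G q j) : ¬ G.Adj x y := by
  intro h
  obtain ⟨l, m, hli, hlj, hmi, hmj, hlm⟩ := exists_two_others hij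
  have hne := hq.X_ne_X hC hij hx hy
  rw [mem_portX] at hx hy
  exact hC x (q i) (q l) (q j) y hx.1.symm (hq _ _ hli.symm) (hq _ _ hlj) hy.1 h.symm
    (hx.2 l) (hx.2 j) (hq.ne hij) (hy.2 i).symm (hy.2 l).symm

theorem T_ne (hq : IsK4 G q) {i j : Fin 4} {t : V} (ht : t ∈ portT G q i) : t ≠ q j := by
  obtain ⟨x, hx, ht⟩ := mem_portT.1 ht
  rw [mem_children] at ht
  by_cases hij : i = j
  · exact hij ▸ ht.2.2
  · rintro rfl; exact ht.2.1 (hq _ _ hij)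

theorem not_adj_T (hq : IsK4 G q) (hC : C5Free G) {i j : Fin 4} {t : V}
    (ht : t ∈ portT G q i) : ¬ G.Adj (q j) t := by
  intro h
  have hne := fun j => hq.T_ne (j := j) ht
  obtain ⟨x, hx, ht⟩ := mem_portT.1 ht
  rw [mem_children] at ht
  by_cases hij : i = j
  · subst hij; exact ht.2.1 h
  · obtain ⟨l, m, hli, hlj, hmi, hmj, hlm⟩ := exists_two_others hij
    rw [mem_portX] at hx
    exact hC t x (q i) (q l) (q j) ht.1.symm hx.1.symm (hq _ _ hli.symm) (hq _ _ hlj) h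
      (hne i) (hne l) (hx.2 l) (hx.2 j) (hq.ne hij)

theorem not_adj_XT (hq : IsK4 G q) (hC : C5Free G) {i j : Fin 4} (hij : i ≠ j) {y t : V}
    (hy : y ∈ portX G q j) (ht : t ∈ portT G q i) : ¬ G.Adj y t := by
  intro h
  have hne := fun j => hq.T_ne (j := j) ht
  obtain ⟨x, hx, ht⟩ := mem_portT.1 ht
  rw [mem_children] at ht
  have hxy := hq.X_ne_X hC hij hx hy
  rw [mem_portX] at hx hy
  exact hC t x (q i) (q j) y ht.1.symm hx.1.symm (hq _ _ hij) hy.1 h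
      (hne i) (hne j) (hx.2 j) hxy (hy.2 i).symm

theorem T_ne_T (hq : IsK4 G q) (hC : C5Free G) {i j : Fin 4} (hij : i ≠ j) {t s : V}
    (ht : t ∈ portT G q i) (hs : s ∈ portT G q j) : t ≠ s := by
  rintro rfl
  obtain ⟨y, hy, hs⟩ := mem_portT.1 hs
  exact hq.not_adj_XT hC hij hy ht (mem_children.1 hs).1

theorem T_ne_X (hq : IsK4 G q) (hC : C5Free G) {i j : Fin 4} {t y : V}
    (ht : t ∈ portT G q i) (hy : y ∈ portX G q j) : t ≠ y := by
  rintro rfl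
  exact hq.not_adj_T hC ht (adj_of_mem hy)

theorem disjoint_ports (hq : IsK4 G q) (hC : C5Free G) {i j : Fin 4} (hij : i ≠ j)
    {A B : Finset V} (hA : A ⊆ portX G q i ∪ portT G q i) (hB : B ⊆ portX G q j ∪ portT G q j) :
    Disjoint A B := by
  rw [Finset.disjoint_left]
  intro x hx hy
  rcases Finset.mem_union.1 (hA hx) with hx | hx <;> rcases Finset.mem_union.1 (hB hy) with hy | hy
  · exact hq.X_ne_X hC hij hx hy rfl
  · exact hq.T_ne_X hC hy hx rfl
  · exact hq.T_ne_X hC hx hy rfl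
  · exact hq.T_ne_T hC hij hx hy rfl

/-- Independent sets from the four ports combine with `q i`, if the part in port `i` avoids the
neighbours of `q i`. -/
theorem card_four_le (hq : IsK4 G q) (hC : C5Free G) (hα : AlphaLE G k) {i j l m : Fin 4}
    (hij : i ≠ j) (hil : i ≠ l) (him : i ≠ m) (hjl : j ≠ l) (hjm : j ≠ m) (hlm : l ≠ m)
    {J A B D : Finset V} (hJ : J ⊆ portT G q i) (hA : A ⊆ portX G q j ∪ portT G q j)
    (hB : B ⊆ portX G q l ∪ portT G q l) (hD : D ⊆ portX G q m ∪ portT G q m)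
    (iJ : Indep G J) (iA : Indep G A) (iB : Indep G B) (iD : Indep G D)
    (hJA : ∀ x ∈ J, ∀ y ∈ A, ¬ G.Adj x y) (hJB : ∀ x ∈ J, ∀ y ∈ B, ¬ G.Adj x y)
    (hJD : ∀ x ∈ J, ∀ y ∈ D, ¬ G.Adj x y) (hAB : ∀ x ∈ A, ∀ y ∈ B, ¬ G.Adj x y)
    (hAD : ∀ x ∈ A, ∀ y ∈ D, ¬ G.Adj x y) (hBD : ∀ x ∈ B, ∀ y ∈ D, ¬ G.Adj x y) :
    J.card + A.card + B.card + D.card + 1 ≤ k := by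
  have hJ' : J ⊆ portX G q i ∪ portT G q i := hJ.trans Finset.subset_union_right
  have hI : Indep G (J ∪ (A ∪ (B ∪ D))) := by
    refine iJ.union (iA.union (iB.union iD hBD) ?_) ?_ <;> intro x hx y hy <;>
      simp only [Finset.mem_union] at hy
    · rcases hy with hy | hy
      exacts [hAB x hx y hy, hAD x hx y hy]
    · rcases hy with hy | hy | hy
      exacts [hJA x hx y hy, hJB x hx y hy, hJD x hx y hy]
  have e := card_le_of_nonadj hα hI (v := q i) (by
    have aux : ∀ {A : Finset V} {j}, i ≠ j → A ⊆ portX G q j ∪ portT G q j → ∀ w ∈ A,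
        ¬ G.Adj (q i) w ∧ w ≠ q i := by
      intro A j hij hA w hw
      rcases Finset.mem_union.1 (hA hw) with h | h
      · exact ⟨hq.not_adj_X hC hij.symm h, (mem_portX.1 h).2 i⟩
      · exact ⟨hq.not_adj_T hC h, hq.T_ne h⟩
    intro w hw
    simp only [Finset.mem_union] at hw
    rcases hw with hw | hw | hw | hw
    · exact ⟨hq.not_adj_T hC (hJ hw), hq.T_ne (hJ hw)⟩
    · exact aux hij hA w hw
    · exact aux hil hB w hw
    · exact aux him hD w hw)
  have dBD := hq.disjoint_ports hC hlm hB hD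
  have dA := Finset.disjoint_union_right.2 ⟨hq.disjoint_ports hC hjl hA hB,
    hq.disjoint_ports hC hjm hA hD⟩
  have dJ := Finset.disjoint_union_right.2 ⟨hq.disjoint_ports hC hij hJ' hA,
    Finset.disjoint_union_right.2 ⟨hq.disjoint_ports hC hil hJ' hB,
    hq.disjoint_ports hC him hJ' hD⟩⟩
  rw [Finset.card_union_of_disjoint dJ, Finset.card_union_of_disjoint dA,
    Finset.card_union_of_disjoint dBD] at e
  omega

theorem not_adj_T_singleton (hq : IsK4 G q) (hC : C5Free G) {i j : Fin 4} (hij : i ≠ j) {x : V}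
    {A : Finset V} (hA : A ⊆ portX G q i ∪ portT G q i) (hx : x ∈ portX G q j) :
    ∀ a ∈ A, ∀ y ∈ ({x} : Finset V), ¬ G.Adj a y := by
  intro a ha y hy
  rw [Finset.mem_singleton] at hy
  subst hy
  rcases Finset.mem_union.1 (hA ha) with h | h
  · exact hq.not_adj_XX hC hij h hx
  · exact fun h' => hq.not_adj_XT hC hij hx h h'.symm

theorem card_three_le (hq : IsK4 G q) (hC : C5Free G) (hα : AlphaLE G k)
    (hX : ∀ i, (portX G q i).Nonempty) {i j l : Fin 4}
    (hij : i ≠ j) (hil : i ≠ l) (hjl : j ≠ l)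
    {J A B : Finset V} (hJ : J ⊆ portT G q i) (hA : A ⊆ portX G q j ∪ portT G q j)
    (hB : B ⊆ portX G q l ∪ portT G q l)
    (iJ : Indep G J) (iA : Indep G A) (iB : Indep G B)
    (hJA : ∀ x ∈ J, ∀ y ∈ A, ¬ G.Adj x y) (hJB : ∀ x ∈ J, ∀ y ∈ B, ¬ G.Adj x y)
    (hAB : ∀ x ∈ A, ∀ y ∈ B, ¬ G.Adj x y) : J.card + A.card + B.card + 2 ≤ k := by
  obtain ⟨m, him, hjm, hlm⟩ := exists_other i j l
  obtain ⟨x, hx⟩ := hX m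
  exact hq.card_four_le hC hα hij hil him hjl hjm hlm hJ hA hB (D := {x})
    (by simpa using Or.inl (mem_portX.1 hx))
    iJ iA iB (Indep.singleton x) hJA hJB
    (hq.not_adj_T_singleton hC him (hJ.trans Finset.subset_union_right) hx) hAB
    (hq.not_adj_T_singleton hC hjm hA hx) (hq.not_adj_T_singleton hC hlm hB hx)

theorem card_two_le (hq : IsK4 G q) (hC : C5Free G) (hα : AlphaLE G k)
    (hX : ∀ i, (portX G q i).Nonempty) {i j : Fin 4} (hij : i ≠ j)
    {J A : Finset V} (hJ : J ⊆ portT G q i) (hA : A ⊆ portX G q j ∪ portT G q j)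
    (iJ : Indep G J) (iA : Indep G A)
    (hJA : ∀ x ∈ J, ∀ y ∈ A, ¬ G.Adj x y) : J.card + A.card + 3 ≤ k := by
  obtain ⟨m, -, hmi, hmj, -⟩ := exists_two_others hij
  obtain ⟨x, hx⟩ := hX m
  exact hq.card_three_le hC hα hX hij hmi.symm hmj.symm hJ hA (B := {x})
    (by simpa using Or.inl (mem_portX.1 hx))
    iJ iA (Indep.singleton x) hJA
    (hq.not_adj_T_singleton hC hmi.symm (hJ.trans Finset.subset_union_right) hx)
    (hq.not_adj_T_singleton hC hmj.symm hA hx)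

theorem card_one_le (hq : IsK4 G q) (hC : C5Free G) (hα : AlphaLE G k)
    (hX : ∀ i, (portX G q i).Nonempty) {i : Fin 4}
    {J : Finset V} (hJ : J ⊆ portT G q i) (iJ : Indep G J) : J.card + 4 ≤ k := by
  obtain ⟨j, hij⟩ := exists_ne i
  obtain ⟨x, hx⟩ := hX j
  exact hq.card_two_le hC hα hX hij.symm hJ (A := {x}) (by simpa using Or.inl (mem_portX.1 hx))
    iJ (Indep.singleton x)
    (hq.not_adj_T_singleton hC hij.symm (hJ.trans Finset.subset_union_right) hx)

theorem card_T_add_card_X_le (hq : IsK4 G q) (hC : C5Free G) (hα : AlphaLE G k)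
    (hX : ∀ i, (portX G q i).Nonempty) {i j : Fin 4} (hij : i ≠ j)
    {J A : Finset V} (hJ : J ⊆ portT G q i) (hA : A ⊆ portX G q j)
    (iJ : Indep G J) (iA : Indep G A) : J.card + A.card + 3 ≤ k :=
  hq.card_two_le hC hα hX hij hJ (hA.trans Finset.subset_union_left) iJ iA
    fun _ hx _ hy h => hq.not_adj_XT hC hij (hA hy) (hJ hx) h.symm

theorem card_nbrs (hq : IsK4 G q) (i : Fin 4) :
    (nbrs G (q i)).card = (portX G q i).card + 3 := by
  have h : nbrs G (q i) = portX G q i ∪ (Finset.univ.erase i).image q := by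
    ext x
    simp only [mem_nbrs, Finset.mem_union, mem_portX, Finset.mem_image, Finset.mem_erase,
      Finset.mem_univ, and_true]
    constructor
    · intro h
      by_cases hx : ∃ j, q j = x
      · obtain ⟨j, rfl⟩ := hx
        refine Or.inr ⟨j, ?_, rfl⟩
        rintro rfl
        exact G.irrefl h
      · push Not at hx
        exact Or.inl ⟨h, fun j => (hx j).symm⟩
    · rintro (h | ⟨j, hj, rfl⟩)
      · exact h.1
      · exact hq _ _ hj.symm
  rw [h, Finset.card_union_of_disjoint, Finset.card_image_of_injective]
  · simp
  · intro a b hab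
    by_contra hne
    exact hq.ne hne hab
  · rw [Finset.disjoint_left]
    intro x hx hx'
    obtain ⟨j, -, rfl⟩ := Finset.mem_image.1 hx'
    exact (mem_portX.1 hx).2 j rfl

theorem card_nbrs_X (hq : IsK4 G q) (hC : C5Free G) {i : Fin 4} {x : V} (hx : x ∈ portX G q i) :
    (nbrs G x).card = (children G (q i) x).card + (portX G q i ∩ nbrs G x).card + 1 := by
  rw [card_nbrs_eq (adj_of_mem hx)]
  have : nbrs G (q i) ∩ nbrs G x = portX G q i ∩ nbrs G x := by
    ext y
    simp only [Finset.mem_inter, mem_nbrs, mem_portX]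
    refine ⟨fun h => ⟨⟨h.1, ?_⟩, h.2⟩, fun h => ⟨h.1.1, h.2⟩⟩
    rintro j rfl
    by_cases hij : i = j
    · subst hij; exact G.irrefl h.1
    · exact hq.not_adj_X hC hij hx h.2.symm
  rw [this]

/-- A common child of two vertices of a port limits their neighbours in the port. -/
theorem card_X_inter_le_one (hC : C5Free G) {i : Fin 4} {x y t : V}
    (hx : x ∈ portX G q i) (hy : y ∈ portX G q i) (hxy : x ≠ y)
    (htx : t ∈ children G (q i) x) (hty : t ∈ children G (q i) y) :
    (portX G q i ∩ nbrs G x).card ≤ 1 := by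
  refine (Finset.card_le_card (t := {y}) ?_).trans (by simp)
  intro c hc
  rw [Finset.mem_inter, mem_nbrs] at hc
  rw [mem_children] at htx hty
  exact Finset.mem_singleton.2 (hC.eq_of_two_parents (adj_of_mem hx) (adj_of_mem hy)
    (adj_of_mem hc.1) htx.2.1 htx.2.2 htx.1 hty.1 hxy hc.2)

theorem exists_indep_pair_of_card_le (hq : IsK4 G q) (hC : C5Free G)
    (hδ : ∀ v, 4 ≤ (nbrs G v).card) {i : Fin 4} {x y : V} (hx : x ∈ portX G q i)
    (hy : y ∈ portX G q i) (hxy : x ≠ y) (hhx : (portX G q i ∩ nbrs G x).card ≤ 2)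
    (hhy : (portX G q i ∩ nbrs G y).card ≤ 2) :
    ∃ t ∈ children G (q i) x, ∃ s ∈ children G (q i) y, t ≠ s := by
  have e1 := hq.card_nbrs_X hC hx
  have e2 := hq.card_nbrs_X hC hy
  have e3 := hδ x
  have e4 := hδ y
  obtain ⟨t, ht⟩ := Finset.card_pos.1 (show 0 < (children G (q i) x).card by omega)
  obtain ⟨s, hs⟩ := Finset.card_pos.1 (show 0 < (children G (q i) y).card by omega)
  by_cases hts : t = s
  · subst hts
    have := card_X_inter_le_one hC hx hy hxy ht hs
    obtain ⟨t', ht', hne⟩ := Finset.exists_mem_ne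
      (show 1 < (children G (q i) x).card by omega) t
    exact ⟨t', ht', t, hs, hne⟩
  · exact ⟨t, ht, s, hs, hts⟩

theorem exists_indep_pair (hq : IsK4 G q) (hC : C5Free G) (hδ : ∀ v, 4 ≤ (nbrs G v).card)
    {i : Fin 4} (h : 1 < (portX G q i).card) :
    ∃ x ∈ portX G q i, ∃ y ∈ portX G q i, ∃ t ∈ children G (q i) x, ∃ s ∈ children G (q i) y,
      x ≠ y ∧ t ≠ s ∧ ¬ G.Adj t s := by
  suffices ∃ x ∈ portX G q i, ∃ y ∈ portX G q i, x ≠ y ∧ (portX G q i ∩ nbrs G x).card ≤ 2 ∧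
      (portX G q i ∩ nbrs G y).card ≤ 2 by
    obtain ⟨x, hx, y, hy, hxy, h1, h2⟩ := this
    obtain ⟨t, ht, s, hs, hts⟩ := hq.exists_indep_pair_of_card_le hC hδ hx hy hxy h1 h2
    exact ⟨x, hx, y, hy, t, ht, s, hs, hxy, hts,
      nonadj_children hC (adj_of_mem hx) (adj_of_mem hy) hxy ht hs⟩
  by_cases hbig : ∃ c ∈ portX G q i, 3 ≤ (portX G q i ∩ nbrs G c).card
  · obtain ⟨c, hc, h3⟩ := hbig
    have small : ∀ y ∈ portX G q i ∩ nbrs G c, (portX G q i ∩ nbrs G y).card ≤ 2 := by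
      intro y hy
      refine (Finset.card_le_card (t := {c}) ?_).trans (by simp)
      intro z hz
      rw [Finset.mem_singleton]
      by_contra hzc
      obtain ⟨w, hw⟩ := Finset.card_pos.1
        (show 0 < (((portX G q i ∩ nbrs G c).erase y).erase z).card by
          have := Finset.pred_card_le_card_erase (s := portX G q i ∩ nbrs G c) (a := y)
          have := Finset.pred_card_le_card_erase (s := (portX G q i ∩ nbrs G c).erase y) (a := z)
          omega)
      simp only [Finset.mem_erase, Finset.mem_inter, mem_nbrs] at hw hy hz
      exact hC.no_path_in_nbrs (adj_of_mem hw.2.2.1) (adj_of_mem hc) (adj_of_mem hy.1)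
        (adj_of_mem hz.1) hw.2.2.2.symm hy.2 hz.2 hw.2.1 hw.1 (Ne.symm hzc)
    obtain ⟨x, hx, y, hy, hxy⟩ := Finset.one_lt_card.1
      (show 1 < (portX G q i ∩ nbrs G c).card by omega)
    exact ⟨x, (Finset.mem_inter.1 hx).1, y, (Finset.mem_inter.1 hy).1, hxy, small x hx, small y hy⟩
  · push Not at hbig
    obtain ⟨x, hx, y, hy, hxy⟩ := Finset.one_lt_card.1 h
    have h1 := hbig x hx
    have h2 := hbig y hy
    exact ⟨x, hx, y, hy, hxy, by omega, by omega⟩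

end IsK4

theorem exists_isK4 {V : Type} {G : SimpleGraph V} (h : ¬ K4Free G) :
    ∃ q : Fin 4 → V, IsK4 G q := by
  unfold K4Free at h
  push Not at h
  obtain ⟨a, b, c, d, hab, hac, had, hbc, hbd, hcd, -⟩ := h
  refine ⟨![a, b, c, d], fun i j hij => ?_⟩
  fin_cases i <;> fin_cases j <;>
    first
    | exact absurd rfl hij
    | assumption
    | exact SimpleGraph.Adj.symm (by assumption)

end Ports

section CliqueCovers

variable {V : Type} [Fintype V] {G : SimpleGraph V} {k : ℕ} {q : Fin 4 → V}

/-- The vertices of `G` can be partitioned into at most `k` cliques. -/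
def CliqueCover (G : SimpleGraph V) (k : ℕ) : Prop :=
  ∃ f : V → ℕ, (∀ v, f v < k) ∧ ∀ x y, f x = f y → x ≠ y → G.Adj x y

theorem CliqueCover.of_finset {ι : ℕ} (P : Fin ι → Finset V)
    (hP : ∀ i, ∀ x ∈ P i, ∀ y ∈ P i, x ≠ y → G.Adj x y) (hcov : ∀ v, ∃ i, v ∈ P i) :
    CliqueCover G ι := by
  choose f hf using hcov
  refine ⟨fun v => f v, fun v => (f v).2, fun x y hxy => hP (f x) x (hf x) y ?_⟩
  rw [Fin.ext hxy]
  exact hf y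

/-- Adding a clique to a clique cover of the remaining vertices. -/
theorem CliqueCover.extend {W : Finset V} (hW : ∀ x ∈ W, ∀ y ∈ W, x ≠ y → G.Adj x y)
    (h : CliqueCover (G.comap (Subtype.val : {x // x ∈ Wᶜ} → V)) k) : CliqueCover G (k + 1) := by
  obtain ⟨f, hf, hf'⟩ := h
  refine ⟨fun v => if hv : v ∈ Wᶜ then f ⟨v, hv⟩ else k, fun v => ?_, fun x y hxy hne => ?_⟩
  · dsimp only
    split_ifs with hv
    · exact (hf _).trans (Nat.lt_succ_self k)
    · exact Nat.lt_succ_self k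
  · dsimp only at hxy
    split_ifs at hxy with h1 h2 h2
    · exact hf' ⟨x, h1⟩ ⟨y, h2⟩ hxy (by simpa using hne)
    · exact absurd hxy (hf _).ne
    · exact absurd hxy.symm (hf _).ne
    · rw [Finset.mem_compl, not_not] at h1 h2
      exact hW x h1 y h2 hne

namespace IsK4

theorem image_card (hq : IsK4 G q) : (Finset.univ.image q).card = 4 := by
  rw [Finset.card_image_of_injective _ fun a b hab => by
    by_contra hne
    exact hq.ne hne hab]
  simp

theorem portX_nonempty (hq : IsK4 G q) (hδ : ∀ v, 4 ≤ (nbrs G v).card) (i : Fin 4) :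
    (portX G q i).Nonempty := by
  have e1 := hq.card_nbrs i
  have e2 := hδ (q i)
  exact Finset.card_pos.1 (by omega)

theorem adj_of_mem_portT (hq : IsK4 G q) (hC : C5Free G) (hα : AlphaLE G 5)
    (hδ : ∀ v, 4 ≤ (nbrs G v).card) {i : Fin 4} {t s : V} (ht : t ∈ portT G q i)
    (hs : s ∈ portT G q i) (hts : t ≠ s) : G.Adj t s := by
  by_contra hno
  have := hq.card_one_le hC hα (hq.portX_nonempty hδ) (J := {t, s})
    (Finset.insert_subset ht (Finset.singleton_subset_iff.2 hs)) (Indep.pair hno)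
  rw [Finset.card_pair hts] at this
  omega

theorem card_portX_le_one (hq : IsK4 G q) (hC : C5Free G) (hα : AlphaLE G 5)
    (hδ : ∀ v, 4 ≤ (nbrs G v).card) (i : Fin 4) : (portX G q i).card ≤ 1 := by
  by_contra! h
  obtain ⟨x, hx, y, hy, t, ht, s, hs, -, hts, hno⟩ := hq.exists_indep_pair hC hδ h
  exact hno (hq.adj_of_mem_portT hC hα hδ (children_subset hx ht) (children_subset hy hs) hts)

/-- For independence number at most five, a complete graph on four vertices in a graph of minimum
degree at least four gives rise to five disjoint ones. -/
theorem exists_five_cliques (hq : IsK4 G q) (hC : C5Free G) (hα : AlphaLE G 5)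
    (hδ : ∀ v, 4 ≤ (nbrs G v).card) :
    20 ≤ Fintype.card V ∧ (Fintype.card V = 20 → CliqueCover G 5) := by
  set P : Fin 4 → Finset V := fun i => portX G q i ∪ portT G q i with hP
  have hclique : ∀ i, ∀ x ∈ P i, ∀ y ∈ P i, x ≠ y → G.Adj x y := by
    intro i
    have key : ∀ x ∈ portX G q i, ∀ t ∈ portT G q i, G.Adj x t := by
      intro x hx t ht
      obtain ⟨y, hy, ht⟩ := mem_portT.1 ht
      rw [Finset.card_le_one.1 (hq.card_portX_le_one hC hα hδ i) x hx y hy]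
      exact (mem_children.1 ht).1
    intro x hx y hy hxy
    rcases Finset.mem_union.1 hx with hx | hx <;> rcases Finset.mem_union.1 hy with hy | hy
    · exact absurd (Finset.card_le_one.1 (hq.card_portX_le_one hC hα hδ i) x hx y hy) hxy
    · exact key x hx y hy
    · exact (key y hy x hx).symm
    · exact hq.adj_of_mem_portT hC hα hδ hx hy hxy
  have hcard : ∀ i, 4 ≤ (P i).card := by
    intro i
    obtain ⟨x, hx⟩ := hq.portX_nonempty hδ i
    have e1 := hq.card_nbrs_X hC hx
    have e2 := hδ x
    have e3 : portX G q i ∩ nbrs G x = ∅ := by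
      rw [Finset.eq_empty_iff_forall_notMem]
      intro y hy
      rw [Finset.mem_inter, mem_nbrs] at hy
      exact hy.2.ne (Finset.card_le_one.1 (hq.card_portX_le_one hC hα hδ i) x hx y hy.1)
    rw [e3, Finset.card_empty] at e1
    have e4 : insert x (children G (q i) x) ⊆ P i :=
      Finset.insert_subset (Finset.mem_union_left _ hx)
        ((children_subset hx).trans Finset.subset_union_right)
    have e5 := Finset.card_le_card e4
    rw [Finset.card_insert_of_notMem (by simp)] at e5
    omega
  have hdisj : Disjoint (Finset.univ.image q) (Finset.univ.biUnion P) := by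
    rw [Finset.disjoint_left]
    intro x hx hx'
    obtain ⟨j, -, rfl⟩ := Finset.mem_image.1 hx
    obtain ⟨i, -, hi⟩ := Finset.mem_biUnion.1 hx'
    rcases Finset.mem_union.1 hi with hi | hi
    · exact (mem_portX.1 hi).2 j rfl
    · exact hq.T_ne hi rfl
  have hsum : 20 ≤ (Finset.univ.image q ∪ Finset.univ.biUnion P).card := by
    rw [Finset.card_union_of_disjoint hdisj, hq.image_card, Finset.card_biUnion
      fun i _ j _ hij => hq.disjoint_ports hC hij le_rfl le_rfl]
    have := Finset.card_nsmul_le_sum Finset.univ (fun i => (P i).card) 4 fun i _ => hcard i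
    simp only [Finset.card_univ, Fintype.card_fin, smul_eq_mul] at this
    change 20 ≤ 4 + ∑ i, (P i).card
    omega
  refine ⟨hsum.trans (Finset.card_le_univ _), fun h20 => ?_⟩
  have huniv : Finset.univ.image q ∪ Finset.univ.biUnion P = Finset.univ :=
    Finset.eq_univ_of_card _ (le_antisymm (Finset.card_le_univ _) (h20 ▸ hsum))
  refine CliqueCover.of_finset (Fin.cons (Finset.univ.image q) P) ?_ ?_
  · refine Fin.cases ?_ fun i => ?_
    · intro x hx y hy hxy
      simp only [Fin.cons_zero, Finset.mem_image, Finset.mem_univ, true_and] at hx hy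
      obtain ⟨i, rfl⟩ := hx
      obtain ⟨j, rfl⟩ := hy
      exact hq i j fun h => hxy (h ▸ rfl)
    · simpa using hclique i
  · intro v
    have : v ∈ Finset.univ.image q ∪ Finset.univ.biUnion P := huniv ▸ Finset.mem_univ v
    rcases Finset.mem_union.1 this with h | h
    · exact ⟨0, by simpa using h⟩
    · obtain ⟨i, -, hi⟩ := Finset.mem_biUnion.1 h
      exact ⟨i.succ, by simpa using hi⟩

end IsK4

end CliqueCovers

section PortTypes

variable {V : Type} [Fintype V] {G : SimpleGraph V} {k : ℕ} {q : Fin 4 → V}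

/-- Port `i` has two adjacent vertices with `k - 4` common children, which are independent, and no
other children. -/
structure SharedPort (G : SimpleGraph V) (q : Fin 4 → V) (k : ℕ) (i : Fin 4) : Prop where
  card_X : (portX G q i).card = 2
  adj_X : ∀ x ∈ portX G q i, ∀ y ∈ portX G q i, x ≠ y → G.Adj x y
  indep_T : Indep G (portT G q i)
  card_T : (portT G q i).card + 4 = k
  adj_T : ∀ x ∈ portX G q i, ∀ t ∈ portT G q i, G.Adj x t

/-- Port `i` has two adjacent vertices each having two adjacent children. -/
structure PairedPort (G : SimpleGraph V) (q : Fin 4 → V) (i : Fin 4) (x y p p' r r' : V) :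
    Prop where
  mem_x : x ∈ portX G q i
  mem_y : y ∈ portX G q i
  adj_xy : G.Adj x y
  mem_p : p ∈ children G (q i) x
  mem_p' : p' ∈ children G (q i) x
  adj_p : G.Adj p p'
  mem_r : r ∈ children G (q i) y
  mem_r' : r' ∈ children G (q i) y
  adj_r : G.Adj r r'

theorem PairedPort.swap {i : Fin 4} {x y p p' r r' : V} (h : PairedPort G q i x y p p' r r') :
    PairedPort G q i y x r r' p p' :=
  ⟨h.mem_y, h.mem_x, h.adj_xy.symm, h.mem_r, h.mem_r', h.adj_r, h.mem_p, h.mem_p', h.adj_p⟩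

theorem PairedPort.flip {i : Fin 4} {x y p p' r r' : V} (h : PairedPort G q i x y p p' r r') :
    PairedPort G q i x y p' p r r' :=
  ⟨h.mem_x, h.mem_y, h.adj_xy, h.mem_p', h.mem_p, h.adj_p.symm, h.mem_r, h.mem_r', h.adj_r⟩

namespace IsK4

theorem eq_of_adj_of_adj (hC : C5Free G) {i : Fin 4} {x y t s p : V} (hx : x ∈ portX G q i)
    (hy : y ∈ portX G q i) (hxy : G.Adj x y) (ht : t ∈ children G (q i) x)
    (hs : s ∈ children G (q i) y) (hpx : p ≠ x) (hpy : p ≠ y) (hpt : G.Adj p t)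
    (hps : G.Adj p s) : t = s := by
  by_contra hts
  rw [mem_children] at ht hs
  refine hC p t x y s hpt ht.1.symm hxy hs.1 hps.symm hpx hpy ?_ hts ?_
  · rintro rfl; exact ht.2.1 (adj_of_mem hy)
  · rintro rfl; exact hs.2.1 (adj_of_mem hx)

theorem eq_of_adj_pair (hC : C5Free G) {i : Fin 4} {x t s p p' : V}
    (ht : t ∈ children G (q i) x) (hs : s ∈ children G (q i) x) (hpx : p ≠ x) (hpx' : p' ≠ x)
    (hpp : G.Adj p p') (hpt : G.Adj p t) (hps : G.Adj p' s) (hps' : p ≠ s) (hpt' : p' ≠ t) :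
    t = s := by
  by_contra hts
  rw [mem_children] at ht hs
  exact hC p p' s x t hpp hps hs.1.symm ht.1 hpt.symm hps' hpx hpx' hpt' (Ne.symm hts)

/-- Two adjacent children of `x` are not children of another vertex of the port. -/
theorem not_adj_of_pair (hC : C5Free G) {i : Fin 4} {x y p p' : V} (hx : x ∈ portX G q i)
    (hy : y ∈ portX G q i) (hxy : x ≠ y) (hp : p ∈ children G (q i) x)
    (hp' : p' ∈ children G (q i) x) (hpp : G.Adj p p') : ¬ G.Adj y p := by
  intro h
  rw [mem_children] at hp hp'
  exact hxy (hC.parents_eq (adj_of_mem hx) (adj_of_mem hy) hp'.2.1 hp'.2.2 hp.2.1 hp.2.2 hp'.1 h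
    hpp.symm)

/-- A private child in a port meets every independent set of maximum size in another port. -/
theorem exists_adj_of_private (hq : IsK4 G q) (hC : C5Free G) (hα : AlphaLE G k)
    (hX : ∀ i, (portX G q i).Nonempty) {i j : Fin 4} (hij : i ≠ j) {x y p : V}
    (hx : x ∈ portX G q i) (hy : y ∈ portX G q i) (hp : p ∈ children G (q i) x)
    (hyp : ¬ G.Adj y p) {J : Finset V} (hJ : J ⊆ portT G q j) (iJ : Indep G J)
    (hk : k ≤ J.card + 4) : ∃ s ∈ J, G.Adj p s := by
  by_contra! hno
  have hpT := children_subset hx hp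
  have := hq.card_two_le hC hα hX hij.symm hJ (A := {y, p})
    (Finset.insert_subset (Finset.mem_union_left _ hy)
      (Finset.singleton_subset_iff.2 (Finset.mem_union_right _ hpT))) iJ (Indep.pair hyp) (by
    intro s hs z hz
    simp only [Finset.mem_insert, Finset.mem_singleton] at hz
    rcases hz with rfl | rfl
    · exact fun h => hq.not_adj_XT hC hij.symm hy (hJ hs) h.symm
    · exact fun h => hno s hs h.symm)
  rw [Finset.card_pair (hq.T_ne_X hC hpT hy).symm] at this
  omega

end IsK4

theorem SharedPort.mem_children_of_mem {i : Fin 4} (hq : IsK4 G q) (hC : C5Free G)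
    (h : SharedPort G q k i) {x t : V} (hx : x ∈ portX G q i)
    (ht : t ∈ portT G q i) : t ∈ children G (q i) x :=
  mem_children.2 ⟨h.adj_T x hx t ht, hq.not_adj_T hC ht, hq.T_ne ht⟩

theorem SharedPort.exists_pair {i : Fin 4} (h : SharedPort G q k i) :
    ∃ x ∈ portX G q i, ∃ y ∈ portX G q i, G.Adj x y := by
  obtain ⟨x, hx, y, hy, hxy⟩ := Finset.one_lt_card.1 (by rw [h.card_X]; omega)
  exact ⟨x, hx, y, hy, h.adj_X x hx y hy hxy⟩

/-- Two adjacent private children of a port see a common vertex of a shared port. -/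
theorem SharedPort.exists_common (hq : IsK4 G q) (hC : C5Free G) (hα : AlphaLE G k)
    (hX : ∀ i, (portX G q i).Nonempty) {i j : Fin 4} (hij : i ≠ j) {x y p p' : V}
    (hx : x ∈ portX G q i) (hy : y ∈ portX G q i) (hxy : x ≠ y) (hp : p ∈ children G (q i) x)
    (hp' : p' ∈ children G (q i) x) (hpp : G.Adj p p') (hS : SharedPort G q k j) :
    ∃ s ∈ portT G q j, G.Adj p s ∧ G.Adj p' s := by
  have hk : k ≤ (portT G q j).card + 4 := hS.card_T.ge
  obtain ⟨s, hs, hps⟩ := hq.exists_adj_of_private hC hα hX hij hx hy hp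
    (IsK4.not_adj_of_pair hC hx hy hxy hp hp' hpp) le_rfl hS.indep_T hk
  obtain ⟨s', hs', hps'⟩ := hq.exists_adj_of_private hC hα hX hij hx hy hp'
    (IsK4.not_adj_of_pair hC hx hy hxy hp' hp hpp.symm) le_rfl hS.indep_T hk
  obtain ⟨z, hz⟩ := hX j
  have hpT := IsK4.children_subset hx hp
  have hpT' := IsK4.children_subset hx hp'
  have := IsK4.eq_of_adj_pair hC (hS.mem_children_of_mem hq hC hz hs)
    (hS.mem_children_of_mem hq hC hz hs') (hq.T_ne_X hC hpT hz) (hq.T_ne_X hC hpT' hz) hpp hps hps'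
    (hq.T_ne_T hC hij hpT hs') (hq.T_ne_T hC hij hpT' hs)
  exact ⟨s, hs, hps, this ▸ hps'⟩

/-- A paired port excludes two shared ports. -/
theorem PairedPort.false_of_shared (hq : IsK4 G q) (hC : C5Free G) (hα : AlphaLE G k)
    (hX : ∀ i, (portX G q i).Nonempty) {i j l : Fin 4} (hij : i ≠ j) (hil : i ≠ l) (hjl : j ≠ l)
    {x y p p' r r' : V} (hP : PairedPort G q i x y p p' r r') (hj : SharedPort G q k j)
    (hl : SharedPort G q k l) : False := by
  have key : ∀ {x y p p'}, x ∈ portX G q i → y ∈ portX G q i → x ≠ y → p ∈ children G (q i) x →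
      p' ∈ children G (q i) x → G.Adj p p' →
      ∃ u ∈ portT G q l, G.Adj p u ∧ ∀ s ∈ portT G q j, ¬ G.Adj s u := by
    intro x y p p' hx hy hxy hp hp' hpp
    obtain ⟨s, hs, hps, hps'⟩ := hj.exists_common hq hC hα hX hij hx hy hxy hp hp' hpp
    obtain ⟨u, hu, hpu, hpu'⟩ := hl.exists_common hq hC hα hX hil hx hy hxy hp hp' hpp
    refine ⟨u, hu, hpu, fun a ha hau => ?_⟩
    have hpT := IsK4.children_subset hx hp
    by_cases hsa : a = s
    · subst hsa
      exact hC x p a u p' (mem_children.1 hp).1 hps hau hpu'.symm (mem_children.1 hp').1.symm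
        (hq.T_ne_X hC hs hx).symm (hq.T_ne_X hC hu hx).symm (hq.T_ne_T hC hil hpT hu)
        hpp.ne (hq.T_ne_T hC hij (IsK4.children_subset hx hp') hs).symm
    · obtain ⟨z, hz⟩ := hX j
      exact hC a u p s z hau hpu.symm hps (hj.adj_T z hz s hs).symm (hj.adj_T z hz a ha)
        (hq.T_ne_T hC hij hpT ha).symm hsa (hq.T_ne_T hC hjl hs hu).symm
        (hq.T_ne_X hC hu hz) (hq.T_ne_X hC hpT hz)
  obtain ⟨u, hu, hpu, hnu⟩ := key hP.mem_x hP.mem_y hP.adj_xy.ne hP.mem_p hP.mem_p' hP.adj_p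
  obtain ⟨w, hw, hrw, hnw⟩ := key hP.mem_y hP.mem_x hP.adj_xy.ne' hP.mem_r hP.mem_r' hP.adj_r
  have huw : u ≠ w := by
    rintro rfl
    have hpr := IsK4.eq_of_adj_of_adj hC hP.mem_x hP.mem_y hP.adj_xy hP.mem_p hP.mem_r
      (hq.T_ne_X hC hu hP.mem_x) (hq.T_ne_X hC hu hP.mem_y) hpu.symm hrw.symm
    have h1 := IsK4.not_adj_of_pair hC hP.mem_x hP.mem_y hP.adj_xy.ne hP.mem_p hP.mem_p' hP.adj_p
    exact h1 (hpr ▸ (mem_children.1 hP.mem_r).1)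
  have := hq.card_two_le hC hα hX hjl (J := portT G q j) (A := {u, w}) le_rfl
    (Finset.insert_subset (Finset.mem_union_right _ hu)
      (Finset.singleton_subset_iff.2 (Finset.mem_union_right _ hw))) hj.indep_T
    (Indep.pair (hl.indep_T u hu w hw)) (by
    intro s hs z hz
    simp only [Finset.mem_insert, Finset.mem_singleton] at hz
    rcases hz with rfl | rfl
    exacts [hnu s hs, hnw s hs])
  rw [Finset.card_pair huw] at this
  have := hj.card_T
  omega

/-- The vertices outside the complete graph `q` and all its ports. -/
noncomputable def portRest (G : SimpleGraph V) (q : Fin 4 → V) : Finset V :=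
  (Finset.univ.image q ∪ Finset.univ.biUnion fun i => portX G q i ∪ portT G q i)ᶜ

theorem mem_portRest {r : V} : r ∈ portRest G q ↔
    (∀ i, r ≠ q i) ∧ (∀ i, r ∉ portX G q i) ∧ ∀ i, r ∉ portT G q i := by
  simp only [portRest, Finset.mem_compl, Finset.mem_union, Finset.mem_image, Finset.mem_univ,
    true_and, Finset.mem_biUnion, not_or, not_exists]
  exact ⟨fun h => ⟨fun i => (Ne.symm (h.1 i)), fun i => (h.2 i).1, fun i => (h.2 i).2⟩,
    fun h => ⟨fun i => (h.1 i).symm, fun i => ⟨h.2.1 i, h.2.2 i⟩⟩⟩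

theorem not_adj_portRest {r x : V} {i : Fin 4} (hr : r ∈ portRest G q) (hx : x ∈ portX G q i) :
    ¬ G.Adj x r := by
  rw [mem_portRest] at hr
  intro h
  have h1 : ¬ G.Adj (q i) r := fun h => hr.2.1 i (mem_portX.2 ⟨h, hr.1⟩)
  exact hr.2.2 i (IsK4.children_subset hx (mem_children.2 ⟨h, h1, hr.1 i⟩))

/-- An independent set formed by children of port `i` and vertices outside all ports combines with
`q i` and a vertex from each other port. -/
theorem IsK4.card_rest_le (hq : IsK4 G q) (hC : C5Free G) (hα : AlphaLE G k)
    (hX : ∀ i, (portX G q i).Nonempty) (i : Fin 4) {J : Finset V}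
    (hJ : J ⊆ portT G q i ∪ portRest G q) (iJ : Indep G J) : J.card + 4 ≤ k := by
  choose x hx using hX
  have hnX : ∀ j ≠ i, ∀ w ∈ J, ¬ G.Adj (x j) w ∧ w ≠ x j := by
    intro j hj w hw
    rcases Finset.mem_union.1 (hJ hw) with h | h
    · exact ⟨hq.not_adj_XT hC hj.symm (hx j) h, hq.T_ne_X hC h (hx j)⟩
    · refine ⟨not_adj_portRest h (hx j), ?_⟩
      rintro rfl
      exact (mem_portRest.1 h).2.1 j (hx j)
  have hxx : Set.InjOn x ((Finset.univ : Finset (Fin 4)).erase i) := by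
    intro a _ b _ hab
    by_contra hne
    exact hq.X_ne_X hC hne (hx a) (hx b) hab
  have hI : Indep G (J ∪ (Finset.univ.erase i).image x) := by
    refine iJ.union ?_ ?_
    · intro a ha b hb hab
      obtain ⟨j, -, rfl⟩ := Finset.mem_image.1 ha
      obtain ⟨l, -, rfl⟩ := Finset.mem_image.1 hb
      by_cases hjl : j = l
      · subst hjl; exact G.irrefl hab
      · exact hq.not_adj_XX hC hjl (hx j) (hx l) hab
    · intro w hw b hb hab
      obtain ⟨l, hl, rfl⟩ := Finset.mem_image.1 hb
      exact (hnX l (Finset.ne_of_mem_erase hl) w hw).1 hab.symm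
  have := card_le_of_nonadj hα hI (v := q i) (by
    intro w hw
    rcases Finset.mem_union.1 hw with hw | hw
    · rcases Finset.mem_union.1 (hJ hw) with h | h
      · exact ⟨hq.not_adj_T hC h, hq.T_ne h⟩
      · have h := mem_portRest.1 h
        exact ⟨fun h' => h.2.1 i (mem_portX.2 ⟨h', h.1⟩), h.1 i⟩
    · obtain ⟨l, hl, rfl⟩ := Finset.mem_image.1 hw
      exact ⟨hq.not_adj_X hC (Finset.ne_of_mem_erase hl) (hx l), (mem_portX.1 (hx l)).2 i⟩)
  rw [Finset.card_union_of_disjoint, Finset.card_image_of_injOn hxx] at this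
  · simp at this
    omega
  · rw [Finset.disjoint_left]
    intro w hw hb
    obtain ⟨l, hl, rfl⟩ := Finset.mem_image.1 hb
    exact (hnX l (Finset.ne_of_mem_erase hl) _ hw).2 rfl

/-- Four shared ports are impossible in a graph with many vertices. -/
theorem SharedPort.false_of_all (hq : IsK4 G q) (hC : C5Free G) (hα : AlphaLE G k)
    (hk : k ≤ 7) (hn : 5 * k ≤ Fintype.card V + 6) (hS : ∀ i, SharedPort G q k i) : False := by
  have hX : ∀ i, (portX G q i).Nonempty := fun i =>
    Finset.card_pos.1 (by rw [(hS i).card_X]; omega)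
  have hR : k ≤ (portRest G q).card + 2 := by
    have h1 : (Finset.univ.image q ∪ Finset.univ.biUnion
        fun i => portX G q i ∪ portT G q i).card ≤ 4 + ∑ i : Fin 4, (2 + (k - 4)) := by
      refine (Finset.card_union_le _ _).trans ?_
      refine Nat.add_le_add hq.image_card.le (Finset.card_biUnion_le.trans ?_)
      refine Finset.sum_le_sum fun i _ => (Finset.card_union_le _ _).trans ?_
      have h1 := (hS i).card_X
      have h2 := (hS i).card_T
      omega
    simp only [Finset.sum_const, Finset.card_univ, Fintype.card_fin, smul_eq_mul] at h1
    have h2 := Finset.card_compl (Finset.univ.image q ∪ Finset.univ.biUnion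
        fun i => portX G q i ∪ portT G q i)
    have h3 : (portRest G q).card = _ := h2
    have h4 := (hS 0).card_T
    omega
  have hne : ∀ {r t i}, r ∈ portRest G q → t ∈ portT G q i → r ≠ t := by
    rintro r t i hr ht rfl
    exact (mem_portRest.1 hr).2.2 i ht
  have hneX : ∀ {r x i}, r ∈ portRest G q → x ∈ portX G q i → r ≠ x := by
    rintro r t i hr ht rfl
    exact (mem_portRest.1 hr).2.1 i ht
  have hex : ∀ r i, r ∈ portRest G q → ∃ t ∈ portT G q i, G.Adj r t := by
    intro r i hr
    by_contra! hno
    have := hq.card_rest_le hC hα hX i (J := insert r (portT G q i))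
      (Finset.insert_subset (Finset.mem_union_right _ hr) Finset.subset_union_left)
      ((hS i).indep_T.insert hno)
    rw [Finset.card_insert_of_notMem fun h => hne hr h rfl] at this
    have := (hS i).card_T
    omega
  choose! φ hφT hφ using hex
  have huniq : ∀ r i, r ∈ portRest G q → ∀ t ∈ portT G q i, G.Adj r t → t = φ r i := by
    intro r i hr t ht hrt
    obtain ⟨x, hx, y, hy, hxy⟩ := (hS i).exists_pair
    exact IsK4.eq_of_adj_of_adj hC hx hy hxy ((hS i).mem_children_of_mem hq hC hx ht)
      ((hS i).mem_children_of_mem hq hC hy (hφT r i hr)) (hneX hr hx) (hneX hr hy) hrt (hφ r i hr)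
  have heq : ∀ r s i, r ∈ portRest G q → s ∈ portRest G q → G.Adj r s → φ r i = φ s i := by
    intro r s i hr hs hrs
    obtain ⟨x, hx⟩ := hX i
    exact IsK4.eq_of_adj_pair hC ((hS i).mem_children_of_mem hq hC hx (hφT r i hr))
      ((hS i).mem_children_of_mem hq hC hx (hφT s i hs)) (hneX hr hx) (hneX hs hx) hrs
      (hφ r i hr) (hφ s i hs) (hne hr (hφT s i hs)) (hne hs (hφT r i hr))
  have hadj : ∀ r s i, r ∈ portRest G q → s ∈ portRest G q → r ≠ s → φ r i = φ s i →
      G.Adj r s := by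
    intro r s i hr hs hrs hφs
    by_contra hno
    have hI : Indep G (insert r (insert s ((portT G q i).erase (φ r i)))) := by
      refine Indep.insert (Indep.insert ((hS i).indep_T.mono (Finset.erase_subset _ _)) ?_) ?_
      · intro t ht hst
        rw [Finset.mem_erase] at ht
        exact ht.1 (hφs ▸ huniq s i hs t ht.2 hst)
      · intro t ht hst
        rw [Finset.mem_insert, Finset.mem_erase] at ht
        rcases ht with rfl | ht
        · exact hno hst
        · exact ht.1 (huniq r i hr t ht.2 hst)
    have := hq.card_rest_le hC hα hX i
      (Finset.insert_subset (Finset.mem_union_right _ hr) (Finset.insert_subset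
        (Finset.mem_union_right _ hs)
        ((Finset.erase_subset _ _).trans Finset.subset_union_left))) hI
    rw [Finset.card_insert_of_notMem, Finset.card_insert_of_notMem,
      Finset.card_erase_of_mem (hφT r i hr)] at this
    · have := (hS i).card_T
      have := Finset.card_pos.2 ⟨_, hφT r i hr⟩
      omega
    · exact fun h => hne hs (Finset.mem_of_mem_erase h) rfl
    · intro h
      rw [Finset.mem_insert] at h
      rcases h with h | h
      · exact hrs h
      · exact hne hr (Finset.mem_of_mem_erase h) rfl
  obtain ⟨r, hr, r', hr', hrr, hφr⟩ := Finset.exists_ne_map_eq_of_card_lt_of_maps_to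
    (s := portRest G q) (t := portT G q 0) (f := fun r => φ r 0)
    (by have := (hS 0).card_T; omega) (fun r hr => hφT r 0 hr)
  obtain ⟨s, hs, s', hs', hss, hφs⟩ := Finset.exists_ne_map_eq_of_card_lt_of_maps_to
    (s := (portRest G q).erase r) (t := portT G q 0) (f := fun r => φ r 0)
    (by have := (hS 0).card_T; rw [Finset.card_erase_of_mem hr]; omega)
    (fun r hr => hφT r 0 (Finset.mem_of_mem_erase hr))
  rw [Finset.mem_erase] at hs hs'
  have rr := hadj r r' 0 hr hr' hrr hφr
  have ss := hadj s s' 0 hs.2 hs'.2 hss hφs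
  have hrs0 : φ r 0 ≠ φ s 0 := by
    intro h
    have h1 := hadj r s 0 hr hs.2 hs.1.symm h
    have h2 := hadj r s' 0 hr hs'.2 hs'.1.symm (h.trans hφs)
    have e1 := heq r s 1 hr hs.2 h1
    have e2 := heq r s' 1 hr hs'.2 h2
    exact hC (φ r 0) r (φ r 1) s s' (hφ r 0 hr).symm (hφ r 1 hr) (e1 ▸ (hφ s 1 hs.2).symm) ss
      (by rw [h, hφs]; exact hφ s' 0 hs'.2)
      (hq.T_ne_T hC (by decide) (hφT r 0 hr) (hφT r 1 hr)) (hne hs.2 (hφT r 0 hr)).symm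
      hs.1.symm hs'.1.symm (hne hs'.2 (hφT r 1 hr)).symm
  have hrs : ¬ G.Adj r s := fun h => hrs0 (heq r s 0 hr hs.2 h)
  have hrsi : ∀ i, φ r i ≠ φ s i := fun i h => hrs (hadj r s i hr hs.2 hs.1.symm h)
  have self : ∀ r r', r ∈ portRest G q → r' ∈ portRest G q → G.Adj r r' → ∀ i j,
      ¬ G.Adj (φ r i) (φ r j) := by
    intro r r' hr hr' hrr i j hij
    have hne' : i ≠ j := by rintro rfl; exact G.irrefl hij
    obtain ⟨l, -, hli, hlj, -⟩ := exists_two_others hne'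
    have e1 := heq r r' j hr hr' hrr
    have e2 := heq r r' l hr hr' hrr
    exact hC (φ r l) r (φ r i) (φ r j) r' (hφ r l hr).symm (hφ r i hr) hij
      (e1 ▸ (hφ r' j hr').symm) (e2 ▸ hφ r' l hr')
      (hq.T_ne_T hC hli (hφT r l hr) (hφT r i hr)) (hq.T_ne_T hC hlj (hφT r l hr) (hφT r j hr))
      (hne hr (hφT r j hr)) hrr.ne (hne hr' (hφT r i hr)).symm
  have cross : ∀ i j, ¬ G.Adj (φ r i) (φ s j) := by
    intro i j hij
    by_cases hne' : i = j
    · subst hne'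
      exact (hS i).indep_T _ (hφT r i hr) _ (hφT s i hs.2) hij
    · obtain ⟨x, hx⟩ := hX i
      exact hC (φ r i) (φ s j) s (φ s i) x hij (hφ s j hs.2).symm (hφ s i hs.2)
        ((hS i).adj_T x hx _ (hφT s i hs.2)).symm ((hS i).adj_T x hx _ (hφT r i hr))
        (hne hs.2 (hφT r i hr)).symm (hrsi i)
        (hq.T_ne_T hC hne' (hφT s i hs.2) (hφT s j hs.2)).symm
        (hq.T_ne_X hC (hφT s j hs.2) hx) (hneX hs.2 hx)
  have hcard := hα (Finset.univ.image (φ r) ∪ Finset.univ.image (φ s)) (by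
    refine Indep.union ?_ ?_ ?_
    all_goals
      intro a ha b hb
      obtain ⟨i, -, rfl⟩ := Finset.mem_image.1 ha
      obtain ⟨j, -, rfl⟩ := Finset.mem_image.1 hb
    · exact self r r' hr hr' rr i j
    · exact self s s' hs.2 hs'.2 ss i j
    · exact cross i j)
  have hinj : ∀ r ∈ portRest G q, Function.Injective (φ r) := by
    intro r hr a b hab
    by_contra hne
    exact hq.T_ne_T hC hne (hφT r a hr) (hφT r b hr) hab
  rw [Finset.card_union_of_disjoint, Finset.card_image_of_injective _ (hinj r hr),
    Finset.card_image_of_injective _ (hinj s hs.2)] at hcard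
  · simp at hcard
    omega
  · rw [Finset.disjoint_left]
    intro a ha hb
    obtain ⟨i, -, rfl⟩ := Finset.mem_image.1 ha
    obtain ⟨j, -, h⟩ := Finset.mem_image.1 hb
    by_cases hij : i = j
    · subst hij; exact hrsi i h.symm
    · exact hq.T_ne_T hC hij (hφT r i hr) (hφT s j hs.2) h.symm

end PortTypes

section CliquePorts

variable {V : Type} [Fintype V] {G : SimpleGraph V} {k : ℕ} {q : Fin 4 → V}

/-- A vertex outside a complete graph on four vertices is adjacent to at most one of them. -/
theorem C5Free.false_of_adj_two (hC : C5Free G) {v a b c d : V} (hac : G.Adj a c)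
    (hcd : G.Adj c d) (hdb : G.Adj d b) (hab : a ≠ b) (had : a ≠ d) (hcb : c ≠ b)
    (hvc : v ≠ c) (hvd : v ≠ d) (ha : G.Adj v a) (hb : G.Adj v b) : False :=
  hC v a c d b ha hac hcd hdb hb.symm hvc hvd had hab hcb

/-- The neighbours of `q i` outside `q` form a clique. -/
def CliquePort (G : SimpleGraph V) (q : Fin 4 → V) (i : Fin 4) : Prop :=
  ∀ x ∈ portX G q i, ∀ y ∈ portX G q i, x ≠ y → G.Adj x y

namespace CliquePort

variable {i : Fin 4}

theorem card_X_le (hC : C5Free G) (h : CliquePort G q i) : (portX G q i).card ≤ 3 := by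
  by_contra! hcard
  obtain ⟨s, hs, hs4⟩ := Finset.exists_subset_card_eq (show 4 ≤ (portX G q i).card by omega)
  obtain ⟨a, b, c, d, hab, hac, had, hbc, hbd, hcd, rfl⟩ := Finset.card_eq_four.1 hs4
  have ha : a ∈ portX G q i := hs (by simp)
  have hb : b ∈ portX G q i := hs (by simp)
  have hc : c ∈ portX G q i := hs (by simp)
  have hd : d ∈ portX G q i := hs (by simp)
  exact hC.no_path_in_nbrs (IsK4.adj_of_mem ha) (IsK4.adj_of_mem hb) (IsK4.adj_of_mem hc)
    (IsK4.adj_of_mem hd) (h a ha b hb hab) (h b hb c hc hbc) (h c hc d hd hcd) hac had hbd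

theorem card_inter (h : CliquePort G q i) {x : V} (hx : x ∈ portX G q i) :
    (portX G q i ∩ nbrs G x).card + 1 = (portX G q i).card := by
  have : portX G q i ∩ nbrs G x = (portX G q i).erase x := by
    ext y
    simp only [Finset.mem_inter, mem_nbrs, Finset.mem_erase]
    exact ⟨fun h => ⟨h.2.ne', h.1⟩, fun hy => ⟨hy.2, h x hx y hy.2 hy.1.symm⟩⟩
  rw [this, Finset.card_erase_add_one hx]

theorem card_children (hq : IsK4 G q) (hC : C5Free G) (h : CliquePort G q i) {x : V}
    (hx : x ∈ portX G q i) :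
    (nbrs G x).card = (children G (q i) x).card + (portX G q i).card := by
  rw [hq.card_nbrs_X hC hx, ← h.card_inter hx, add_assoc]

/-- In a clique port with three vertices no child is shared. -/
theorem not_mem_children (hC : C5Free G) (h : CliquePort G q i)
    (h3 : 3 ≤ (portX G q i).card) {x y t : V} (hx : x ∈ portX G q i) (hy : y ∈ portX G q i)
    (hxy : x ≠ y) (ht : t ∈ children G (q i) x) : t ∉ children G (q i) y := by
  intro ht'
  have h1 := IsK4.card_X_inter_le_one hC hx hy hxy ht ht'
  have h2 := h.card_inter hx
  omega

/-- A shared child is not adjacent to any child. -/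
theorem not_adj_shared (hC : C5Free G) {x y s t : V} (hx : x ∈ portX G q i)
    (hy : y ∈ portX G q i) (hxy : x ≠ y) (hs : s ∈ children G (q i) x)
    (hs' : s ∈ children G (q i) y) (ht : t ∈ portT G q i) : ¬ G.Adj s t := by
  obtain ⟨z, hz, ht⟩ := mem_portT.1 ht
  by_cases h : x = z
  · subst h
    exact nonadj_children hC (IsK4.adj_of_mem hy) (IsK4.adj_of_mem hz) hxy.symm hs' ht
  · exact nonadj_children hC (IsK4.adj_of_mem hx) (IsK4.adj_of_mem hz) h hs ht

end CliquePort

theorem PairedPort.ne {i : Fin 4} {x y p p' r r' : V} (hC : C5Free G)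
    (h : PairedPort G q i x y p p' r r') : p ≠ r := by
  rintro rfl
  exact IsK4.not_adj_of_pair hC h.mem_x h.mem_y h.adj_xy.ne h.mem_p h.mem_p' h.adj_p
    (mem_children.1 h.mem_r).1

theorem PairedPort.not_adj {i : Fin 4} {x y p p' r r' : V} (hC : C5Free G)
    (h : PairedPort G q i x y p p' r r') : ¬ G.Adj p r :=
  nonadj_children hC (IsK4.adj_of_mem h.mem_x) (IsK4.adj_of_mem h.mem_y) h.adj_xy.ne h.mem_p h.mem_r

/-- No vertex outside the port sees children of both vertices of a paired port. -/
theorem PairedPort.not_adj_both (hq : IsK4 G q) {i j : Fin 4} {x y p p' r r' t : V} (hC : C5Free G)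
    (h : PairedPort G q i x y p p' r r') (ht : t ∈ portT G q j) (hp : G.Adj t p)
    (hr : G.Adj t r) : False :=
  h.ne hC (IsK4.eq_of_adj_of_adj hC h.mem_x h.mem_y h.adj_xy h.mem_p h.mem_r
    (hq.T_ne_X hC ht h.mem_x) (hq.T_ne_X hC ht h.mem_y) hp hr)

/-- Adjacent children of port `i` do not see different children of the same vertex of port `j`. -/
theorem IsK4.eq_of_adj_pair' (hq : IsK4 G q) (hC : C5Free G) {i j : Fin 4} (hij : i ≠ j)
    {x t s p p' : V} (hx : x ∈ portX G q j) (ht : t ∈ children G (q j) x)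
    (hs : s ∈ children G (q j) x) (hp : p ∈ portT G q i) (hp' : p' ∈ portT G q i)
    (hpp : G.Adj p p') (hpt : G.Adj p t) (hps : G.Adj p' s) : t = s :=
  IsK4.eq_of_adj_pair hC ht hs (hq.T_ne_X hC hp hx) (hq.T_ne_X hC hp' hx) hpp hpt hps
    (hq.T_ne_T hC hij hp (IsK4.children_subset hx hs))
    (hq.T_ne_T hC hij hp' (IsK4.children_subset hx ht))

theorem PairedPort.mem_T {i : Fin 4} {x y p p' r r' : V} (h : PairedPort G q i x y p p' r r') :
    p ∈ portT G q i ∧ p' ∈ portT G q i ∧ r ∈ portT G q i ∧ r' ∈ portT G q i :=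
  ⟨IsK4.children_subset h.mem_x h.mem_p, IsK4.children_subset h.mem_x h.mem_p',
    IsK4.children_subset h.mem_y h.mem_r, IsK4.children_subset h.mem_y h.mem_r'⟩

/-- A private child of port `i` meets every transversal of a paired port. -/
theorem PairedPort.adj_or (hq : IsK4 G q) (hC : C5Free G) (hα : AlphaLE G 6)
    (hX : ∀ i, (portX G q i).Nonempty) {i j : Fin 4} (hij : i ≠ j) {x y p p' r r' u w a a' b b' : V}
    (h : PairedPort G q i x y p p' r r') (h' : PairedPort G q j u w a a' b b') :
    G.Adj p a ∨ G.Adj p b := by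
  obtain ⟨s, hs, hps⟩ := hq.exists_adj_of_private hC hα hX hij h.mem_x h.mem_y h.mem_p
    (IsK4.not_adj_of_pair hC h.mem_x h.mem_y h.adj_xy.ne h.mem_p h.mem_p' h.adj_p) (J := {a, b})
    (Finset.insert_subset h'.mem_T.1 (Finset.singleton_subset_iff.2 h'.mem_T.2.2.1))
    (Indep.pair (h'.not_adj hC)) (by rw [Finset.card_pair (h'.ne hC)])
  simp only [Finset.mem_insert, Finset.mem_singleton] at hs
  rcases hs with rfl | rfl
  exacts [Or.inl hps, Or.inr hps]

theorem PairedPort.adj_split (hq : IsK4 G q) (hC : C5Free G) (hα : AlphaLE G 6)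
    (hX : ∀ i, (portX G q i).Nonempty) {i j : Fin 4} (hij : i ≠ j) {x y p p' r r' u w a a' b b' : V}
    (h : PairedPort G q i x y p p' r r') (h' : PairedPort G q j u w a a' b b') :
    G.Adj p a ∧ G.Adj p' b ∨ G.Adj p b ∧ G.Adj p' a := by
  have hn : ¬ (G.Adj p a ∧ G.Adj p' a') := fun e => h'.adj_p.ne
    (hq.eq_of_adj_pair' hC hij h'.mem_x h'.mem_p h'.mem_p' h.mem_T.1 h.mem_T.2.1 h.adj_p e.1 e.2)
  have hn2 : ¬ (G.Adj p b ∧ G.Adj p' b') := fun e => h'.adj_r.ne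
    (hq.eq_of_adj_pair' hC hij h'.mem_y h'.mem_r h'.mem_r' h.mem_T.1 h.mem_T.2.1 h.adj_p e.1 e.2)
  have hn3 : ¬ (G.Adj p a ∧ G.Adj p b) := fun e => h'.not_adj_both hq hC h.mem_T.1 e.1 e.2
  have hn4 : ¬ (G.Adj p' a ∧ G.Adj p' b) := fun e => h'.not_adj_both hq hC h.mem_T.2.1 e.1 e.2
  have h1 := h.adj_or hq hC hα hX hij h'
  have h2 := h.flip.adj_or hq hC hα hX hij h'
  have h3 := h.flip.adj_or hq hC hα hX hij h'.flip
  have h4 := h.flip.adj_or hq hC hα hX hij h'.swap.flip.swap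
  tauto

/-- There is at most one paired port if there is no independent set of size seven. -/
theorem PairedPort.false_of_paired (hq : IsK4 G q) (hC : C5Free G) (hα : AlphaLE G 6)
    (hX : ∀ i, (portX G q i).Nonempty) {i j : Fin 4} (hij : i ≠ j) {x y p p' r r' u w a a' b b' : V}
    (h : PairedPort G q i x y p p' r r') (h' : PairedPort G q j u w a a' b b') : False := by
  have h1 := h.adj_split hq hC hα hX hij h'
  have h2 := h.swap.adj_split hq hC hα hX hij h'
  have key : ∀ {t}, t ∈ portT G q j → G.Adj p t ∨ G.Adj p' t → G.Adj r t ∨ G.Adj r' t → False := by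
    rintro t ht (hp | hp) (hr | hr)
    · exact h.not_adj_both hq hC ht hp.symm hr.symm
    · exact h.swap.flip.swap.not_adj_both hq hC ht hp.symm hr.symm
    · exact h.flip.not_adj_both hq hC ht hp.symm hr.symm
    · exact h.flip.swap.flip.swap.not_adj_both hq hC ht hp.symm hr.symm
  have := key h'.mem_T.1
  tauto

/-- A clique port with sufficiently many shared children is a shared port. -/
theorem CliquePort.shared_of_card_inter (hC : C5Free G) {i : Fin 4}
    (hα : ∀ J ⊆ portT G q i, Indep G J → J.card + 4 ≤ k) (h : CliquePort G q i)
    (h2 : (portX G q i).card = 2) {x y : V} (hx : x ∈ portX G q i) (hy : y ∈ portX G q i)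
    (hxy : x ≠ y) (hcard : k ≤ (children G (q i) x ∩ children G (q i) y).card + 4) :
    SharedPort G q k i := by
  have hXe : portX G q i = {x, y} := (Finset.eq_of_subset_of_card_le
    (Finset.insert_subset hx (Finset.singleton_subset_iff.2 hy))
    (by rw [h2, Finset.card_pair hxy])).symm
  have hsub : children G (q i) x ∩ children G (q i) y ⊆ portT G q i :=
    Finset.inter_subset_left.trans (IsK4.children_subset hx)
  have hind : ∀ s ∈ children G (q i) x ∩ children G (q i) y, ∀ t ∈ portT G q i, ¬ G.Adj s t := by
    intro s hs t ht
    rw [Finset.mem_inter] at hs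
    exact not_adj_shared hC hx hy hxy hs.1 hs.2 ht
  have hTe : portT G q i = children G (q i) x ∩ children G (q i) y := by
    refine (Finset.Subset.antisymm hsub fun t ht => ?_).symm
    by_contra hno
    have := hα (insert t (children G (q i) x ∩ children G (q i) y)) (Finset.insert_subset ht hsub)
      (Indep.insert (fun s hs s' hs' => hind s hs s' (hsub hs'))
        fun s hs hts => hind s hs t ht hts.symm)
    rw [Finset.card_insert_of_notMem hno] at this
    omega
  refine ⟨h2, h, ?_, ?_, ?_⟩
  · rw [hTe]; exact fun s hs s' hs' => hind s hs s' (hsub hs')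
  · have := hα _ le_rfl (by rw [hTe]; exact fun s hs s' hs' => hind s hs s' (hsub hs'))
    rw [← hTe] at hcard
    omega
  · intro z hz t ht
    rw [hTe, Finset.mem_inter, mem_children, mem_children] at ht
    rw [hXe] at hz
    simp only [Finset.mem_insert, Finset.mem_singleton] at hz
    rcases hz with rfl | rfl
    exacts [ht.1.1, ht.2.1]

end CliquePorts

section LargeDegree

variable {V : Type} [Fintype V] {G : SimpleGraph V} {k : ℕ} {q : Fin 4 → V}

/-- Independent sets of private children combine with the shared children. -/
theorem IsK4.card_private_le (hC : C5Free G) {i : Fin 4}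
    (hα : ∀ J ⊆ portT G q i, Indep G J → J.card + 4 ≤ k) {x y : V} (hx : x ∈ portX G q i)
    (hy : y ∈ portX G q i) (hxy : x ≠ y) {A B : Finset V}
    (hA : A ⊆ children G (q i) x \ children G (q i) y)
    (hB : B ⊆ children G (q i) y \ children G (q i) x) (iA : Indep G A) (iB : Indep G B) :
    (children G (q i) x ∩ children G (q i) y).card + A.card + B.card + 4 ≤ k := by
  have hA' : A ⊆ portT G q i := (hA.trans Finset.sdiff_subset).trans (IsK4.children_subset hx)
  have hB' : B ⊆ portT G q i := (hB.trans Finset.sdiff_subset).trans (IsK4.children_subset hy)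
  have hS : children G (q i) x ∩ children G (q i) y ⊆ portT G q i :=
    Finset.inter_subset_left.trans (IsK4.children_subset hx)
  have hind : ∀ s ∈ children G (q i) x ∩ children G (q i) y, ∀ t ∈ portT G q i, ¬ G.Adj s t := by
    intro s hs t ht
    rw [Finset.mem_inter] at hs
    exact CliquePort.not_adj_shared hC hx hy hxy hs.1 hs.2 ht
  have h := hα (children G (q i) x ∩ children G (q i) y ∪ (A ∪ B))
    (Finset.union_subset hS (Finset.union_subset hA' hB')) (by
      refine Indep.union (fun s hs t ht => hind s hs t (hS ht)) (iA.union iB ?_) ?_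
      · intro a ha b hb
        exact nonadj_children hC (IsK4.adj_of_mem hx) (IsK4.adj_of_mem hy) hxy
          (Finset.mem_sdiff.1 (hA ha)).1 (Finset.mem_sdiff.1 (hB hb)).1
      · exact fun s hs t ht => hind s hs t (Finset.union_subset hA' hB' ht))
  rw [Finset.card_union_of_disjoint, Finset.card_union_of_disjoint] at h
  · omega
  · rw [Finset.disjoint_left]
    intro a ha hb
    exact (Finset.mem_sdiff.1 (hA ha)).2 (Finset.mem_sdiff.1 (hB hb)).1
  · rw [Finset.disjoint_left]
    intro a ha hb
    rw [Finset.mem_inter] at ha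
    rcases Finset.mem_union.1 hb with hb | hb
    · exact (Finset.mem_sdiff.1 (hA hb)).2 ha.2
    · exact (Finset.mem_sdiff.1 (hB hb)).2 ha.1

theorem CliquePort.shared_or_paired (hq : IsK4 G q) (hC : C5Free G)
    (hδ : ∀ v, 4 ≤ (nbrs G v).card) {i : Fin 4}
    (hα : ∀ J ⊆ portT G q i, Indep G J → J.card + 4 ≤ 6) (h : CliquePort G q i)
    (h2 : 2 ≤ (portX G q i).card) :
    SharedPort G q 6 i ∨ ∃ x y p p' r r', PairedPort G q i x y p p' r r' := by
  have hcard : (portX G q i).card = 2 := by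
    by_contra hne
    have h3 : 2 < (portX G q i).card := by omega
    have h3' := h.card_X_le hC
    obtain ⟨x, y, z, hx, hy, hz, hxy, hxz, hyz⟩ := Finset.two_lt_card_iff.1 h3
    have hch : ∀ v ∈ portX G q i, (children G (q i) v).Nonempty := by
      intro v hv
      have e1 := h.card_children hq hC hv
      have e2 := hδ v
      exact Finset.card_pos.1 (by omega)
    obtain ⟨a, ha⟩ := hch x hx
    obtain ⟨b, hb⟩ := hch y hy
    obtain ⟨c, hc⟩ := hch z hz
    have hab := nonadj_children hC (IsK4.adj_of_mem hx) (IsK4.adj_of_mem hy) hxy ha hb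
    have hac := nonadj_children hC (IsK4.adj_of_mem hx) (IsK4.adj_of_mem hz) hxz ha hc
    have hbc := nonadj_children hC (IsK4.adj_of_mem hy) (IsK4.adj_of_mem hz) hyz hb hc
    have nab : a ≠ b := by rintro rfl; exact h.not_mem_children hC (by omega) hx hy hxy ha hb
    have nac : a ≠ c := by rintro rfl; exact h.not_mem_children hC (by omega) hx hz hxz ha hc
    have nbc : b ≠ c := by rintro rfl; exact h.not_mem_children hC (by omega) hy hz hyz hb hc
    have := hα {a, b, c} (by
      simp only [Finset.insert_subset_iff, Finset.singleton_subset_iff]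
      exact ⟨IsK4.children_subset hx ha, IsK4.children_subset hy hb, IsK4.children_subset hz hc⟩)
      ((Indep.pair hbc).insert (by simp [hab, hac]))
    rw [Finset.card_eq_three.2 ⟨a, b, c, nab, nac, nbc, rfl⟩] at this
    omega
  obtain ⟨x, hx, y, hy, hxy⟩ := Finset.one_lt_card.1 (show 1 < (portX G q i).card by omega)
  by_cases hS : 2 ≤ (children G (q i) x ∩ children G (q i) y).card
  · exact Or.inl (h.shared_of_card_inter hC hα hcard hx hy hxy (by omega))
  have ex := h.card_children hq hC hx
  have ey := h.card_children hq hC hy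
  have dx := hδ x
  have dy := hδ y
  have sx := Finset.card_sdiff_add_card_inter (children G (q i) x) (children G (q i) y)
  have sy := Finset.card_sdiff_add_card_inter (children G (q i) y) (children G (q i) x)
  have hcomm := congrArg Finset.card (Finset.inter_comm (children G (q i) x) (children G (q i) y))
  have hpriv : ∀ {A B : Finset V}, A ⊆ children G (q i) x \ children G (q i) y →
      B ⊆ children G (q i) y \ children G (q i) x → Indep G A → Indep G B → _ :=
    fun hA hB iA iB => IsK4.card_private_le hC hα hx hy hxy hA hB iA iB
  obtain ⟨a, ha⟩ := Finset.card_pos.1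
    (show 0 < (children G (q i) x \ children G (q i) y).card by omega)
  obtain ⟨b, hb⟩ := Finset.card_pos.1
    (show 0 < (children G (q i) y \ children G (q i) x).card by omega)
  have h0 := hpriv (Finset.singleton_subset_iff.2 ha) (Finset.singleton_subset_iff.2 hb)
    (Indep.singleton a) (Indep.singleton b)
  simp only [Finset.card_singleton] at h0
  obtain ⟨p, hp, p', hp', hpp⟩ := Finset.one_lt_card.1
    (show 1 < (children G (q i) x \ children G (q i) y).card by omega)
  obtain ⟨r, hr, r', hr', hrr⟩ := Finset.one_lt_card.1
    (show 1 < (children G (q i) y \ children G (q i) x).card by omega)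
  have app : G.Adj p p' := by
    by_contra hno
    have := hpriv (Finset.insert_subset hp (Finset.singleton_subset_iff.2 hp'))
      (Finset.singleton_subset_iff.2 hb) (Indep.pair hno) (Indep.singleton b)
    rw [Finset.card_pair hpp, Finset.card_singleton] at this
    omega
  have arr : G.Adj r r' := by
    by_contra hno
    have := hpriv (Finset.singleton_subset_iff.2 ha)
      (Finset.insert_subset hr (Finset.singleton_subset_iff.2 hr')) (Indep.singleton a)
      (Indep.pair hno)
    rw [Finset.card_pair hrr, Finset.card_singleton] at this
    omega
  exact Or.inr ⟨x, y, p, p', r, r', hx, hy, h x hx y hy hxy, (Finset.mem_sdiff.1 hp).1,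
    (Finset.mem_sdiff.1 hp').1, app, (Finset.mem_sdiff.1 hr).1, (Finset.mem_sdiff.1 hr').1, arr⟩

/-- In a large graph of minimum degree four without independent sets of size seven, every complete
subgraph on four vertices has a vertex of degree four. -/
theorem IsK4.false_of_alpha_six (hq : IsK4 G q) (hC : C5Free G) (hα : AlphaLE G 6)
    (hδ : ∀ v, 4 ≤ (nbrs G v).card) (hX : ∀ i, 2 ≤ (portX G q i).card)
    (hn : 24 ≤ Fintype.card V) : False := by
  have hX' : ∀ i, (portX G q i).Nonempty := fun i => Finset.card_pos.1 (by have := hX i; omega)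
  have hcl : ∀ i, CliquePort G q i := by
    intro i x hx y hy hxy
    by_contra hno
    obtain ⟨j, hij⟩ := exists_ne i
    obtain ⟨u, hu, w, hw, t, ht, s, hs, -, hts, hadj⟩ := hq.exists_indep_pair hC hδ (hX j)
    have := hq.card_T_add_card_X_le hC hα hX' hij (J := {t, s}) (A := {x, y})
      (Finset.insert_subset (IsK4.children_subset hu ht)
        (Finset.singleton_subset_iff.2 (IsK4.children_subset hw hs)))
      (Finset.insert_subset hx (Finset.singleton_subset_iff.2 hy)) (Indep.pair hadj)
      (Indep.pair hno)
    rw [Finset.card_pair hts, Finset.card_pair hxy] at this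
    omega
  have htype := fun i => (hcl i).shared_or_paired hq hC hδ
    (fun J hJ iJ => hq.card_one_le hC hα hX' hJ iJ) (hX i)
  by_cases hall : ∀ i, SharedPort G q 6 i
  · exact SharedPort.false_of_all hq hC hα (by omega) (by omega) hall
  · push Not at hall
    obtain ⟨i, hi⟩ := hall
    obtain ⟨x, y, p, p', r, r', hP⟩ := (htype i).resolve_left hi
    have hS : ∀ j, i ≠ j → SharedPort G q 6 j := by
      intro j hij
      refine (htype j).resolve_right ?_
      rintro ⟨u, w, a, a', b, b', hP'⟩
      exact hP.false_of_paired hq hC hα hX' hij hP'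
    obtain ⟨j, hij, -⟩ := exists_other i i i
    obtain ⟨l, hil, hjl, -⟩ := exists_other i j j
    exact hP.false_of_shared hq hC hα hX' hij hil hjl (hS j hij) (hS l hil)

end LargeDegree

section AlphaSeven

variable {V : Type} [Fintype V] {G : SimpleGraph V} {q : Fin 4 → V}

/-- A paired port with a child `s` of both vertices. -/
structure SplitPort (G : SimpleGraph V) (q : Fin 4 → V) (i : Fin 4) (x y s p p' r r' : V) : Prop
    extends PairedPort G q i x y p p' r r' where
  mem_s : s ∈ children G (q i) x
  mem_s' : s ∈ children G (q i) y

/-- A paired port in which one vertex has three pairwise adjacent children and the other one has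
three children. -/
structure TrianglePort (G : SimpleGraph V) (q : Fin 4 → V) (i : Fin 4) (x y p p' p'' r r' r'' : V) :
    Prop extends PairedPort G q i x y p p' r r' where
  mem_p'' : p'' ∈ children G (q i) x
  adj_pp'' : G.Adj p p''
  adj_p'p'' : G.Adj p' p''
  mem_r'' : r'' ∈ children G (q i) y
  ne_rr'' : r ≠ r''
  ne_r'r'' : r' ≠ r''

/-- A port with three pairwise adjacent vertices each having two adjacent children. -/
structure TriplePort (G : SimpleGraph V) (q : Fin 4 → V) (i : Fin 4) (x y z p p' r r' a a' : V) :
    Prop extends PairedPort G q i x y p p' r r' where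
  mem_z : z ∈ portX G q i
  adj_xz : G.Adj x z
  adj_yz : G.Adj y z
  mem_a : a ∈ children G (q i) z
  mem_a' : a' ∈ children G (q i) z
  adj_a : G.Adj a a'

theorem SplitPort.swap {i : Fin 4} {x y s p p' r r' : V} (h : SplitPort G q i x y s p p' r r') :
    SplitPort G q i y x s r r' p p' := ⟨h.toPairedPort.swap, h.mem_s', h.mem_s⟩

theorem SplitPort.flip {i : Fin 4} {x y s p p' r r' : V} (h : SplitPort G q i x y s p p' r r') :
    SplitPort G q i x y s p' p r r' := ⟨h.toPairedPort.flip, h.mem_s, h.mem_s'⟩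

theorem TriplePort.flip {i : Fin 4} {x y z p p' r r' a a' : V}
    (h : TriplePort G q i x y z p p' r r' a a') : TriplePort G q i x y z p' p r r' a a' :=
  ⟨h.toPairedPort.flip, h.mem_z, h.adj_xz, h.adj_yz, h.mem_a, h.mem_a', h.adj_a⟩

theorem TriplePort.rotate {i : Fin 4} {x y z p p' r r' a a' : V}
    (h : TriplePort G q i x y z p p' r r' a a') : TriplePort G q i y z x r r' a a' p p' :=
  ⟨⟨h.mem_y, h.mem_z, h.adj_yz, h.mem_r, h.mem_r', h.adj_r, h.mem_a, h.mem_a', h.adj_a⟩,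
    h.mem_x, h.adj_xy.symm, h.adj_xz.symm, h.mem_p, h.mem_p', h.adj_p⟩

theorem TrianglePort.rotate {i : Fin 4} {x y p p' p'' r r' r'' : V}
    (h : TrianglePort G q i x y p p' p'' r r' r'') : TrianglePort G q i x y p' p'' p r r' r'' :=
  ⟨⟨h.mem_x, h.mem_y, h.adj_xy, h.mem_p', h.mem_p'', h.adj_p'p'', h.mem_r, h.mem_r', h.adj_r⟩,
    h.mem_p, h.adj_p.symm, h.adj_pp''.symm, h.mem_r'', h.ne_rr'', h.ne_r'r''⟩

/-- A vertex outside a triangle port sees at most one vertex of the triangle. -/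
theorem TrianglePort.not_adj_both (hq : IsK4 G q) (hC : C5Free G) {i j : Fin 4} (hij : i ≠ j)
    {x y p p' p'' r r' r'' t : V} (h : TrianglePort G q i x y p p' p'' r r' r'')
    (ht : t ∈ portT G q j) (h1 : G.Adj t p) (h2 : G.Adj t p') : False := by
  have h3 := (mem_children.1 h.mem_p).1
  exact hC.false_of_adj_two h.adj_pp'' (mem_children.1 h.mem_p'').1.symm
    (mem_children.1 h.mem_p').1 h.adj_p.ne h3.ne' h.adj_p'p''.ne'
    (hq.T_ne_T hC hij (IsK4.children_subset h.mem_x h.mem_p'') ht).symm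
    (hq.T_ne_X hC ht h.mem_x) h1 h2

section

variable {i j l : Fin 4}

theorem PairedPort.exists_adj_of_three (hq : IsK4 G q) (hC : C5Free G) (hα : AlphaLE G 7)
    (hX : ∀ i, (portX G q i).Nonempty) (hij : i ≠ j)
    {x y p p' r r' a b c : V} (h : PairedPort G q i x y p p' r r')
    (ha : a ∈ portT G q j) (hb : b ∈ portT G q j) (hc : c ∈ portT G q j)
    (hab : a ≠ b) (hac : a ≠ c) (hbc : b ≠ c) (nab : ¬ G.Adj a b) (nac : ¬ G.Adj a c)
    (nbc : ¬ G.Adj b c) : G.Adj p a ∨ G.Adj p b ∨ G.Adj p c := by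
  obtain ⟨s, hs, hps⟩ := hq.exists_adj_of_private hC hα hX hij h.mem_x h.mem_y h.mem_p
    (IsK4.not_adj_of_pair hC h.mem_x h.mem_y h.adj_xy.ne h.mem_p h.mem_p' h.adj_p) (J := {a, b, c})
    (by simp [Finset.insert_subset_iff, ha, hb, hc])
    ((Indep.pair nbc).insert (by simp [nab, nac]))
    (by rw [Finset.card_eq_three.2 ⟨a, b, c, hab, hac, hbc, rfl⟩])
  simp only [Finset.mem_insert, Finset.mem_singleton] at hs
  rcases hs with rfl | rfl | rfl
  exacts [Or.inl hps, Or.inr (Or.inl hps), Or.inr (Or.inr hps)]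

theorem PairedPort.adj_or_of_triple (hq : IsK4 G q) (hC : C5Free G) (hα : AlphaLE G 7)
    (hX : ∀ i, (portX G q i).Nonempty) (hij : i ≠ j)
    {x y p p' r r' u w v a a' b b' c c' : V}
    (h : PairedPort G q i x y p p' r r') (h' : TriplePort G q j u w v a a' b b' c c') :
    G.Adj p a ∨ G.Adj p b ∨ G.Adj p c :=
  h.exists_adj_of_three hq hC hα hX hij h'.mem_T.1 h'.mem_T.2.2.1 h'.rotate.mem_T.2.2.1
    (h'.ne hC) (h'.rotate.rotate.ne hC).symm (h'.rotate.ne hC)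
    (h'.not_adj hC) (fun e => h'.rotate.rotate.not_adj hC e.symm) (h'.rotate.not_adj hC)

/-- A private child sees both children in one class of a triple port, and none in the others. -/
theorem PairedPort.adj_class_of_triple (hq : IsK4 G q) (hC : C5Free G) (hα : AlphaLE G 7)
    (hX : ∀ i, (portX G q i).Nonempty) (hij : i ≠ j)
    {x y p p' r r' u w v a a' b b' c c' : V}
    (h : PairedPort G q i x y p p' r r') (h' : TriplePort G q j u w v a a' b b' c c') :
    (G.Adj p a ∧ G.Adj p a') ∨ (G.Adj p b ∧ G.Adj p b') ∨ (G.Adj p c ∧ G.Adj p c') := by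
  have flip2 := h'.rotate.flip.rotate.rotate
  have flip3 := h'.rotate.rotate.flip.rotate
  have h1 := h.adj_or_of_triple hq hC hα hX hij h'
  have h2 := h.adj_or_of_triple hq hC hα hX hij h'.flip
  have h3 := h.adj_or_of_triple hq hC hα hX hij flip2
  have h4 := h.adj_or_of_triple hq hC hα hX hij flip3
  have n1 : ¬ (G.Adj p a ∧ G.Adj p b) := fun e => h'.not_adj_both hq hC h.mem_T.1 e.1 e.2
  have n2 : ¬ (G.Adj p b ∧ G.Adj p c) := fun e => h'.rotate.not_adj_both hq hC h.mem_T.1 e.1 e.2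
  have n3 : ¬ (G.Adj p c ∧ G.Adj p a) :=
    fun e => h'.rotate.rotate.not_adj_both hq hC h.mem_T.1 e.1 e.2
  have n4 : ¬ (G.Adj p a' ∧ G.Adj p b) := fun e => h'.flip.not_adj_both hq hC h.mem_T.1 e.1 e.2
  have n5 : ¬ (G.Adj p c ∧ G.Adj p a') :=
    fun e => h'.flip.rotate.rotate.not_adj_both hq hC h.mem_T.1 e.1 e.2
  grind

/-- A triple port excludes another paired port. -/
theorem PairedPort.false_of_triple (hq : IsK4 G q) (hC : C5Free G) (hα : AlphaLE G 7)
    (hX : ∀ i, (portX G q i).Nonempty) (hij : i ≠ j)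
    {x y p p' r r' u w v a a' b b' c c' : V}
    (h : PairedPort G q i x y p p' r r') (h' : TriplePort G q j u w v a a' b b' c c') : False := by
  have h1 := h.adj_class_of_triple hq hC hα hX hij h'
  have h2 := h.flip.adj_class_of_triple hq hC hα hX hij h'
  have h3 := h.swap.adj_class_of_triple hq hC hα hX hij h'
  have h4 := h.swap.flip.adj_class_of_triple hq hC hα hX hij h'
  have key : ∀ {t}, t ∈ portT G q j → G.Adj p t ∨ G.Adj p' t → G.Adj r t ∨ G.Adj r' t → False := by
    rintro t ht (hp | hp) (hr | hr)
    · exact h.not_adj_both hq hC ht hp.symm hr.symm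
    · exact h.swap.flip.swap.not_adj_both hq hC ht hp.symm hr.symm
    · exact h.flip.not_adj_both hq hC ht hp.symm hr.symm
    · exact h.flip.swap.flip.swap.not_adj_both hq hC ht hp.symm hr.symm
  have same : ∀ {z t s p p'}, z ∈ portX G q j → t ∈ children G (q j) z → s ∈ children G (q j) z →
      G.Adj t s → p ∈ portT G q i → p' ∈ portT G q i → G.Adj p p' →
      ¬ (G.Adj p t ∧ G.Adj p' s) :=
    fun hz ht hs hts hp hp' hpp e => hts.ne (hq.eq_of_adj_pair' hC hij hz ht hs hp hp' hpp e.1 e.2)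
  obtain ⟨mp, mp', mr, mr'⟩ := h.mem_T
  have p1 := same h'.mem_x h'.mem_p h'.mem_p' h'.adj_p mp mp' h.adj_p
  have p2 := same h'.mem_y h'.mem_r h'.mem_r' h'.adj_r mp mp' h.adj_p
  have p3 := same h'.mem_z h'.mem_a h'.mem_a' h'.adj_a mp mp' h.adj_p
  have r1 := same h'.mem_x h'.mem_p h'.mem_p' h'.adj_p mr mr' h.adj_r
  have r2 := same h'.mem_y h'.mem_r h'.mem_r' h'.adj_r mr mr' h.adj_r
  have r3 := same h'.mem_z h'.mem_a h'.mem_a' h'.adj_a mr mr' h.adj_r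
  have k1 := key h'.mem_T.1
  have k2 := key h'.mem_T.2.2.1
  have k3 := key h'.rotate.mem_T.2.2.1
  clear key same
  grind

theorem PairedPort.adj_or_of_split (hq : IsK4 G q) (hC : C5Free G) (hα : AlphaLE G 7)
    (hX : ∀ i, (portX G q i).Nonempty) (hij : i ≠ j)
    {x y p p' r r' u w s a a' b b' : V}
    (h : PairedPort G q i x y p p' r r') (h' : SplitPort G q j u w s a a' b b') :
    G.Adj p s ∨ G.Adj p a ∨ G.Adj p b := by
  have hsT := IsK4.children_subset h'.mem_x h'.mem_s
  have hn : ∀ {u w a a'}, u ∈ portX G q j → w ∈ portX G q j → u ≠ w → s ∈ children G (q j) w →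
      a ∈ children G (q j) u → a' ∈ children G (q j) u → G.Adj a a' → s ≠ a := by
    rintro u w a a' hu hw huw hs ha ha' haa rfl
    exact IsK4.not_adj_of_pair hC hu hw huw ha ha' haa (mem_children.1 hs).1
  have hsh : ∀ {t}, t ∈ portT G q j → ¬ G.Adj s t := fun ht =>
    CliquePort.not_adj_shared hC h'.mem_x h'.mem_y h'.adj_xy.ne h'.mem_s h'.mem_s' ht
  exact h.exists_adj_of_three hq hC hα hX hij hsT h'.mem_T.1 h'.mem_T.2.2.1
    (hn h'.mem_x h'.mem_y h'.adj_xy.ne h'.mem_s' h'.mem_p h'.mem_p' h'.adj_p)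
    (hn h'.mem_y h'.mem_x h'.adj_xy.ne' h'.mem_s h'.mem_r h'.mem_r' h'.adj_r)
    (h'.ne hC) (hsh h'.mem_T.1) (hsh h'.mem_T.2.2.1) (h'.not_adj hC)

/-- A private child sees the shared child of a split port, or both children of one vertex. -/
theorem PairedPort.adj_class_of_split (hq : IsK4 G q) (hC : C5Free G) (hα : AlphaLE G 7)
    (hX : ∀ i, (portX G q i).Nonempty) (hij : i ≠ j)
    {x y p p' r r' u w s a a' b b' : V}
    (h : PairedPort G q i x y p p' r r') (h' : SplitPort G q j u w s a a' b b') :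
    G.Adj p s ∨ (G.Adj p a ∧ G.Adj p a') ∨ (G.Adj p b ∧ G.Adj p b') := by
  have h1 := h.adj_or_of_split hq hC hα hX hij h'
  have h2 := h.adj_or_of_split hq hC hα hX hij h'.flip
  have h3 := h.adj_or_of_split hq hC hα hX hij h'.swap.flip.swap
  have n1 : ¬ (G.Adj p a ∧ G.Adj p b) := fun e => h'.not_adj_both hq hC h.mem_T.1 e.1 e.2
  have n4 : ¬ (G.Adj p a' ∧ G.Adj p b) := fun e => h'.flip.not_adj_both hq hC h.mem_T.1 e.1 e.2
  grind

/-- Adjacent children outside a split port do not see different vertices of one class. -/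
theorem SplitPort.not_adj_pair (hq : IsK4 G q) (hC : C5Free G) (hij : i ≠ j)
    {u w s a a' b b' t t' : V} (h' : SplitPort G q j u w s a a' b b')
    (ht : t ∈ portT G q i) (ht' : t' ∈ portT G q i) (htt : G.Adj t t') :
    ¬ (G.Adj t a ∧ G.Adj t' a') ∧ ¬ (G.Adj t b ∧ G.Adj t' b') ∧ ¬ (G.Adj t s ∧ G.Adj t' a) ∧
      ¬ (G.Adj t s ∧ G.Adj t' b) := by
  have hn : ∀ {u w a a'}, u ∈ portX G q j → w ∈ portX G q j → u ≠ w → s ∈ children G (q j) w →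
      a ∈ children G (q j) u → a' ∈ children G (q j) u → G.Adj a a' → s ≠ a := by
    rintro u w a a' hu hw huw hs ha ha' haa rfl
    exact IsK4.not_adj_of_pair hC hu hw huw ha ha' haa (mem_children.1 hs).1
  refine ⟨fun e => ?_, fun e => ?_, fun e => ?_, fun e => ?_⟩
  · exact h'.adj_p.ne (hq.eq_of_adj_pair' hC hij h'.mem_x h'.mem_p h'.mem_p' ht ht' htt e.1 e.2)
  · exact h'.adj_r.ne (hq.eq_of_adj_pair' hC hij h'.mem_y h'.mem_r h'.mem_r' ht ht' htt e.1 e.2)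
  · exact hn h'.mem_x h'.mem_y h'.adj_xy.ne h'.mem_s' h'.mem_p h'.mem_p' h'.adj_p
      (hq.eq_of_adj_pair' hC hij h'.mem_x h'.mem_s h'.mem_p ht ht' htt e.1 e.2)
  · exact hn h'.mem_y h'.mem_x h'.adj_xy.ne' h'.mem_s h'.mem_r h'.mem_r' h'.adj_r
      (hq.eq_of_adj_pair' hC hij h'.mem_y h'.mem_s' h'.mem_r ht ht' htt e.1 e.2)

/-- A triangle port excludes a split port. -/
theorem TrianglePort.false_of_split (hq : IsK4 G q) (hC : C5Free G) (hα : AlphaLE G 7)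
    (hX : ∀ i, (portX G q i).Nonempty) (hij : i ≠ j)
    {x y p p' p'' r r' r'' u w s a a' b b' : V}
    (h : TrianglePort G q i x y p p' p'' r r' r'') (h' : SplitPort G q j u w s a a' b b') :
    False := by
  have h1 := h.adj_class_of_split hq hC hα hX hij h'
  have h2 := h.rotate.adj_class_of_split hq hC hα hX hij h'
  have h3 := h.rotate.rotate.adj_class_of_split hq hC hα hX hij h'
  have hsT := IsK4.children_subset h'.mem_x h'.mem_s
  have n1 : ¬ (G.Adj p s ∧ G.Adj p' s) :=
    fun e => h.not_adj_both hq hC hij hsT e.1.symm e.2.symm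
  have n2 : ¬ (G.Adj p' s ∧ G.Adj p'' s) :=
    fun e => h.rotate.not_adj_both hq hC hij hsT e.1.symm e.2.symm
  have mp := h.mem_T.1
  have mp' := h.mem_T.2.1
  have mp'' := h.rotate.mem_T.2.1
  have e1 := h'.not_adj_pair hq hC hij mp mp' h.adj_p
  have e2 := h'.not_adj_pair hq hC hij mp' mp h.adj_p.symm
  have e3 := h'.not_adj_pair hq hC hij mp' mp'' h.adj_p'p''
  have e4 := h'.not_adj_pair hq hC hij mp'' mp' h.adj_p'p''.symm
  have e5 := h'.not_adj_pair hq hC hij mp mp'' h.adj_pp''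
  grind

/-- A triangle port excludes a shared port. -/
theorem TrianglePort.false_of_shared (hq : IsK4 G q) (hC : C5Free G) (hα : AlphaLE G 7)
    (hX : ∀ i, (portX G q i).Nonempty) (hij : i ≠ j)
    {x y p p' p'' r r' r'' : V}
    (h : TrianglePort G q i x y p p' p'' r r' r'') (h' : SharedPort G q 7 j) : False := by
  obtain ⟨s, hs, h1, h2⟩ := h'.exists_common hq hC hα hX hij h.mem_x h.mem_y h.adj_xy.ne h.mem_p
    h.mem_p' h.adj_p
  exact h.not_adj_both hq hC hij hs h1.symm h2.symm

theorem SplitPort.false_of_adj (hq : IsK4 G q) (hC : C5Free G) (hα : AlphaLE G 7)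
    (hX : ∀ i, (portX G q i).Nonempty) (hij : i ≠ j)
    {x y s p p' r r' u w s' a a' b b' : V}
    (h : SplitPort G q i x y s p p' r r') (h' : SplitPort G q j u w s' a a' b b')
    (ha : G.Adj r a) (hb : G.Adj r' b) : False := by
  have h1 := h'.adj_class_of_split hq hC hα hX hij.symm h
  have ma := h'.mem_T.1
  have n1 : ¬ (G.Adj a p ∧ G.Adj a r) := fun e => h.not_adj_both hq hC ma e.1 e.2
  have n2 : ¬ (G.Adj a s ∧ G.Adj a r) := by
    intro e
    have := IsK4.eq_of_adj_of_adj hC h.mem_x h.mem_y h.adj_xy h.mem_s h.mem_r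
      (hq.T_ne_X hC ma h.mem_x) (hq.T_ne_X hC ma h.mem_y) e.1 e.2
    exact IsK4.not_adj_of_pair hC h.mem_y h.mem_x h.adj_xy.ne' h.mem_r h.mem_r' h.adj_r
      (this ▸ (mem_children.1 h.mem_s).1)
  have har' : G.Adj a r' := by
    have := ha.symm
    tauto
  exact h'.not_adj_both hq hC h.mem_T.2.2.2 har'.symm hb

/-- There is at most one split port. -/
theorem SplitPort.false_of_split (hq : IsK4 G q) (hC : C5Free G) (hα : AlphaLE G 7)
    (hX : ∀ i, (portX G q i).Nonempty) (hij : i ≠ j)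
    {x y s p p' r r' u w s' a a' b b' : V}
    (h : SplitPort G q i x y s p p' r r') (h' : SplitPort G q j u w s' a a' b b') : False := by
  have h1 := h.adj_class_of_split hq hC hα hX hij h'
  have h2 := h.flip.adj_class_of_split hq hC hα hX hij h'
  have h3 := h.swap.adj_class_of_split hq hC hα hX hij h'
  have h4 := h.swap.flip.adj_class_of_split hq hC hα hX hij h'
  have n1 : ¬ (G.Adj p s' ∧ G.Adj r s') := fun e =>
    h.not_adj_both hq hC (IsK4.children_subset h'.mem_x h'.mem_s) e.1.symm e.2.symm
  obtain ⟨mp, mp', mr, mr'⟩ := h.mem_T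
  have e1 := h'.not_adj_pair hq hC hij mp mp' h.adj_p
  have e2 := h'.not_adj_pair hq hC hij mp' mp h.adj_p.symm
  have e3 := h'.not_adj_pair hq hC hij mr mr' h.adj_r
  have e4 := h'.not_adj_pair hq hC hij mr' mr h.adj_r.symm
  have f1 := h.false_of_adj hq hC hα hX hij h'
  have f2 := h.false_of_adj hq hC hα hX hij h'.swap
  have f3 := h.swap.false_of_adj hq hC hα hX hij h'
  have f4 := h.swap.false_of_adj hq hC hα hX hij h'.swap
  grind

end

/-- Some two vertices of the triangle see at most one of the three vertices of port `i`. -/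
theorem TrianglePort.exists_good (hq : IsK4 G q) (hC : C5Free G) {i j : Fin 4} (hij : i ≠ j)
    {x y p p' p'' r r' r'' u w a a' a'' b b' b'' : V}
    (h : TrianglePort G q i x y p p' p'' r r' r'')
    (h' : TrianglePort G q j u w a a' a'' b b' b'') :
    ∃ a a' a'', TrianglePort G q j u w a a' a'' b b' b'' ∧
      (∀ t, t = a ∨ t = a' → ¬ (G.Adj t r ∧ G.Adj t r') ∧ ¬ (G.Adj t r ∧ G.Adj t r'') ∧
        ¬ (G.Adj t r' ∧ G.Adj t r'')) := by
  have hpair : ∀ {t t'}, t ∈ portT G q j → t' ∈ portT G q j → G.Adj t t' →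
      ∀ c c', c ∈ children G (q i) y → c' ∈ children G (q i) y → c ≠ c' →
      ¬ (G.Adj t c ∧ G.Adj t' c') := fun ht ht' htt _ _ hc hc' hne e =>
    hne (hq.eq_of_adj_pair' hC hij.symm h.mem_y hc hc' ht ht' htt e.1 e.2)
  have hbad : ∀ {t t'}, t ∈ portT G q j → t' ∈ portT G q j → G.Adj t t' →
      (¬ (G.Adj t r ∧ G.Adj t r') ∧ ¬ (G.Adj t r ∧ G.Adj t r'') ∧ ¬ (G.Adj t r' ∧ G.Adj t r'')) ∨
      (¬ (G.Adj t' r ∧ G.Adj t' r') ∧ ¬ (G.Adj t' r ∧ G.Adj t' r'') ∧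
        ¬ (G.Adj t' r' ∧ G.Adj t' r'')) := by
    intro t t' ht ht' htt
    have e1 := hpair ht ht' htt _ _ h.mem_r h.mem_r' h.adj_r.ne
    have e2 := hpair ht ht' htt _ _ h.mem_r h.mem_r'' h.ne_rr''
    have e3 := hpair ht ht' htt _ _ h.mem_r' h.mem_r'' h.ne_r'r''
    have e4 := hpair ht' ht htt.symm _ _ h.mem_r h.mem_r' h.adj_r.ne
    have e5 := hpair ht' ht htt.symm _ _ h.mem_r h.mem_r'' h.ne_rr''
    have e6 := hpair ht' ht htt.symm _ _ h.mem_r' h.mem_r'' h.ne_r'r''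
    clear hpair
    grind
  have b1 := hbad h'.mem_T.1 h'.mem_T.2.1 h'.adj_p
  have b2 := hbad h'.rotate.mem_T.1 h'.rotate.mem_T.2.1 h'.rotate.adj_p
  have b3 := hbad h'.rotate.rotate.mem_T.1 h'.rotate.rotate.mem_T.2.1 h'.rotate.rotate.adj_p
  by_cases c1 : ¬ (G.Adj a r ∧ G.Adj a r') ∧ ¬ (G.Adj a r ∧ G.Adj a r'') ∧
      ¬ (G.Adj a r' ∧ G.Adj a r'')
  · by_cases c2 : ¬ (G.Adj a' r ∧ G.Adj a' r') ∧ ¬ (G.Adj a' r ∧ G.Adj a' r'') ∧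
        ¬ (G.Adj a' r' ∧ G.Adj a' r'')
    · exact ⟨a, a', a'', h', by rintro t (rfl | rfl) <;> assumption⟩
    · have c3 := b2.resolve_left c2
      exact ⟨a'', a, a', h'.rotate.rotate, by rintro t (rfl | rfl) <;> assumption⟩
  · have c2 := b1.resolve_left c1
    have c3 := b3.resolve_right c1
    exact ⟨a', a'', a, h'.rotate, by rintro t (rfl | rfl) <;> assumption⟩

/-- There are at most two triangle ports. -/
theorem TrianglePort.false_of_three (hq : IsK4 G q) (hC : C5Free G) (hα : AlphaLE G 7)
    (hX : ∀ i, (portX G q i).Nonempty) {i j l : Fin 4} (hij : i ≠ j) (hil : i ≠ l) (hjl : j ≠ l)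
    {x y p p' p'' r r' r'' u w a a' a'' b b' b'' u' w' c c' c'' d d' d'' : V}
    (h : TrianglePort G q i x y p p' p'' r r' r'')
    (hj : TrianglePort G q j u w a a' a'' b b' b'')
    (hl : TrianglePort G q l u' w' c c' c'' d d' d'') : False := by
  obtain ⟨a, a', a'', hj, gj⟩ := h.exists_good hq hC hij hj
  obtain ⟨c, c', c'', hl, gl⟩ := h.exists_good hq hC hil hl
  obtain ⟨e, e', he, hnae, ge⟩ : ∃ e e', PairedPort G q l u' w' e e' d d' ∧ ¬ G.Adj a e ∧
      ¬ (G.Adj e r ∧ G.Adj e r') ∧ ¬ (G.Adj e r ∧ G.Adj e r'') ∧ ¬ (G.Adj e r' ∧ G.Adj e r'') := by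
    by_cases hac : G.Adj a c
    · refine ⟨c', c, hl.toPairedPort.flip, fun hac' => ?_, gl c' (Or.inr rfl)⟩
      exact hl.not_adj_both hq hC hjl.symm hj.mem_T.1 hac hac'
    · exact ⟨c, c', hl.toPairedPort, hac, gl c (Or.inl rfl)⟩
  have ga := gj a (Or.inl rfl)
  obtain ⟨t, ht, ⟨hta, hte⟩, hyt⟩ : ∃ t ∈ children G (q i) x,
      (¬ G.Adj a t ∧ ¬ G.Adj e t) ∧ ¬ G.Adj y t := by
    have key : ∀ v, (v ∈ portT G q j ∨ v ∈ portT G q l) → ¬ (G.Adj v p ∧ G.Adj v p') ∧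
        ¬ (G.Adj v p' ∧ G.Adj v p'') ∧ ¬ (G.Adj v p'' ∧ G.Adj v p) := by
      rintro v (hv | hv)
      · exact ⟨fun e => h.not_adj_both hq hC hij hv e.1 e.2,
          fun e => h.rotate.not_adj_both hq hC hij hv e.1 e.2,
          fun e => h.rotate.rotate.not_adj_both hq hC hij hv e.1 e.2⟩
      · exact ⟨fun e => h.not_adj_both hq hC hil hv e.1 e.2,
          fun e => h.rotate.not_adj_both hq hC hil hv e.1 e.2,
          fun e => h.rotate.rotate.not_adj_both hq hC hil hv e.1 e.2⟩
    have k1 := key a (Or.inl hj.mem_T.1)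
    have k2 := key e (Or.inr he.mem_T.1)
    by_contra! hno
    have priv : ∀ {t t'}, t ∈ children G (q i) x → t' ∈ children G (q i) x → G.Adj t t' →
        ¬ G.Adj y t := fun ht ht' htt =>
      IsK4.not_adj_of_pair hC h.mem_x h.mem_y h.adj_xy.ne ht ht' htt
    have n1 := fun e => priv h.mem_p h.mem_p' h.adj_p (hno p h.mem_p e)
    have n2 := fun e => priv h.mem_p' h.mem_p h.adj_p.symm (hno p' h.mem_p' e)
    have n3 := fun e => priv h.mem_p'' h.mem_p h.adj_pp''.symm (hno p'' h.mem_p'' e)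
    clear hno key priv
    grind
  obtain ⟨s, hs, hsa, hse⟩ : ∃ s ∈ children G (q i) y, ¬ G.Adj a s ∧ ¬ G.Adj e s := by
    by_contra! hno
    have n1 := hno r h.mem_r
    have n2 := hno r' h.mem_r'
    have n3 := hno r'' h.mem_r''
    clear hno gj gl
    grind
  have hadj : ¬ G.Adj t s :=
    nonadj_children hC (IsK4.adj_of_mem h.mem_x) (IsK4.adj_of_mem h.mem_y) h.adj_xy.ne ht hs
  have hts : t ≠ s := by
    rintro rfl
    exact hyt (mem_children.1 hs).1
  have htT := IsK4.children_subset h.mem_x ht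
  have hsT := IsK4.children_subset h.mem_y hs
  have hwa := IsK4.not_adj_of_pair hC hj.mem_x hj.mem_y hj.adj_xy.ne hj.mem_p hj.mem_p' hj.adj_p
  have hwe := IsK4.not_adj_of_pair hC he.mem_x he.mem_y he.adj_xy.ne he.mem_p he.mem_p' he.adj_p
  have := hq.card_three_le hC hα hX hij hil hjl (J := {t, s}) (A := {w, a}) (B := {w', e})
    (Finset.insert_subset htT (Finset.singleton_subset_iff.2 hsT))
    (Finset.insert_subset (Finset.mem_union_left _ hj.mem_y)
      (Finset.singleton_subset_iff.2 (Finset.mem_union_right _ hj.mem_T.1)))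
    (Finset.insert_subset (Finset.mem_union_left _ hl.mem_y)
      (Finset.singleton_subset_iff.2 (Finset.mem_union_right _ he.mem_T.1)))
    (Indep.pair hadj) (Indep.pair hwa) (Indep.pair hwe)
    (by
      simp only [Finset.mem_insert, Finset.mem_singleton, forall_eq_or_imp, forall_eq]
      exact ⟨⟨fun e => hq.not_adj_XT hC hij hj.mem_y htT e.symm, fun e => hta e.symm⟩,
        fun e => hq.not_adj_XT hC hij hj.mem_y hsT e.symm, fun e => hsa e.symm⟩)
    (by
      simp only [Finset.mem_insert, Finset.mem_singleton, forall_eq_or_imp, forall_eq]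
      exact ⟨⟨fun e => hq.not_adj_XT hC hil hl.mem_y htT e.symm, fun e => hte e.symm⟩,
        fun e => hq.not_adj_XT hC hil hl.mem_y hsT e.symm, fun e => hse e.symm⟩)
    (by
      simp only [Finset.mem_insert, Finset.mem_singleton, forall_eq_or_imp, forall_eq]
      exact ⟨⟨hq.not_adj_XX hC hjl hj.mem_y hl.mem_y,
        hq.not_adj_XT hC hjl.symm hj.mem_y he.mem_T.1⟩,
        fun e => hq.not_adj_XT hC hjl hl.mem_y hj.mem_T.1 e.symm, hnae⟩)
  rw [Finset.card_pair hts, Finset.card_pair (hq.T_ne_X hC hj.mem_T.1 hj.mem_y).symm,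
    Finset.card_pair (hq.T_ne_X hC he.mem_T.1 hl.mem_y).symm] at this
  omega

theorem CliquePort.triple_of_card (hq : IsK4 G q) (hC : C5Free G)
    (hδ : ∀ v, 5 ≤ (nbrs G v).card) {i : Fin 4}
    (hα : ∀ J ⊆ portT G q i, Indep G J → J.card + 4 ≤ 7) (h : CliquePort G q i)
    (h3 : (portX G q i).card = 3) :
    ∃ x y z p p' r r' a a', TriplePort G q i x y z p p' r r' a a' := by
  have hch : ∀ v ∈ portX G q i, 1 < (children G (q i) v).card := by
    intro v hv
    have e1 := h.card_children hq hC hv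
    have e2 := hδ v
    omega
  have key : ∀ {x y z}, x ∈ portX G q i → y ∈ portX G q i → z ∈ portX G q i → x ≠ y → x ≠ z →
      y ≠ z → ∀ p ∈ children G (q i) x, ∀ p' ∈ children G (q i) x, p ≠ p' → G.Adj p p' := by
    intro x y z hx hy hz hxy hxz hyz p hp p' hp' hpp
    by_contra hno
    obtain ⟨b, hb⟩ := Finset.card_pos.1 (zero_lt_one.trans (hch y hy))
    obtain ⟨c, hc⟩ := Finset.card_pos.1 (zero_lt_one.trans (hch z hz))
    have nadj : ∀ {u v s t}, u ∈ portX G q i → v ∈ portX G q i → u ≠ v →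
        s ∈ children G (q i) u → t ∈ children G (q i) v → s ≠ t ∧ ¬ G.Adj s t := by
      intro u v s t hu hv huv hs ht
      refine ⟨?_, nonadj_children hC (IsK4.adj_of_mem hu) (IsK4.adj_of_mem hv) huv hs ht⟩
      rintro rfl
      exact h.not_mem_children hC (by omega) hu hv huv hs ht
    have h1 := nadj hx hy hxy hp hb
    have h2 := nadj hx hy hxy hp' hb
    have h3 := nadj hx hz hxz hp hc
    have h4 := nadj hx hz hxz hp' hc
    have h5 := nadj hy hz hyz hb hc
    have := hα {p, p', b, c} (by
      simp only [Finset.insert_subset_iff, Finset.singleton_subset_iff]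
      exact ⟨IsK4.children_subset hx hp, IsK4.children_subset hx hp', IsK4.children_subset hy hb,
        IsK4.children_subset hz hc⟩)
      (((Indep.pair h5.2).insert (by simp [h2.2, h4.2])).insert (by simp [hno, h1.2, h3.2]))
    rw [Finset.card_eq_four.2 ⟨p, p', b, c, hpp, h1.1, h3.1, h2.1, h4.1, h5.1, rfl⟩] at this
    omega
  obtain ⟨x, y, z, hx, hy, hz, hxy, hxz, hyz⟩ := Finset.two_lt_card_iff.1
    (show 2 < (portX G q i).card by omega)
  obtain ⟨p, hp, p', hp', hpp⟩ := Finset.one_lt_card.1 (hch x hx)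
  obtain ⟨r, hr, r', hr', hrr⟩ := Finset.one_lt_card.1 (hch y hy)
  obtain ⟨a, ha, a', ha', haa⟩ := Finset.one_lt_card.1 (hch z hz)
  exact ⟨x, y, z, p, p', r, r', a, a', ⟨hx, hy, h x hx y hy hxy, hp, hp',
    key hx hy hz hxy hxz hyz p hp p' hp' hpp, hr, hr',
    key hy hx hz hxy.symm hyz hxz r hr r' hr' hrr⟩, hz, h x hx z hz hxz, h y hy z hz hyz, ha, ha',
    key hz hx hy hxz.symm hyz.symm hxy a ha a' ha' haa⟩

theorem CliquePort.shared_or_split_or_triangle (hq : IsK4 G q) (hC : C5Free G)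
    (hδ : ∀ v, 5 ≤ (nbrs G v).card) {i : Fin 4}
    (hα : ∀ J ⊆ portT G q i, Indep G J → J.card + 4 ≤ 7) (h : CliquePort G q i)
    (hcard : (portX G q i).card = 2) :
    SharedPort G q 7 i ∨ (∃ x y s p p' r r', SplitPort G q i x y s p p' r r') ∨
      ∃ x y p p' p'' r r' r'', TrianglePort G q i x y p p' p'' r r' r'' := by
  have hkey : ∀ x ∈ portX G q i, ∀ y ∈ portX G q i, x ≠ y →
      (children G (q i) x ∩ children G (q i) y).card = 0 →
      (∀ p ∈ children G (q i) x, ∀ p' ∈ children G (q i) x, p ≠ p' → G.Adj p p') →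
      ∃ p p' p'' r r' r'', TrianglePort G q i x y p p' p'' r r' r'' := by
    intro x hx y hy hxy h0 hcl
    have ex := h.card_children hq hC hx
    have ey := h.card_children hq hC hy
    have dx := hδ x
    have dy := hδ y
    obtain ⟨p, p', p'', hp, hp', hp'', hpp', hpp'', hp'p''⟩ := Finset.two_lt_card_iff.1
      (show 2 < (children G (q i) x).card by omega)
    obtain ⟨b, b', b'', hb, hb', hb'', hbb', hbb'', hb'b''⟩ := Finset.two_lt_card_iff.1
      (show 2 < (children G (q i) y).card by omega)
    have hdis : ∀ c ∈ children G (q i) x, c ∉ children G (q i) y := by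
      intro c hc hc'
      rw [Finset.card_eq_zero] at h0
      exact Finset.notMem_empty c (h0 ▸ Finset.mem_inter.2 ⟨hc, hc'⟩)
    obtain ⟨r, r', r'', hr, hr', hr'', hrr, hn1, hn2⟩ : ∃ r r' r'', r ∈ children G (q i) y ∧
        r' ∈ children G (q i) y ∧ r'' ∈ children G (q i) y ∧ G.Adj r r' ∧ r ≠ r'' ∧ r' ≠ r'' := by
      by_contra! hno
      have n1 : ¬ G.Adj b b' := fun e => hb'b'' (hno b b' b'' hb hb' hb'' e hbb'')
      have n2 : ¬ G.Adj b b'' := fun e => hb'b'' (hno b b'' b' hb hb'' hb' e hbb').symm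
      have n3 : ¬ G.Adj b' b'' := fun e => hbb'' (hno b' b'' b hb' hb'' hb e hbb'.symm).symm
      have := IsK4.card_private_le hC hα hx hy hxy (A := {p}) (B := {b, b', b''})
        (Finset.singleton_subset_iff.2 (Finset.mem_sdiff.2 ⟨hp, hdis p hp⟩))
        (by
          simp only [Finset.insert_subset_iff, Finset.singleton_subset_iff, Finset.mem_sdiff]
          exact ⟨⟨hb, fun e => hdis b e hb⟩, ⟨hb', fun e => hdis b' e hb'⟩, hb'',
            fun e => hdis b'' e hb''⟩)
        (Indep.singleton p) ((Indep.pair n3).insert (by simp [n1, n2]))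
      rw [Finset.card_singleton,
        Finset.card_eq_three.2 ⟨b, b', b'', hbb', hbb'', hb'b'', rfl⟩] at this
      omega
    exact ⟨p, p', p'', r, r', r'', ⟨hx, hy, h x hx y hy hxy, hp, hp', hcl p hp p' hp' hpp', hr, hr',
      hrr⟩, hp'', hcl p hp p'' hp'' hpp'', hcl p' hp' p'' hp'' hp'p'', hr'', hn1, hn2⟩
  obtain ⟨x, hx, y, hy, hxy⟩ := Finset.one_lt_card.1 (show 1 < (portX G q i).card by omega)
  by_cases hS : 3 ≤ (children G (q i) x ∩ children G (q i) y).card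
  · exact Or.inl (h.shared_of_card_inter hC hα hcard hx hy hxy (by omega))
  refine Or.inr ?_
  have ex := h.card_children hq hC hx
  have ey := h.card_children hq hC hy
  have dx := hδ x
  have dy := hδ y
  have sx := Finset.card_sdiff_add_card_inter (children G (q i) x) (children G (q i) y)
  have sy := Finset.card_sdiff_add_card_inter (children G (q i) y) (children G (q i) x)
  have hcomm := congrArg Finset.card (Finset.inter_comm (children G (q i) x) (children G (q i) y))
  have hpriv : ∀ {A B : Finset V}, A ⊆ children G (q i) x \ children G (q i) y →
      B ⊆ children G (q i) y \ children G (q i) x → Indep G A → Indep G B → _ :=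
    fun hA hB iA iB => IsK4.card_private_le hC hα hx hy hxy hA hB iA iB
  obtain ⟨a, ha⟩ := Finset.card_pos.1
    (show 0 < (children G (q i) x \ children G (q i) y).card by omega)
  obtain ⟨b, hb⟩ := Finset.card_pos.1
    (show 0 < (children G (q i) y \ children G (q i) x).card by omega)
  have h0 := hpriv (Finset.singleton_subset_iff.2 ha) (Finset.singleton_subset_iff.2 hb)
    (Indep.singleton a) (Indep.singleton b)
  simp only [Finset.card_singleton] at h0
  have hsum : ∀ p ∈ children G (q i) x \ children G (q i) y,
      ∀ p' ∈ children G (q i) x \ children G (q i) y, p ≠ p' → ¬ G.Adj p p' →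
      ∀ r ∈ children G (q i) y \ children G (q i) x,
      ∀ r' ∈ children G (q i) y \ children G (q i) x, r ≠ r' → ¬ G.Adj r r' → False := by
    intro p hp p' hp' hpp npp r hr r' hr' hrr nrr
    have := hpriv (Finset.insert_subset hp (Finset.singleton_subset_iff.2 hp'))
      (Finset.insert_subset hr (Finset.singleton_subset_iff.2 hr')) (Indep.pair npp)
      (Indep.pair nrr)
    rw [Finset.card_pair hpp, Finset.card_pair hrr] at this
    omega
  rcases Nat.eq_zero_or_pos (children G (q i) x ∩ children G (q i) y).card with hz | hpos
  · right
    have hdis : ∀ c ∈ children G (q i) x, c ∉ children G (q i) y := by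
      intro c hc hc'
      rw [Finset.card_eq_zero] at hz
      exact Finset.notMem_empty c (hz ▸ Finset.mem_inter.2 ⟨hc, hc'⟩)
    by_cases hcl : ∀ p ∈ children G (q i) x, ∀ p' ∈ children G (q i) x, p ≠ p' → G.Adj p p'
    · exact ⟨x, y, hkey x hx y hy hxy hz hcl⟩
    · push Not at hcl
      obtain ⟨p, hp, p', hp', hpp, npp⟩ := hcl
      refine ⟨y, x, hkey y hy x hx hxy.symm (hcomm ▸ hz) ?_⟩
      intro r hr r' hr' hrr
      by_contra nrr
      exact hsum p (Finset.mem_sdiff.2 ⟨hp, hdis p hp⟩) p' (Finset.mem_sdiff.2 ⟨hp', hdis p' hp'⟩)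
        hpp npp r (Finset.mem_sdiff.2 ⟨hr, fun e => hdis r e hr⟩) r'
        (Finset.mem_sdiff.2 ⟨hr', fun e => hdis r' e hr'⟩) hrr nrr
  · left
    obtain ⟨s, hs⟩ := Finset.card_pos.1 hpos
    rw [Finset.mem_inter] at hs
    obtain ⟨p, hp, p', hp', hpp⟩ := Finset.one_lt_card.1
      (show 1 < (children G (q i) x \ children G (q i) y).card by omega)
    obtain ⟨r, hr, r', hr', hrr⟩ := Finset.one_lt_card.1
      (show 1 < (children G (q i) y \ children G (q i) x).card by omega)
    have app : G.Adj p p' := by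
      by_contra hno
      have := hpriv (Finset.insert_subset hp (Finset.singleton_subset_iff.2 hp'))
        (Finset.singleton_subset_iff.2 hb) (Indep.pair hno) (Indep.singleton b)
      rw [Finset.card_pair hpp, Finset.card_singleton] at this
      omega
    have arr : G.Adj r r' := by
      by_contra hno
      have := hpriv (Finset.singleton_subset_iff.2 ha)
        (Finset.insert_subset hr (Finset.singleton_subset_iff.2 hr')) (Indep.singleton a)
        (Indep.pair hno)
      rw [Finset.card_pair hrr, Finset.card_singleton] at this
      omega
    exact ⟨x, y, s, p, p', r, r', ⟨hx, hy, h x hx y hy hxy, (Finset.mem_sdiff.1 hp).1,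
      (Finset.mem_sdiff.1 hp').1, app, (Finset.mem_sdiff.1 hr).1, (Finset.mem_sdiff.1 hr').1,
      arr⟩, hs.1, hs.2⟩

end AlphaSeven

section AlphaSeven

variable {V : Type} [Fintype V] {G : SimpleGraph V} {q : Fin 4 → V}

theorem CliquePort.type_of_alpha_seven (hq : IsK4 G q) (hC : C5Free G)
    (hδ : ∀ v, 5 ≤ (nbrs G v).card) {i : Fin 4}
    (hα : ∀ J ⊆ portT G q i, Indep G J → J.card + 4 ≤ 7) (h : CliquePort G q i)
    (h2 : 2 ≤ (portX G q i).card) :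
    SharedPort G q 7 i ∨ (∃ x y z p p' r r' a a', TriplePort G q i x y z p p' r r' a a') ∨
      (∃ x y s p p' r r', SplitPort G q i x y s p p' r r') ∨
      ∃ x y p p' p'' r r' r'', TrianglePort G q i x y p p' p'' r r' r'' := by
  have h3 := h.card_X_le hC
  by_cases h3' : (portX G q i).card = 3
  · exact Or.inr (Or.inl (h.triple_of_card hq hC hδ hα h3'))
  · rcases h.shared_or_split_or_triangle hq hC hδ hα (by omega) with h | h | h
    exacts [Or.inl h, Or.inr (Or.inr (Or.inl h)), Or.inr (Or.inr (Or.inr h))]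

/-- Three clique ports are shared. -/
theorem CliquePort.shared_of_three (hq : IsK4 G q) (hC : C5Free G) (hα : AlphaLE G 7)
    (hδ : ∀ v, 5 ≤ (nbrs G v).card) (hX : ∀ i, 2 ≤ (portX G q i).card) {i j l : Fin 4}
    (hij : i ≠ j) (hil : i ≠ l) (hjl : j ≠ l) (hi : CliquePort G q i) (hj : CliquePort G q j)
    (hl : CliquePort G q l) : SharedPort G q 7 i := by
  have hX' : ∀ i, (portX G q i).Nonempty := fun i => Finset.card_pos.1 (by have := hX i; omega)
  have htype : ∀ i, CliquePort G q i → _ := fun i hi => hi.type_of_alpha_seven hq hC hδ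
    (fun J hJ iJ => hq.card_one_le hC hα hX' hJ iJ) (hX i)
  have tj := htype j hj
  have tl := htype l hl
  rcases htype i hi with t | ⟨x, y, z, p, p', r, r', a, a', t⟩ | ⟨x, y, s, p, p', r, r', t⟩ |
    ⟨x, y, p, p', p'', r, r', r'', t⟩
  · exact t
  · have key : ∀ j, i ≠ j → CliquePort G q j → SharedPort G q 7 j := by
      intro j hij hj
      rcases htype j hj with u | ⟨_, _, _, _, _, _, _, _, _, u⟩ | ⟨_, _, _, _, _, _, _, u⟩ |
        ⟨_, _, _, _, _, _, _, _, u⟩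
      · exact u
      · exact (u.toPairedPort.false_of_triple hq hC hα hX' hij.symm t).elim
      · exact (u.toPairedPort.false_of_triple hq hC hα hX' hij.symm t).elim
      · exact (u.toPairedPort.false_of_triple hq hC hα hX' hij.symm t).elim
    exact (t.toPairedPort.false_of_shared hq hC hα hX' hij hil hjl (key j hij hj)
      (key l hil hl)).elim
  · have key : ∀ j, i ≠ j → CliquePort G q j → SharedPort G q 7 j := by
      intro j hij hj
      rcases htype j hj with u | ⟨_, _, _, _, _, _, _, _, _, u⟩ | ⟨_, _, _, _, _, _, _, u⟩ |
        ⟨_, _, _, _, _, _, _, _, u⟩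
      · exact u
      · exact (t.toPairedPort.false_of_triple hq hC hα hX' hij u).elim
      · exact (t.false_of_split hq hC hα hX' hij u).elim
      · exact (u.false_of_split hq hC hα hX' hij.symm t).elim
    exact (t.toPairedPort.false_of_shared hq hC hα hX' hij hil hjl (key j hij hj)
      (key l hil hl)).elim
  · have key : ∀ j, i ≠ j → CliquePort G q j →
        ∃ x y p p' p'' r r' r'', TrianglePort G q j x y p p' p'' r r' r'' := by
      intro j hij hj
      rcases htype j hj with u | ⟨_, _, _, _, _, _, _, _, _, u⟩ | ⟨_, _, _, _, _, _, _, u⟩ | u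
      · exact (t.false_of_shared hq hC hα hX' hij u).elim
      · exact (t.toPairedPort.false_of_triple hq hC hα hX' hij u).elim
      · exact (t.false_of_split hq hC hα hX' hij u).elim
      · exact u
    obtain ⟨_, _, _, _, _, _, _, _, u⟩ := key j hij hj
    obtain ⟨_, _, _, _, _, _, _, _, v⟩ := key l hil hl
    exact (t.false_of_three hq hC hα hX' hij hil hjl u v).elim

/-- In a large graph of minimum degree five without independent sets of size eight, every complete
subgraph on four vertices has a vertex of degree less than five. -/
theorem IsK4.false_of_alpha_seven (hq : IsK4 G q) (hC : C5Free G) (hα : AlphaLE G 7)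
    (hδ : ∀ v, 5 ≤ (nbrs G v).card) (hn : 29 ≤ Fintype.card V) : False := by
  have hX : ∀ i, 2 ≤ (portX G q i).card := by
    intro i
    have h1 := hq.card_nbrs i
    have h2 := hδ (q i)
    omega
  have hX' : ∀ i, (portX G q i).Nonempty := fun i => Finset.card_pos.1 (by have := hX i; omega)
  have hpair : ∀ j l, j ≠ l → CliquePort G q j ∨ CliquePort G q l := by
    intro j l hjl
    by_contra! hno
    simp only [CliquePort] at hno
    push Not at hno
    obtain ⟨⟨x, hx, y, hy, hxy, nxy⟩, u, hu, w, hw, huw, nuw⟩ := hno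
    obtain ⟨i, hji, hli, -⟩ := exists_other j l l
    obtain ⟨a, ha, b, hb, t, ht, s, hs, -, hts, nts⟩ := hq.exists_indep_pair hC
      (fun v => (by omega : 4 ≤ 5).trans (hδ v)) (hX i)
    have htT : ({t, s} : Finset V) ⊆ portT G q i :=
      Finset.insert_subset (IsK4.children_subset ha ht)
        (Finset.singleton_subset_iff.2 (IsK4.children_subset hb hs))
    have hA : ({x, y} : Finset V) ⊆ portX G q j :=
      Finset.insert_subset hx (Finset.singleton_subset_iff.2 hy)
    have hB : ({u, w} : Finset V) ⊆ portX G q l :=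
      Finset.insert_subset hu (Finset.singleton_subset_iff.2 hw)
    have := hq.card_three_le hC hα hX' hji.symm hli.symm hjl htT
      (hA.trans Finset.subset_union_left) (hB.trans Finset.subset_union_left) (Indep.pair nts)
      (Indep.pair nxy) (Indep.pair nuw)
      (fun c hc d hd e => hq.not_adj_XT hC hji.symm (hA hd) (htT hc) e.symm)
      (fun c hc d hd e => hq.not_adj_XT hC hli.symm (hB hd) (htT hc) e.symm)
      (fun c hc d hd => hq.not_adj_XX hC hjl (hA hc) (hB hd))
    rw [Finset.card_pair hts, Finset.card_pair hxy, Finset.card_pair huw] at this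
    omega
  obtain ⟨m, hm⟩ : ∃ m, ∀ i, i ≠ m → CliquePort G q i := by
    by_cases hall : ∀ i, CliquePort G q i
    · exact ⟨0, fun i _ => hall i⟩
    · push Not at hall
      obtain ⟨m, hm⟩ := hall
      exact ⟨m, fun i hi => (hpair i m hi).resolve_right hm⟩
  have hS : ∀ i, i ≠ m → SharedPort G q 7 i := by
    intro i hi
    obtain ⟨j, l, hji, hjm, hli, hlm, hjl⟩ := exists_two_others hi
    exact CliquePort.shared_of_three hq hC hα hδ hX hji.symm hli.symm hjl (hm i hi) (hm j hjm)
      (hm l hlm)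
  obtain ⟨i, hmi, -⟩ := exists_other m m m
  obtain ⟨j, hmj, hij, -⟩ := exists_other m i i
  have hmC : CliquePort G q m := by
    intro x hx y hy hxy
    by_contra nxy
    have := hq.card_T_add_card_X_le hC hα hX' hmi.symm (J := portT G q i) (A := {x, y}) le_rfl
      (Finset.insert_subset hx (Finset.singleton_subset_iff.2 hy)) (hS i hmi.symm).indep_T
      (Indep.pair nxy)
    rw [Finset.card_pair hxy] at this
    have := (hS i hmi.symm).card_T
    omega
  refine SharedPort.false_of_all hq hC hα (by omega) (by omega) fun l => ?_
  by_cases hl : l = m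
  · subst hl
    exact CliquePort.shared_of_three hq hC hα hδ hX hmi hmj hij hmC (hm i hmi.symm)
      (hm j hmj.symm)
  · exact hS l hl

end AlphaSeven

section Transversals

variable {V : Type} [Fintype V] [Nonempty V] {G : SimpleGraph V}

/-- There is at most one edge between `A` and `B`. -/
def FewEdges (G : SimpleGraph V) (A B : Finset V) : Prop :=
  ∀ a ∈ A, ∀ a' ∈ A, ∀ b ∈ B, ∀ b' ∈ B, G.Adj a b → G.Adj a' b' → a = a' ∧ b = b'

/-- There is an independent choice of vertices from the sets `P i` with `i ∈ S`. -/
def HasTransversal (G : SimpleGraph V) (S : Finset ℕ) (P : ℕ → Finset V) : Prop :=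
  ∃ g : ℕ → V, (∀ i ∈ S, g i ∈ P i) ∧ ∀ i ∈ S, ∀ j ∈ S, i ≠ j → ¬ G.Adj (g i) (g j)

theorem HasTransversal.empty (P : ℕ → Finset V) : HasTransversal G ∅ P :=
  ⟨fun _ => Classical.arbitrary V, by simp, by simp⟩

theorem HasTransversal.of_erase {S : Finset ℕ} {P : ℕ → Finset V} {i : ℕ} {v : V}
    (hv : v ∈ P i) (h : HasTransversal G (S.erase i) fun j => (P j).filter (¬ G.Adj v ·)) :
    HasTransversal G S P := by
  obtain ⟨g, hg, hadj⟩ := h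
  refine ⟨Function.update g i v, fun j hj => ?_, fun j hj l hl hjl => ?_⟩
  · by_cases hji : j = i
    · subst hji; simpa using hv
    · rw [Function.update_of_ne hji]
      exact (Finset.mem_filter.1 (hg j (Finset.mem_erase.2 ⟨hji, hj⟩))).1
  · by_cases hji : j = i
    · subst hji
      rw [Function.update_self, Function.update_of_ne hjl.symm]
      exact (Finset.mem_filter.1 (hg l (Finset.mem_erase.2 ⟨hjl.symm, hl⟩))).2
    · rw [Function.update_of_ne hji]
      by_cases hli : l = i
      · subst hli
        rw [Function.update_self]
        exact fun e => (Finset.mem_filter.1 (hg j (Finset.mem_erase.2 ⟨hji, hj⟩))).2 e.symm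
      · rw [Function.update_of_ne hli]
        exact hadj j (Finset.mem_erase.2 ⟨hji, hj⟩) l (Finset.mem_erase.2 ⟨hli, hl⟩) hjl

section

variable {S : Finset ℕ} {P : ℕ → Finset V}

theorem FewEdges.filter_erase
    (hP : ∀ i ∈ S, ∀ j ∈ S, i ≠ j → FewEdges G (P i) (P j))
    {i : ℕ} {v : V} : ∀ j ∈ S.erase i, ∀ l ∈ S.erase i, j ≠ l →
    FewEdges G ((P j).filter (¬ G.Adj v ·)) ((P l).filter (¬ G.Adj v ·)) := by
  intro j hj l hl hjl a ha a' ha' b hb b' hb'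
  exact hP j (Finset.mem_of_mem_erase hj) l (Finset.mem_of_mem_erase hl) hjl a
    (Finset.mem_filter.1 ha).1 a' (Finset.mem_filter.1 ha').1 b (Finset.mem_filter.1 hb).1 b'
    (Finset.mem_filter.1 hb').1

theorem FewEdges.card_le_filter
    (hP : ∀ i ∈ S, ∀ j ∈ S, i ≠ j → FewEdges G (P i) (P j))
    {i j : ℕ} (hi : i ∈ S) (hj : j ∈ S.erase i) {v : V}
    (hv : v ∈ P i) : (P j).card ≤ ((P j).filter (¬ G.Adj v ·)).card + 1 := by
  have h1 := Finset.card_filter_add_card_filter_not (s := P j) (fun w => G.Adj v w)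
  have h2 : ((P j).filter (G.Adj v ·)).card ≤ 1 := by
    rw [Finset.card_le_one]
    intro a ha b hb
    rw [Finset.mem_filter] at ha hb
    rw [Finset.mem_erase] at hj
    exact (hP i hi j hj.2 hj.1.symm v hv v hv a ha.1 b hb.1 ha.2 hb.2).2
  omega

/-- Some vertex of `P i` has neighbours in few of the other sets. -/
theorem FewEdges.exists_few_hits
    (hP : ∀ i ∈ S, ∀ j ∈ S, i ≠ j → FewEdges G (P i) (P j))
    {i : ℕ} (hi : i ∈ S) {B : Finset ℕ} (hB : B ⊆ S.erase i) {c : ℕ}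
    (hc : B.card < (c + 1) * (P i).card) :
    ∃ v ∈ P i, (B.filter fun j => ∃ w ∈ P j, G.Adj v w).card ≤ c := by
  by_contra! hno
  have h1 : ((P i).biUnion fun v => B.filter fun j => ∃ w ∈ P j, G.Adj v w).card ≤ B.card :=
    Finset.card_le_card (Finset.biUnion_subset.2 fun v _ => Finset.filter_subset _ _)
  rw [Finset.card_biUnion] at h1
  · have h2 : (P i).card • (c + 1) ≤
        ∑ v ∈ P i, (B.filter fun j => ∃ w ∈ P j, G.Adj v w).card :=
      Finset.card_nsmul_le_sum _ _ _ hno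
    rw [smul_eq_mul, mul_comm] at h2
    omega
  · intro v hv v' hv' hne
    refine Finset.disjoint_left.2 fun j hj hj' => ?_
    rw [Finset.mem_filter] at hj hj'
    obtain ⟨hjB, w, hw, hvw⟩ := hj
    obtain ⟨-, w', hw', hvw'⟩ := hj'
    have hjS := Finset.mem_erase.1 (hB hjB)
    exact hne (hP i hi j hjS.2 hjS.1.symm v hv v' hv' w hw w' hw' hvw hvw').1

theorem filter_not_adj_eq {j : ℕ} {v : V} (h : ¬ ∃ w ∈ P j, G.Adj v w) :
    (P j).filter (¬ G.Adj v ·) = P j :=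
  Finset.filter_true_of_mem fun w hw e => h ⟨w, hw, e⟩

theorem hasTransversal_two
    (hP : ∀ i ∈ S, ∀ j ∈ S, i ≠ j → FewEdges G (P i) (P j))
    (hS : S.card ≤ 2) (h1 : ∀ i ∈ S, 1 ≤ (P i).card)
    (h2 : (S.filter fun i => (P i).card < 2).card ≤ 1) : HasTransversal G S P := by
  rcases S.eq_empty_or_nonempty with rfl | hne
  · exact HasTransversal.empty P
  obtain ⟨i, hi, hrest⟩ : ∃ i ∈ S, ∀ j ∈ S.erase i, 2 ≤ (P j).card := by
    by_cases hsm : ∃ i ∈ S, (P i).card < 2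
    · obtain ⟨i, hi, hlt⟩ := hsm
      refine ⟨i, hi, fun j hj => ?_⟩
      by_contra! hlt'
      rw [Finset.mem_erase] at hj
      exact hj.1 (Finset.card_le_one.1 h2 j (Finset.mem_filter.2 ⟨hj.2, hlt'⟩) i
        (Finset.mem_filter.2 ⟨hi, hlt⟩))
    · push Not at hsm
      obtain ⟨i, hi⟩ := hne
      exact ⟨i, hi, fun j hj => hsm j (Finset.mem_of_mem_erase hj)⟩
  obtain ⟨v, hv⟩ := Finset.card_pos.1 (h1 i hi)
  refine HasTransversal.of_erase hv ?_
  have hcard := Finset.card_erase_add_one hi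
  rcases (S.erase i).eq_empty_or_nonempty with h0 | ⟨j, hj⟩
  · rw [h0]; exact HasTransversal.empty _
  have hle := FewEdges.card_le_filter hP hi hj hv
  have h2' := hrest j hj
  obtain ⟨w, hw⟩ := Finset.card_pos.1
    (show 0 < ((P j).filter (¬ G.Adj v ·)).card by omega)
  have huniq : ∀ l ∈ S.erase i, l = j := fun l hl =>
    Finset.card_le_one.1 (by omega) l hl j hj
  exact ⟨fun _ => w, fun l hl => huniq l hl ▸ hw, fun l hl l' hl' hne' =>
    absurd ((huniq l hl).trans (huniq l' hl').symm) hne'⟩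

theorem hasTransversal_three
    (hP : ∀ i ∈ S, ∀ j ∈ S, i ≠ j → FewEdges G (P i) (P j))
    (hS : S.card ≤ 3) (h2 : ∀ i ∈ S, 2 ≤ (P i).card) :
    HasTransversal G S P := by
  rcases S.eq_empty_or_nonempty with rfl | ⟨i, hi⟩
  · exact HasTransversal.empty P
  have hcard := Finset.card_erase_add_one hi
  obtain ⟨v, hv, hfew⟩ := FewEdges.exists_few_hits hP hi (B := S.erase i) le_rfl (c := 1)
    (by have := h2 i hi; omega)
  refine HasTransversal.of_erase hv (hasTransversal_two (FewEdges.filter_erase hP) (by omega)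
    (fun j hj => ?_) (le_trans (Finset.card_le_card fun j hj => ?_) hfew))
  · have h3 := FewEdges.card_le_filter hP hi hj hv
    have h4 := h2 j (Finset.mem_of_mem_erase hj)
    omega
  · rw [Finset.mem_filter] at hj ⊢
    refine ⟨hj.1, by_contra fun hno => ?_⟩
    rw [filter_not_adj_eq hno] at hj
    have := h2 j (Finset.mem_of_mem_erase hj.1)
    omega

theorem hasTransversal_four
    (hP : ∀ i ∈ S, ∀ j ∈ S, i ≠ j → FewEdges G (P i) (P j))
    (hS : S.card ≤ 4) (h2 : ∀ i ∈ S, 2 ≤ (P i).card)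
    (h3 : (S.filter fun i => (P i).card < 3).card ≤ 2) : HasTransversal G S P := by
  by_cases hS3 : S.card ≤ 3
  · exact hasTransversal_three hP hS3 h2
  obtain ⟨i, hi, hni⟩ := Finset.exists_mem_notMem_of_card_lt_card
    (show (S.filter fun i => (P i).card < 3).card < S.card by omega)
  have hi3 : 3 ≤ (P i).card := by
    by_contra hlt
    exact hni (Finset.mem_filter.2 ⟨hi, by omega⟩)
  obtain ⟨v, hv, hfew⟩ := FewEdges.exists_few_hits hP hi
    (B := S.filter fun i => (P i).card < 3) (c := 0) (fun j hj => Finset.mem_erase.2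
      ⟨by rintro rfl; exact hni hj, (Finset.mem_filter.1 hj).1⟩) (by omega)
  have hcard := Finset.card_erase_add_one hi
  refine HasTransversal.of_erase hv (hasTransversal_three (FewEdges.filter_erase hP) (by omega)
    fun j hj => ?_)
  have hjS := Finset.mem_of_mem_erase hj
  by_cases hj3 : (P j).card < 3
  · have : ¬ ∃ w ∈ P j, G.Adj v w := fun hex => by
      have := Finset.card_eq_zero.1 (Nat.le_zero.1 hfew)
      exact Finset.notMem_empty j (this ▸ Finset.mem_filter.2
        ⟨Finset.mem_filter.2 ⟨hjS, hj3⟩, hex⟩)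
    rw [filter_not_adj_eq this]
    exact h2 j hjS
  · have := FewEdges.card_le_filter hP hi hj hv
    omega

theorem hasTransversal_five
    (hP : ∀ i ∈ S, ∀ j ∈ S, i ≠ j → FewEdges G (P i) (P j))
    (hS : S.card ≤ 5) (h2 : ∀ i ∈ S, 2 ≤ (P i).card)
    (h3 : (S.filter fun i => (P i).card < 3).card ≤ 1) : HasTransversal G S P := by
  by_cases hS3 : S.card ≤ 4
  · exact hasTransversal_four hP hS3 h2 (by omega)
  obtain ⟨i, hi, hrest⟩ : ∃ i ∈ S, ∀ j ∈ S.erase i, 3 ≤ (P j).card := by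
    by_cases hsm : ∃ i ∈ S, (P i).card < 3
    · obtain ⟨i, hi, hlt⟩ := hsm
      refine ⟨i, hi, fun j hj => ?_⟩
      by_contra! hlt'
      rw [Finset.mem_erase] at hj
      exact hj.1 (Finset.card_le_one.1 h3 j (Finset.mem_filter.2 ⟨hj.2, hlt'⟩) i
        (Finset.mem_filter.2 ⟨hi, hlt⟩))
    · push Not at hsm
      obtain ⟨i, hi⟩ := Finset.card_pos.1 (show 0 < S.card by omega)
      exact ⟨i, hi, fun j hj => hsm j (Finset.mem_of_mem_erase hj)⟩
  have hcard := Finset.card_erase_add_one hi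
  obtain ⟨v, hv, hfew⟩ := FewEdges.exists_few_hits hP hi (B := S.erase i) le_rfl (c := 2)
    (by have := h2 i hi; omega)
  refine HasTransversal.of_erase hv (hasTransversal_four (FewEdges.filter_erase hP) (by omega)
    (fun j hj => ?_) (le_trans (Finset.card_le_card fun j hj => ?_) hfew))
  · have h3 := FewEdges.card_le_filter hP hi hj hv
    have h4 := hrest j hj
    omega
  · rw [Finset.mem_filter] at hj ⊢
    refine ⟨hj.1, by_contra fun hno => ?_⟩
    rw [filter_not_adj_eq hno] at hj
    have := hrest j hj.1
    omega

theorem hasTransversal_six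
    (hP : ∀ i ∈ S, ∀ j ∈ S, i ≠ j → FewEdges G (P i) (P j))
    (hS : S.card ≤ 6) (h3 : ∀ i ∈ S, 3 ≤ (P i).card) :
    HasTransversal G S P := by
  rcases S.eq_empty_or_nonempty with rfl | ⟨i, hi⟩
  · exact HasTransversal.empty P
  have hcard := Finset.card_erase_add_one hi
  obtain ⟨v, hv, hfew⟩ := FewEdges.exists_few_hits hP hi (B := S.erase i) le_rfl (c := 1)
    (by have := h3 i hi; omega)
  refine HasTransversal.of_erase hv (hasTransversal_five (FewEdges.filter_erase hP) (by omega)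
    (fun j hj => ?_) (le_trans (Finset.card_le_card fun j hj => ?_) hfew))
  · have h4 := FewEdges.card_le_filter hP hi hj hv
    have h5 := h3 j (Finset.mem_of_mem_erase hj)
    omega
  · rw [Finset.mem_filter] at hj ⊢
    refine ⟨hj.1, by_contra fun hno => ?_⟩
    rw [filter_not_adj_eq hno] at hj
    have := h3 j (Finset.mem_of_mem_erase hj.1)
    omega

end

end Transversals

section Cliques

variable {V : Type} [Fintype V] {G : SimpleGraph V} {k m : ℕ}

/-- The vertices of `W` are pairwise adjacent. -/
def IsCliqueOn (G : SimpleGraph V) (W : Finset V) : Prop :=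
  ∀ x ∈ W, ∀ y ∈ W, x ≠ y → G.Adj x y

/-- The vertices of `U` with colour `c`. -/
noncomputable def fibre (U : Finset V) (f : V → ℕ) (c : ℕ) : Finset V := U.filter (f · = c)

@[simp] theorem mem_fibre {U : Finset V} {f : V → ℕ} {c : ℕ} {x : V} :
    x ∈ fibre U f c ↔ x ∈ U ∧ f x = c := by simp [fibre]

/-- The first `m` colour classes of `f` on `U` are complete graphs on four vertices. -/
def K4Fibres (G : SimpleGraph V) (U : Finset V) (f : V → ℕ) (m : ℕ) : Prop :=
  ∀ c < m, IsCliqueOn G (fibre U f c) ∧ (fibre U f c).card = 4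

theorem IsCliqueOn.card_le_four (hC : C5Free G) {W : Finset V} (hW : IsCliqueOn G W) :
    W.card ≤ 4 := by
  by_contra! hlt
  obtain ⟨e⟩ := Function.Embedding.nonempty_of_card_le (α := Fin 5) (β := {x // x ∈ W})
    (by simpa using Nat.succ_le_of_lt hlt)
  have hne : ∀ i j, i ≠ j → (e i : V) ≠ e j := fun i j hij h =>
    hij (e.injective (Subtype.ext h))
  have hadj : ∀ i j, i ≠ j → G.Adj (e i) (e j) := fun i j hij =>
    hW _ (e i).2 _ (e j).2 (hne i j hij)
  exact hC (e 0) (e 1) (e 2) (e 3) (e 4) (hadj _ _ (by decide)) (hadj _ _ (by decide))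
    (hadj _ _ (by decide)) (hadj _ _ (by decide)) (hadj _ _ (by decide)) (hne _ _ (by decide))
    (hne _ _ (by decide)) (hne _ _ (by decide)) (hne _ _ (by decide)) (hne _ _ (by decide))

theorem exists_two_more {κ : Finset V} (h4 : κ.card = 4) (a b : V) :
    ∃ c ∈ κ, ∃ d ∈ κ, c ≠ d ∧ c ≠ a ∧ c ≠ b ∧ d ≠ a ∧ d ≠ b := by
  have h1 : 1 < (κ \ {a, b}).card := by
    have := Finset.le_card_sdiff {a, b} κ
    have := Finset.card_le_two (a := a) (b := b)
    omega
  obtain ⟨c, hc, d, hd, hcd⟩ := Finset.one_lt_card.1 h1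
  simp only [Finset.mem_sdiff, Finset.mem_insert, Finset.mem_singleton, not_or] at hc hd
  exact ⟨c, hc.1, d, hd.1, hcd, hc.2.1, hc.2.2, hd.2.1, hd.2.2⟩

theorem IsCliqueOn.eq_of_adj (hC : C5Free G) {κ : Finset V} (hκ : IsCliqueOn G κ)
    (h4 : κ.card = 4) {v a b : V} (hv : v ∉ κ) (ha : a ∈ κ) (hb : b ∈ κ) (hva : G.Adj v a)
    (hvb : G.Adj v b) : a = b := by
  by_contra hab
  obtain ⟨c, hc, d, hd, hcd, hca, hcb, hda, hdb⟩ := exists_two_more h4 a b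
  have nv : ∀ x ∈ κ, v ≠ x := fun x hx h => hv (h ▸ hx)
  exact hC v a c d b hva (hκ a ha c hc hca.symm) (hκ c hc d hd hcd) (hκ d hd b hb hdb) hvb.symm
    (nv c hc) (nv d hd) hda.symm hab hcb

theorem IsCliqueOn.fewEdges (hC : C5Free G) {κ κ' : Finset V} (hκ : IsCliqueOn G κ)
    (h4 : κ.card = 4) (hκ' : IsCliqueOn G κ') (h4' : κ'.card = 4) (hd : Disjoint κ κ') :
    FewEdges G κ κ' := by
  intro a ha a' ha' b hb b' hb' hab hab'
  have nn : ∀ x ∈ κ, ∀ y ∈ κ', x ≠ y := fun x hx y hy h =>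
    Finset.disjoint_left.1 hd hx (h ▸ hy)
  by_cases h1 : a = a'
  · subst h1
    exact ⟨rfl, hκ'.eq_of_adj hC h4' (Finset.disjoint_left.1 hd ha) hb hb' hab hab'⟩
  by_cases h2 : b = b'
  · subst h2
    exact ⟨hκ.eq_of_adj hC h4 (Finset.disjoint_right.1 hd hb) ha ha' hab.symm hab'.symm, rfl⟩
  obtain ⟨c, hc, -, -, -, hca, hca', -⟩ := exists_two_more h4 a a'
  exact (hC a b b' a' c hab (hκ' b hb b' hb' h2) hab'.symm (hκ a' ha' c hc hca'.symm)
    (hκ c hc a ha hca) (nn a ha b' hb') h1 (nn a' ha' b hb).symm (nn c hc b hb).symm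
    (nn c hc b' hb').symm).elim

/-- Adjacent vertices far from `v` do not see different neighbours of `v`. -/
theorem C5Free.eq_of_adj_of_adj (hC : C5Free G) {v u w a b : V} (hu : G.Adj v u) (hw : G.Adj v w)
    (hab : G.Adj a b) (ha : ¬ G.Adj v a) (hva : v ≠ a) (hb : ¬ G.Adj v b) (hvb : v ≠ b)
    (hua : G.Adj u a) (hwb : G.Adj w b) : u = w := by
  by_contra huw
  exact hC v u a b w hu hua hab hwb.symm hw.symm hva hvb (fun h => hb (h ▸ hu)) huw
    (fun h => ha (h ▸ hw))

/-- Among the vertices of a complete graph on four vertices far from `v`, at most one sees a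
neighbour of `v`. -/
theorem IsCliqueOn.eq_of_dominated (hC : C5Free G) {κ : Finset V} (hκ : IsCliqueOn G κ)
    (h4 : κ.card = 4) {v u w a b : V} (hκv : κ ⊆ (closedNbrs G {v})ᶜ) (hu : G.Adj v u)
    (hw : G.Adj v w) (ha : a ∈ κ) (hb : b ∈ κ) (hua : G.Adj u a) (hwb : G.Adj w b) : a = b := by
  by_contra hab
  have far : ∀ x ∈ κ, v ≠ x ∧ ¬ G.Adj v x := fun x hx => by
    have := hκv hx
    simp only [Finset.mem_compl, mem_closedNbrs, Finset.mem_singleton, not_or] at this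
    exact ⟨fun h => this.1 h.symm, fun h => this.2 ⟨v, rfl, h⟩⟩
  have huw := hC.eq_of_adj_of_adj hu hw (hκ a ha b hb hab) (far a ha).2 (far a ha).1 (far b hb).2
    (far b hb).1 hua hwb
  subst huw
  exact hab (hκ.eq_of_adj hC h4 (fun h => (far u h).2 hu) ha hb hua hwb)

theorem mem_compl_closedNbrs_singleton {v x : V} :
    x ∈ (closedNbrs G {v})ᶜ ↔ x ≠ v ∧ ¬ G.Adj v x := by
  simp

theorem CliqueCover.exists_colouring {U : Finset V}
    (h : CliqueCover (G.comap (Subtype.val : {x // x ∈ U} → V)) k) :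
    ∃ f : V → ℕ, (∀ x ∈ U, f x < k) ∧ ∀ c, IsCliqueOn G (fibre U f c) := by
  obtain ⟨f, hf, hadj⟩ := h
  refine ⟨fun v => if hv : v ∈ U then f ⟨v, hv⟩ else 0, fun x hx => ?_,
    fun c x hx y hy hne => ?_⟩
  · simpa [hx] using hf ⟨x, hx⟩
  · rw [mem_fibre] at hx hy
    have hxy := hx.2.trans hy.2.symm
    simp only [hx.1, hy.1, dite_true] at hxy
    exact hadj ⟨x, hx.1⟩ ⟨y, hy.1⟩ hxy (by simpa using hne)

theorem sum_card_fibre {U : Finset V} {f : V → ℕ} (hf : ∀ x ∈ U, f x < k) :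
    ∑ c ∈ Finset.range k, (fibre U f c).card = U.card :=
  (Finset.card_eq_sum_card_fiberwise (t := Finset.range k) fun x hx => by
    simpa using hf x hx).symm

theorem card_fibre_eq_four {U : Finset V} {f : V → ℕ}
    (h4 : ∀ c, (fibre U f c).card ≤ 4)
    (hs : 4 * m ≤ ∑ c ∈ Finset.range m, (fibre U f c).card) : ∀ c < m, (fibre U f c).card = 4 := by
  have h1 : ∑ c ∈ Finset.range m, (fibre U f c).card ≤ ∑ c ∈ Finset.range m, 4 :=
    Finset.sum_le_sum fun c _ => h4 c
  have h2 : ∑ c ∈ Finset.range m, 4 = 4 * m := by simp [mul_comm]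
  intro c hc
  exact (Finset.sum_eq_sum_iff_of_le fun c _ => h4 c).1 (le_antisymm h1 (h2 ▸ hs)) c
    (Finset.mem_range.2 hc)

theorem CliqueCover.exists_k4Fibres (hC : C5Free G) {U : Finset V}
    (h : CliqueCover (G.comap (Subtype.val : {x // x ∈ U} → V)) m) (hU : U.card = 4 * m) :
    ∃ f, K4Fibres G U f m := by
  obtain ⟨f, hf, hcl⟩ := h.exists_colouring
  have := card_fibre_eq_four (m := m) (fun c => (hcl c).card_le_four hC)
    (by rw [sum_card_fibre hf, hU])
  exact ⟨f, fun c hc => ⟨hcl c, this c hc⟩⟩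

theorem CliqueCover.exists_k4Fibres_succ (hC : C5Free G) {U : Finset V}
    (h : CliqueCover (G.comap (Subtype.val : {x // x ∈ U} → V)) (m + 1))
    (hU : U.card = 4 * m + 3) :
    ∃ f, (∀ x ∈ U, f x < m + 1) ∧ K4Fibres G U f m ∧ IsCliqueOn G (fibre U f m) ∧
      (fibre U f m).card = 3 := by
  obtain ⟨f, hf, hcl⟩ := h.exists_colouring
  obtain ⟨c₀, hc₀, hlt⟩ : ∃ c ∈ Finset.range (m + 1), (fibre U f c).card < 4 := by
    by_contra! hge
    have := Finset.card_nsmul_le_sum _ _ _ hge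
    rw [sum_card_fibre hf, Finset.card_range, smul_eq_mul] at this
    omega
  rw [Finset.mem_range] at hc₀
  let σ := Equiv.swap c₀ m
  have hfib : ∀ c, fibre U (fun x => σ (f x)) c = fibre U f (σ c) := fun c => by
    ext x
    simp only [mem_fibre, σ, Equiv.swap_apply_eq_iff]
  have hσ : ∀ x ∈ U, σ (f x) < m + 1 := fun x hx => by
    have := hf x hx
    simp only [σ, Equiv.swap_apply_def]
    split_ifs <;> omega
  have hcl' : ∀ c, IsCliqueOn G (fibre U (fun x => σ (f x)) c) := fun c => hfib c ▸ hcl _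
  have hsum := sum_card_fibre hσ
  have hm : (fibre U (fun x => σ (f x)) m).card < 4 := by
    rw [hfib]
    simpa [σ] using hlt
  rw [Finset.sum_range_succ, hU] at hsum
  have h4 : ∀ c < m, (fibre U (fun x => σ (f x)) c).card = 4 :=
    card_fibre_eq_four (fun c => (hcl' c).card_le_four hC) (by omega)
  have hsum' : ∑ c ∈ Finset.range m, (fibre U (fun x => σ (f x)) c).card = m * 4 := by
    rw [Finset.sum_congr rfl fun c hc => h4 c (Finset.mem_range.1 hc)]
    simp
  exact ⟨_, hσ, fun c hc => ⟨hcl' c, h4 c hc⟩, hcl' m, by omega⟩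

theorem K4Fibres.fewEdges (hC : C5Free G) {U : Finset V} {f : V → ℕ} (h : K4Fibres G U f m)
    {P : ℕ → Finset V} (hP : ∀ c < m, P c ⊆ fibre U f c) :
    ∀ i ∈ Finset.range m, ∀ j ∈ Finset.range m, i ≠ j → FewEdges G (P i) (P j) := by
  intro i hi j hj hij a ha a' ha' b hb b' hb'
  rw [Finset.mem_range] at hi hj
  refine (h i hi).1.fewEdges hC (h i hi).2 (h j hj).1 (h j hj).2 (Finset.disjoint_left.2 ?_) a
    (hP i hi ha) a' (hP i hi ha') b (hP j hj hb) b' (hP j hj hb')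
  intro x hx hx'
  exact hij ((mem_fibre.1 hx).2.symm.trans (mem_fibre.1 hx').2)

theorem AlphaLE.card_add_le (hα : AlphaLE G k) {J : Finset V} (hJ : Indep G J) {f : V → ℕ}
    {P : ℕ → Finset V} (hT : HasTransversal G (Finset.range m) P)
    (hP : ∀ c < m, ∀ x ∈ P c, f x = c ∧ x ∉ J ∧ ∀ u ∈ J, ¬ G.Adj u x) : J.card + m ≤ k := by
  obtain ⟨g, hg, hadj⟩ := hT
  have hg' : ∀ c < m, _ := fun c hc => hP c hc (g c) (hg c (Finset.mem_range.2 hc))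
  have hcard : ((Finset.range m).image g).card = m := by
    rw [Finset.card_image_of_injOn, Finset.card_range]
    intro a ha b hb hab
    rw [Finset.coe_range, Set.mem_Iio] at ha hb
    rw [← (hg' a ha).1, ← (hg' b hb).1, hab]
  have hdisj : Disjoint J ((Finset.range m).image g) := by
    refine Finset.disjoint_right.2 fun x hx => ?_
    obtain ⟨c, hc, rfl⟩ := Finset.mem_image.1 hx
    exact (hg' c (Finset.mem_range.1 hc)).2.1
  have hI : Indep G (J ∪ (Finset.range m).image g) := by
    refine hJ.union (fun x hx y hy => ?_) fun x hx y hy => ?_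
    · obtain ⟨c, hc, rfl⟩ := Finset.mem_image.1 hx
      obtain ⟨d, hd, rfl⟩ := Finset.mem_image.1 hy
      by_cases hcd : c = d
      · subst hcd; exact G.irrefl
      · exact hadj c hc d hd hcd
    · obtain ⟨c, hc, rfl⟩ := Finset.mem_image.1 hy
      exact (hg' c (Finset.mem_range.1 hc)).2.2 x hx
  have := hα _ hI
  rw [Finset.card_union_of_disjoint hdisj, hcard] at this
  exact this

/-- If the vertices far from `v` are covered by complete graphs on four vertices and `G` has no
larger independent set than it must have, then the neighbours of `v` are pairwise adjacent. -/
theorem K4Fibres.isCliqueOn_nbrs (hC : C5Free G) (hα : AlphaLE G (m + 1)) (hm : m ≤ 6) {v : V}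
    {f : V → ℕ} (h : K4Fibres G (closedNbrs G {v})ᶜ f m) : IsCliqueOn G (nbrs G v) := by
  have : Nonempty V := ⟨v⟩
  intro u hu w hw huw
  by_contra hno
  rw [mem_nbrs] at hu hw
  let P : ℕ → Finset V := fun c =>
    (fibre (closedNbrs G {v})ᶜ f c).filter fun x => ¬ (G.Adj u x ∨ G.Adj w x)
  have hP : ∀ c < m, P c ⊆ fibre (closedNbrs G {v})ᶜ f c := fun c _ => Finset.filter_subset _ _
  have hcard : ∀ c ∈ Finset.range m, 3 ≤ (P c).card := fun c hc => by
    obtain ⟨hcl, h4⟩ := h c (Finset.mem_range.1 hc)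
    have hsub : fibre (closedNbrs G {v})ᶜ f c ⊆ (closedNbrs G {v})ᶜ := Finset.filter_subset _ _
    have h1 := Finset.card_filter_add_card_filter_not (s := fibre (closedNbrs G {v})ᶜ f c)
      (fun x => G.Adj u x ∨ G.Adj w x)
    have h2 : ((fibre (closedNbrs G {v})ᶜ f c).filter fun x => G.Adj u x ∨ G.Adj w x).card ≤ 1 := by
      refine Finset.card_le_one.2 fun a ha b hb => ?_
      rw [Finset.mem_filter] at ha hb
      rcases ha.2 with h3 | h3 <;> rcases hb.2 with h5 | h5
      · exact hcl.eq_of_dominated hC h4 hsub hu hu ha.1 hb.1 h3 h5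
      · exact hcl.eq_of_dominated hC h4 hsub hu hw ha.1 hb.1 h3 h5
      · exact hcl.eq_of_dominated hC h4 hsub hw hu ha.1 hb.1 h3 h5
      · exact hcl.eq_of_dominated hC h4 hsub hw hw ha.1 hb.1 h3 h5
    show 3 ≤ ((fibre (closedNbrs G {v})ᶜ f c).filter fun x => ¬ (G.Adj u x ∨ G.Adj w x)).card
    omega
  have := hα.card_add_le (Indep.pair hno) (f := f)
    (hasTransversal_six (h.fewEdges hC hP) (by simpa using hm) hcard) fun c hc x hx => by
      obtain ⟨h1, h2⟩ := Finset.mem_filter.1 hx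
      rw [mem_fibre, mem_compl_closedNbrs_singleton] at h1
      simp only [Finset.mem_insert, Finset.mem_singleton, not_or] at h2 ⊢
      refine ⟨h1.2, ⟨?_, ?_⟩, ?_⟩
      · rintro rfl; exact h1.1.2 hu
      · rintro rfl; exact h1.1.2 hw
      · rintro y (rfl | rfl)
        exacts [h2.1, h2.2]
  rw [Finset.card_pair huw] at this
  omega

end Cliques

section Induction

variable {V : Type} [Fintype V] {G : SimpleGraph V} {k m : ℕ}

/-- A graph without five-cycles and with independence number at most `k` has at most `4 k`
vertices. -/
def OrderBound (k : ℕ) : Prop :=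
  ∀ (V : Type) [Fintype V] (G : SimpleGraph V), C5Free G → AlphaLE G k → Fintype.card V ≤ 4 * k

/-- A graph without five-cycles, with independence number at most `k` and with `4 k` vertices is
covered by `k` cliques. -/
def FullCover (k : ℕ) : Prop :=
  ∀ (V : Type) [Fintype V] (G : SimpleGraph V), C5Free G → AlphaLE G k →
    Fintype.card V = 4 * k → CliqueCover G k

/-- A graph without five-cycles, with independence number at most `k` and with `4 k - 1` vertices
is covered by `k` cliques. -/
def NearCover (k : ℕ) : Prop :=
  ∀ (V : Type) [Fintype V] (G : SimpleGraph V), C5Free G → AlphaLE G k →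
    Fintype.card V + 1 = 4 * k → CliqueCover G k

theorem AlphaLE.mono (h : AlphaLE G k) (hkm : k ≤ m) : AlphaLE G m :=
  fun s hs => (h s hs).trans hkm

theorem AlphaLE.comap_compl_singleton (hα : AlphaLE G (k + 1)) (v : V) :
    AlphaLE (G.comap (Subtype.val : {x // x ∈ (closedNbrs G {v})ᶜ} → V)) k := by
  simpa using hα.comap_compl_closedNbrs (Indep.singleton v)

theorem card_compl_closedNbrs_singleton (v : V) :
    (closedNbrs G {v})ᶜ.card + (nbrs G v).card + 1 = Fintype.card V := by
  have h1 := Finset.card_add_card_compl (closedNbrs G {v})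
  have h2 := card_closedNbrs_singleton (G := G) v
  omega

theorem exists_isK4_of_card {n : ℕ} (hB : K4FreeBound k n) (hC : C5Free G) (hα : AlphaLE G k)
    (hn : n < Fintype.card V) : ∃ q, IsK4 G q :=
  exists_isK4 fun hK => hn.not_ge (hB V G hC hK hα)

theorem OrderBound.le_card_nbrs (hB : OrderBound k) (hC : C5Free G) (hα : AlphaLE G (k + 1))
    (v : V) : Fintype.card V ≤ 4 * k + (nbrs G v).card + 1 := by
  have h1 := hB _ _ (hC.comap Subtype.val_injective) (hα.comap_compl_singleton v)
  have h2 := card_compl_closedNbrs_singleton (G := G) v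
  rw [Fintype.card_coe] at h1
  omega

/-- A vertex of the least possible degree has a clique as its closed neighbourhood, and the
remaining vertices are covered by cliques. -/
theorem FullCover.isCliqueOn_closedNbrs (hF : FullCover k) (hk : k ≤ 6) (hC : C5Free G)
    (hα : AlphaLE G (k + 1)) {v : V} (hv : Fintype.card V = 4 * k + (nbrs G v).card + 1) :
    IsCliqueOn G (closedNbrs G {v}) ∧
      CliqueCover (G.comap (Subtype.val : {x // x ∈ (closedNbrs G {v})ᶜ} → V)) k := by
  have h2 := card_compl_closedNbrs_singleton (G := G) v
  have hcov := hF _ _ (hC.comap Subtype.val_injective) (hα.comap_compl_singleton v)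
    (by rw [Fintype.card_coe]; omega)
  obtain ⟨f, hf⟩ := hcov.exists_k4Fibres hC (by omega)
  refine ⟨?_, hcov⟩
  rw [closedNbrs_singleton]
  intro x hx y hy hxy
  rcases Finset.mem_insert.1 hx with rfl | hx <;> rcases Finset.mem_insert.1 hy with rfl | hy
  · exact absurd rfl hxy
  · exact mem_nbrs.1 hy
  · exact (mem_nbrs.1 hx).symm
  · exact hf.isCliqueOn_nbrs hC hα hk x hx y hy hxy

theorem FullCover.cliqueCover_of_card (hF : FullCover k) (hk : k ≤ 6) (hC : C5Free G)
    (hα : AlphaLE G (k + 1)) {v : V} (hv : Fintype.card V = 4 * k + (nbrs G v).card + 1) :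
    CliqueCover G (k + 1) :=
  have h := hF.isCliqueOn_closedNbrs hk hC hα hv
  CliqueCover.extend h.1 h.2

/-- A graph with too many vertices has minimum degree at least five. -/
theorem OrderBound.five_le_card_nbrs (hB : OrderBound k) (hF : FullCover k) (hk : k ≤ 6)
    (hC : C5Free G) (hα : AlphaLE G (k + 1)) (hn : 4 * (k + 1) < Fintype.card V) (v : V) :
    5 ≤ (nbrs G v).card := by
  have h1 := hB.le_card_nbrs hC hα v
  by_contra! hlt
  have h2 := (hF.isCliqueOn_closedNbrs hk hC hα (v := v) (by omega)).1.card_le_four hC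
  rw [card_closedNbrs_singleton] at h2
  omega

theorem exists_isK4_of_le_five (hk : k ≤ 5) (hC : C5Free G) (hα : AlphaLE G k)
    (hn : 4 * k ≤ Fintype.card V + 1) (hk' : k ≤ 2 → 4 * k ≤ Fintype.card V)
    (h0 : 0 < k) : ∃ q, IsK4 G q := by
  interval_cases k
  · exact exists_isK4_of_card k4FreeBound_one hC hα (by omega)
  · exact exists_isK4_of_card k4FreeBound_two hC hα (by omega)
  · exact exists_isK4_of_card k4FreeBound_three hC hα (by omega)
  · exact exists_isK4_of_card k4FreeBound_four hC hα (by omega)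
  · exact exists_isK4_of_card k4FreeBound_five hC hα (by omega)

theorem OrderBound.succ (hB : OrderBound k) (hF : FullCover k) (hk : k + 1 ≤ 5) :
    OrderBound (k + 1) := by
  intro V _ G hC hα
  by_contra! hn
  have hδ := hB.five_le_card_nbrs hF (by omega) hC hα hn
  obtain ⟨q, hq⟩ := exists_isK4_of_le_five hk hC hα (by omega) (by omega) (by omega)
  have h1 := hq.card_portX_le_one hC (hα.mono hk) (fun v => by have := hδ v; omega) 0
  have h2 := hq.card_nbrs 0
  have h3 := hδ (q 0)
  omega

theorem FullCover.succ (hB : OrderBound k) (hF : FullCover k) (hk : k + 1 ≤ 5) :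
    FullCover (k + 1) := by
  intro V _ G hC hα hn
  by_cases hδ : ∀ v, 4 ≤ (nbrs G v).card
  · obtain ⟨q, hq⟩ := exists_isK4_of_le_five hk hC hα (by omega) (by omega) (by omega)
    have h := hq.exists_five_cliques hC (hα.mono hk) hδ
    obtain rfl : k = 4 := by omega
    exact h.2 hn
  · push Not at hδ
    obtain ⟨v, hv⟩ := hδ
    have := hB.le_card_nbrs hC hα v
    exact hF.cliqueCover_of_card (by omega) hC hα (v := v) (by omega)

theorem OrderBound.and_fullCover (hk : k ≤ 5) : OrderBound k ∧ FullCover k := by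
  induction k with
  | zero =>
    have h : OrderBound 0 := fun V _ G _ hα => by
      by_contra! hn
      obtain ⟨v⟩ := Fintype.card_pos_iff.1 hn
      simpa using hα {v} (Indep.singleton v)
    refine ⟨h, fun V _ G _ _ hn => ⟨fun _ => 0, fun v => ?_, fun x => ?_⟩⟩
    · exact ((Fintype.card_eq_zero_iff.1 hn).false v).elim
    · exact ((Fintype.card_eq_zero_iff.1 hn).false x).elim
  | succ k ih =>
    obtain ⟨hB, hF⟩ := ih (by omega)
    exact ⟨hB.succ hF hk, hF.succ hB hk⟩

theorem IsK4.isCliqueOn {q : Fin 4 → V} (hq : IsK4 G q) : IsCliqueOn G (Finset.univ.image q) := by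
  intro x hx y hy hxy
  obtain ⟨i, -, rfl⟩ := Finset.mem_image.1 hx
  obtain ⟨j, -, rfl⟩ := Finset.mem_image.1 hy
  exact hq i j fun h => hxy (h ▸ rfl)

theorem nearCover_two : NearCover 2 := by
  intro V _ G hC hα hn
  obtain ⟨q, hq⟩ := exists_isK4_of_card k4FreeBound_two hC hα (by omega)
  set κ := Finset.univ.image q
  have h4 : κ.card = 4 := hq.image_card
  have hκ : IsCliqueOn G κ := hq.isCliqueOn
  refine CliqueCover.extend hκ ⟨fun _ => 0, fun _ => Nat.one_pos, ?_⟩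
  rintro ⟨x, hx⟩ ⟨y, hy⟩ - hne
  rw [Finset.mem_compl] at hx hy
  show G.Adj x y
  by_contra hno
  have hle : ∀ v ∉ κ, (κ.filter (G.Adj v ·)).card ≤ 1 := fun v hv =>
    Finset.card_le_one.2 fun a ha b hb => by
      rw [Finset.mem_filter] at ha hb
      exact hκ.eq_of_adj hC h4 hv ha.1 hb.1 ha.2 hb.2
  obtain ⟨z, hz, hz'⟩ := Finset.exists_mem_notMem_of_card_lt_card
    (show (κ.filter (G.Adj x ·) ∪ κ.filter (G.Adj y ·)).card < κ.card by
      have h1 := Finset.card_union_le (κ.filter (G.Adj x ·)) (κ.filter (G.Adj y ·))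
      have h2 := hle x hx
      have h3 := hle y hy
      omega)
  simp only [Finset.mem_union, Finset.mem_filter, hz, true_and, not_or] at hz'
  have hI : Indep G {z, x, y} := (Indep.pair hno).insert (by
    simpa [G.adj_comm z] using hz')
  have h5 := hα _ hI
  have hxy : x ≠ y := by simpa using hne
  have hzx : z ≠ x := fun h => hx (h ▸ hz)
  have hzy : z ≠ y := fun h => hy (h ▸ hz)
  rw [Finset.card_eq_three.2 ⟨z, x, y, hzx, hzy, hxy, rfl⟩] at h5
  omega

theorem mem_closedNbrs_singleton {v x : V} : x ∈ closedNbrs G {v} ↔ x = v ∨ G.Adj v x := by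
  simp

/-- The case of a vertex of degree three in the induction step for `NearCover`. -/
theorem NearCover.cliqueCover_of_degree_three (hN : NearCover (m + 1)) (hm : m ≤ 3)
    (hC : C5Free G) (hα : AlphaLE G (m + 2)) (hn : Fintype.card V = 4 * m + 7) {v : V}
    (hv : (nbrs G v).card = 3) : CliqueCover G (m + 2) := by
  have : Nonempty V := ⟨v⟩
  have hUcard : (closedNbrs G {v})ᶜ.card = 4 * m + 3 := by
    have := card_compl_closedNbrs_singleton (G := G) v
    omega
  obtain ⟨f, hf, hK, hτ, hτ3⟩ := (hN _ _ (hC.comap Subtype.val_injective)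
    (hα.comap_compl_singleton v) (by rw [Fintype.card_coe]; omega)).exists_k4Fibres_succ hC hUcard
  set U := (closedNbrs G {v})ᶜ
  set W := closedNbrs G {v} ∪ fibre U f m with hW
  have hWcard : W.card = 7 := by
    rw [hW, Finset.card_union_of_disjoint, card_closedNbrs_singleton, hv, hτ3]
    exact Finset.disjoint_right.2 fun x hx => Finset.mem_compl.1 (mem_fibre.1 hx).1
  have hWc : ∀ x, x ∉ W → x ∈ U ∧ f x < m := fun x hx => by
    rw [hW, Finset.mem_union, not_or, mem_fibre, not_and] at hx
    have hxU : x ∈ U := Finset.mem_compl.2 hx.1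
    have := hf x hxU
    have := hx.2 hxU
    exact ⟨hxU, by omega⟩
  by_cases hαW : AlphaLE (G.comap (Subtype.val : {x // x ∈ W} → V)) 2
  · obtain ⟨g, hg, hgcl⟩ := (nearCover_two _ _ (hC.comap Subtype.val_injective) hαW
      (by rw [Fintype.card_coe, hWcard])).exists_colouring
    refine ⟨fun x => if x ∈ W then m + g x else f x, fun x => ?_, fun x y hxy hne => ?_⟩
    · dsimp only
      split_ifs with hx
      · have := hg x hx; omega
      · have := hWc x hx; omega
    · dsimp only at hxy
      split_ifs at hxy with hx hy hy
      · exact hgcl (g x) x (mem_fibre.2 ⟨hx, rfl⟩) y (mem_fibre.2 ⟨hy, by omega⟩) hne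
      · have := hWc y hy; omega
      · have := hWc x hx; omega
      · obtain ⟨hxU, hxm⟩ := hWc x hx
        exact (hK (f x) hxm).1 x (mem_fibre.2 ⟨hxU, rfl⟩) y
          (mem_fibre.2 ⟨(hWc y hy).1, hxy.symm⟩) hne
  exfalso
  unfold AlphaLE at hαW
  push Not at hαW
  obtain ⟨s, hs, hs3⟩ := hαW
  set J := s.map (Function.Embedding.subtype _) with hJ
  have hJI : Indep G J := hs.map_subtype
  have hJW : ∀ x ∈ J, x ∈ W := fun x hx => by
    obtain ⟨y, -, rfl⟩ := Finset.mem_map.1 hx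
    exact y.2
  let P : ℕ → Finset V := fun c => (fibre U f c).filter fun x => ¬ ∃ u ∈ J, G.Adj u x
  have hP : ∀ c < m, P c ⊆ fibre U f c := fun c _ => Finset.filter_subset _ _
  have hcard : ∀ c ∈ Finset.range m, 2 ≤ (P c).card := fun c hc => by
    rw [Finset.mem_range] at hc
    obtain ⟨hcl, h4⟩ := hK c hc
    have hsub : fibre U f c ⊆ U := Finset.filter_subset _ _
    have h1 := Finset.card_filter_add_card_filter_not (s := fibre U f c)
      (fun x => ∃ u ∈ J, G.Adj u x)
    have h2 : ((fibre U f c).filter fun x => ∃ u, G.Adj v u ∧ G.Adj u x).card ≤ 1 := by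
      refine Finset.card_le_one.2 fun a ha b hb => ?_
      rw [Finset.mem_filter] at ha hb
      obtain ⟨ha, u, hu, hua⟩ := ha
      obtain ⟨hb, w, hw, hwb⟩ := hb
      exact hcl.eq_of_dominated hC h4 hsub hu hw ha hb hua hwb
    have h3 : ((fibre U f c).filter fun x => ∃ u ∈ J, u ∈ fibre U f m ∧ G.Adj u x).card ≤ 1 := by
      refine Finset.card_le_one.2 fun a ha b hb => ?_
      rw [Finset.mem_filter] at ha hb
      obtain ⟨ha, u, huJ, hu, hua⟩ := ha
      obtain ⟨hb, w, hwJ, hw, hwb⟩ := hb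
      obtain rfl : u = w := by
        by_contra huw
        exact hJI u huJ w hwJ (hτ u hu w hw huw)
      refine hcl.eq_of_adj hC h4 (fun h => ?_) ha hb hua hwb
      have h5 := (mem_fibre.1 h).2
      have h6 := (mem_fibre.1 hu).2
      omega
    have h5 : (fibre U f c).filter (fun x => ∃ u ∈ J, G.Adj u x) ⊆
        ((fibre U f c).filter fun x => ∃ u, G.Adj v u ∧ G.Adj u x) ∪
        (fibre U f c).filter fun x => ∃ u ∈ J, u ∈ fibre U f m ∧ G.Adj u x := by
      intro x hx
      obtain ⟨hx, u, huJ, hux⟩ := Finset.mem_filter.1 hx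
      rw [Finset.mem_union, Finset.mem_filter, Finset.mem_filter]
      rcases Finset.mem_union.1 (hJW u huJ) with hu | hu
      · rcases mem_closedNbrs_singleton.1 hu with rfl | hu
        · exact absurd hux (mem_compl_closedNbrs_singleton.1 (hsub hx)).2
        · exact Or.inl ⟨hx, u, hu, hux⟩
      · exact Or.inr ⟨hx, u, huJ, hu, hux⟩
    have h6 := (Finset.card_le_card h5).trans (Finset.card_union_le _ _)
    show 2 ≤ ((fibre U f c).filter fun x => ¬ ∃ u ∈ J, G.Adj u x).card
    omega
  have := hα.card_add_le hJI (f := f)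
    (hasTransversal_three (hK.fewEdges hC hP) (by simpa using hm) hcard) fun c hc x hx => by
      obtain ⟨h1, h2⟩ := Finset.mem_filter.1 hx
      rw [mem_fibre] at h1
      refine ⟨h1.2, fun hxJ => ?_, fun u hu hux => h2 ⟨u, hu, hux⟩⟩
      rcases Finset.mem_union.1 (hJW x hxJ) with h3 | h3
      · exact Finset.mem_compl.1 h1.1 h3
      · have := (mem_fibre.1 h3).2
        omega
  rw [hJ, Finset.card_map] at this
  omega

theorem NearCover.succ (hN : NearCover (m + 1)) (hm1 : 1 ≤ m) (hm : m ≤ 3) :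
    NearCover (m + 2) := by
  intro V _ G hC hα hn
  obtain ⟨hB, hF⟩ := OrderBound.and_fullCover (k := m + 1) (by omega)
  by_cases hδ : ∀ v, 4 ≤ (nbrs G v).card
  · obtain ⟨q, hq⟩ := exists_isK4_of_le_five (k := m + 2) (by omega) hC hα (by omega) (by omega)
      (by omega)
    have := (hq.exists_five_cliques hC (hα.mono (by omega)) hδ).1
    omega
  · push Not at hδ
    obtain ⟨v, hv⟩ := hδ
    have h1 := hB.le_card_nbrs hC hα v
    by_cases h2 : (nbrs G v).card = 3
    · exact hN.cliqueCover_of_degree_three hm hC hα (by omega) h2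
    · exact hF.cliqueCover_of_card (by omega) hC hα (v := v) (by omega)

theorem nearCover_five : NearCover 5 :=
  ((nearCover_two.succ le_rfl (by omega)).succ (by omega) (by omega)).succ (by omega) le_rfl

end Induction

section SmallPort

variable {V : Type} [Fintype V] {G : SimpleGraph V} {q : Fin 4 → V}

theorem eq_or_eq_of_adj_of_portX {i : Fin 4} {x w : V} (hx : portX G q i = {x})
    (hw : G.Adj (q i) w) : w = x ∨ ∃ j, j ≠ i ∧ w = q j := by
  by_cases h : ∃ j, w = q j
  · obtain ⟨j, rfl⟩ := h
    exact Or.inr ⟨j, fun h => hw.ne (h ▸ rfl), rfl⟩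
  · push Not at h
    exact Or.inl (Finset.mem_singleton.1 (hx ▸ mem_portX.2 ⟨hw, h⟩))

/-- A vertex far from `q i` sees at most one neighbour of `q i`, if only one of these neighbours
lies outside `q`. -/
theorem IsK4.eq_of_adj_of_portX (hq : IsK4 G q) (hC : C5Free G) {i : Fin 4} {x u u' w : V}
    (hx : portX G q i = {x}) (hw : w ∈ (closedNbrs G {q i})ᶜ) (hu : G.Adj (q i) u)
    (hu' : G.Adj (q i) u') (huw : G.Adj u w) (huw' : G.Adj u' w) : u = u' := by
  rw [mem_compl_closedNbrs_singleton] at hw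
  have hwq : ∀ j, w ≠ q j := fun j h => by
    by_cases hij : i = j
    · exact hw.1 (h.trans (hij ▸ rfl))
    · exact hw.2 (h ▸ hq i j hij)
  have hxX : x ∈ portX G q i := hx ▸ Finset.mem_singleton_self x
  have key : ∀ j, j ≠ i → G.Adj (q j) w → ¬ G.Adj x w := fun j hji h1 h2 => by
    obtain ⟨l, -, hli, hlj, -⟩ := exists_two_others hji.symm
    have hx' := mem_portX.1 hxX
    exact hC w (q j) (q l) (q i) x h1.symm (hq _ _ hlj.symm) (hq _ _ hli) hx'.1 h2 (hwq l) (hwq i)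
      (hq.ne hji) (hx'.2 j).symm (hx'.2 l).symm
  rcases eq_or_eq_of_adj_of_portX hx hu with rfl | ⟨j, hj, rfl⟩ <;>
    rcases eq_or_eq_of_adj_of_portX hx hu' with rfl | ⟨l, hl, rfl⟩
  · rfl
  · exact (key l hl huw' huw).elim
  · exact (key j hj huw huw').elim
  · exact hq.isCliqueOn.eq_of_adj hC hq.image_card (by simpa using fun j h => hwq j h.symm)
      (by simp) (by simp) huw.symm huw'.symm

theorem IsK4.cliqueCover_six (hq : IsK4 G q) (hC : C5Free G) (hα : AlphaLE G 6)
    (hδ : ∀ v, 4 ≤ (nbrs G v).card) (hn : Fintype.card V = 24) {i : Fin 4}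
    (hX : (portX G q i).card ≤ 1) : CliqueCover G 6 := by
  have : Nonempty V := ⟨q i⟩
  have hne := hq.portX_nonempty hδ
  obtain ⟨x, hx⟩ : ∃ x, portX G q i = {x} :=
    Finset.card_eq_one.1 (le_antisymm hX (Finset.card_pos.2 (hne i)))
  have hxX : x ∈ portX G q i := hx ▸ Finset.mem_singleton_self x
  have hxq := mem_portX.1 hxX
  have hUcard : (closedNbrs G {q i})ᶜ.card = 4 * 4 + 3 := by
    have h1 := card_compl_closedNbrs_singleton (G := G) (q i)
    have h2 := hq.card_nbrs i
    rw [hx, Finset.card_singleton] at h2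
    omega
  have huniq := fun w hw u u' => hq.eq_of_adj_of_portX hC (u := u) (u' := u') (w := w) hx hw
  obtain ⟨f, hf, hK, hτ, hτ3⟩ := (nearCover_five _ _ (hC.comap Subtype.val_injective)
    (hα.comap_compl_singleton (q i)) (by rw [Fintype.card_coe]; omega)).exists_k4Fibres_succ hC
    hUcard
  have hmemU : ∀ w, w ∈ (closedNbrs G {q i})ᶜ ↔ w ≠ q i ∧ ¬ G.Adj (q i) w := fun w =>
    mem_compl_closedNbrs_singleton
  have hdom : ∀ u w a b, G.Adj (q i) u → G.Adj (q i) w → a ∈ (closedNbrs G {q i})ᶜ →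
      b ∈ (closedNbrs G {q i})ᶜ → f a = f b → f a < 4 → G.Adj u a → G.Adj w b → a = b :=
    fun u w a b hu hw ha hb hab h4 => (hK (f a) h4).1.eq_of_dominated hC (hK (f a) h4).2
      (Finset.filter_subset _ _) hu hw (mem_fibre.2 ⟨ha, rfl⟩) (mem_fibre.2 ⟨hb, hab.symm⟩)
  set U := (closedNbrs G {q i})ᶜ
  choose p hp using hne
  have hpU : ∀ j, j ≠ i → p j ∈ U := fun j hj =>
    (hmemU _).2 ⟨(mem_portX.1 (hp j)).2 i, hq.not_adj_X hC hj (hp j)⟩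
  have hpq : ∀ j, G.Adj (q j) (p j) := fun j => (mem_portX.1 (hp j)).1
  have hsingle : ∀ z ∈ fibre U f 4, ∀ z' ∈ fibre U f 4, ∀ u u', G.Adj (q i) u → G.Adj (q i) u' →
      G.Adj u z → G.Adj u' z' → u = u' := fun z hz z' hz' u u' hu hu' huz huz' => by
    have h1 := mem_fibre.1 hz
    have h2 := mem_fibre.1 hz'
    by_cases hzz : z = z'
    · subst hzz
      exact huniq z h1.1 u u' hu hu' huz huz'
    · exact hC.eq_of_adj_of_adj hu hu' (hτ z hz z' hz' hzz) ((hmemU z).1 h1.1).2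
        ((hmemU z).1 h1.1).1.symm ((hmemU z').1 h2.1).2 ((hmemU z').1 h2.1).1.symm huz huz'
  have hlt : ∀ w ∈ U, w ∉ fibre U f 4 → f w < 4 := fun w hw h => by
    have := hf w hw
    have : f w ≠ 4 := fun h' => h (mem_fibre.2 ⟨hw, h'⟩)
    omega
  have hxτ : ∃ z ∈ fibre U f 4, G.Adj x z := by
    by_contra! hmiss
    obtain ⟨j, l, hj, hl, hjl, hpj, hpl⟩ : ∃ j l, j ≠ i ∧ l ≠ i ∧ j ≠ l ∧
        p j ∉ fibre U f 4 ∧ p l ∉ fibre U f 4 := by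
      obtain ⟨j, hj⟩ := exists_ne i
      obtain ⟨l, m, hli, hlj, hmi, hmj, hlm⟩ := exists_two_others hj.symm
      have key : ∀ a b, a ≠ i → b ≠ i → a ≠ b → p a ∈ fibre U f 4 → p b ∉ fibre U f 4 :=
        fun a b ha hb hab h1 h2 => hq.ne hab (hsingle _ h1 _ h2 _ _ (hq _ _ ha.symm)
          (hq _ _ hb.symm) (hpq a) (hpq b))
      by_cases h1 : p j ∈ fibre U f 4
      · exact ⟨l, m, hli, hmi, hlm, key j l hj hli hlj.symm h1, key j m hj hmi hmj.symm h1⟩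
      · by_cases h2 : p l ∈ fibre U f 4
        · exact ⟨j, m, hj, hmi, hmj.symm, h1, key l m hli hmi hlm h2⟩
        · exact ⟨j, l, hj, hli, hlj.symm, h1, h2⟩
    have hsub : nbrs G x ⊆ insert (q i) (nbrs G x ∩ U) := fun y hy => by
      rw [mem_nbrs] at hy
      rw [Finset.mem_insert, Finset.mem_inter, mem_nbrs, hmemU]
      by_cases hyi : y = q i
      · exact Or.inl hyi
      · refine Or.inr ⟨hy, hyi, fun h => ?_⟩
        rcases eq_or_eq_of_adj_of_portX hx h with rfl | ⟨m, hm, rfl⟩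
        · exact G.irrefl hy
        · exact hq.not_adj_X hC hm.symm hxX hy.symm
    have h1 := (Finset.card_le_card hsub).trans (Finset.card_insert_le _ _)
    have h2 := hδ x
    set D := insert (p j) (insert (p l) (nbrs G x ∩ U)) with hD
    have hpx : ∀ m, m ≠ i → p m ∉ nbrs G x ∩ U := fun m hm h =>
      hq.not_adj_XX hC hm.symm hxX (hp m) (mem_nbrs.1 (Finset.mem_inter.1 h).1)
    have hDcard : D.card = (nbrs G x ∩ U).card + 2 := by
      rw [hD, Finset.card_insert_of_notMem, Finset.card_insert_of_notMem (hpx l hl)]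
      rw [Finset.mem_insert, not_or]
      exact ⟨hq.X_ne_X hC hjl (hp j) (hp l), hpx j hj⟩
    have hDdom : ∀ w ∈ D, w ∈ U ∧ f w < 4 ∧ ∃ u, G.Adj (q i) u ∧ G.Adj u w := fun w hw => by
      rw [hD, Finset.mem_insert, Finset.mem_insert, Finset.mem_inter, mem_nbrs] at hw
      rcases hw with rfl | rfl | hw
      · exact ⟨hpU j hj, hlt _ (hpU j hj) hpj, q j, hq _ _ hj.symm, hpq j⟩
      · exact ⟨hpU l hl, hlt _ (hpU l hl) hpl, q l, hq _ _ hl.symm, hpq l⟩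
      · exact ⟨hw.2, hlt _ hw.2 fun h => hmiss w h hw.1, x, hxq.1, hw.1⟩
    have h3 : D.card ≤ (Finset.range 4).card :=
      Finset.card_le_card_of_injOn f (fun w hw => by simpa using (hDdom w hw).2.1)
        fun a ha b hb hab => by
          obtain ⟨haU, ha4, u, hu, hua⟩ := hDdom a ha
          obtain ⟨hbU, -, w, hw, hwb⟩ := hDdom b hb
          exact hdom u w a b hu hw haU hbU hab ha4 hua hwb
    rw [Finset.card_range] at h3
    omega
  obtain ⟨z₀, hz₀, hxz₀⟩ := hxτ
  have hqτ : ∀ j, j ≠ i → ∀ z ∈ fibre U f 4, ¬ G.Adj (q j) z := fun j hj z hz h =>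
    hxq.2 j (hsingle z₀ hz₀ z hz x (q j) hxq.1 (hq _ _ hj.symm) hxz₀ h)
  by_cases hall : ∀ z ∈ fibre U f 4, G.Adj x z
  · have hrest : ∀ w, w ∉ Finset.univ.image q → w ≠ x → w ∈ U := fun w hw hwx => by
      rw [Finset.mem_image] at hw
      push Not at hw
      refine (hmemU w).2 ⟨fun h => hw i (Finset.mem_univ i) h.symm, fun h => ?_⟩
      rcases eq_or_eq_of_adj_of_portX hx h with h | ⟨j, -, h⟩
      · exact hwx h
      · exact hw j (Finset.mem_univ j) h.symm
    have hcl : ∀ c < 5, IsCliqueOn G (fibre U f c) := fun c hc => by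
      by_cases h : c = 4
      · exact h ▸ hτ
      · exact (hK c (by omega)).1
    refine CliqueCover.extend hq.isCliqueOn ⟨fun w => if w.1 = x then 4 else f w, ?_, ?_⟩
    · rintro ⟨w, hw⟩
      dsimp only
      split_ifs with h
      · omega
      · exact hf w (hrest w (Finset.mem_compl.1 hw) h)
    · rintro ⟨a, ha⟩ ⟨b, hb⟩ hab hne
      rw [Finset.mem_compl] at ha hb
      dsimp only at hab
      rw [Ne, Subtype.mk.injEq] at hne
      show G.Adj a b
      by_cases h1 : a = x <;> by_cases h2 : b = x
      · exact absurd (h1.trans h2.symm) hne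
      · rw [if_pos h1, if_neg h2] at hab
        rw [h1]
        exact hall b (mem_fibre.2 ⟨hrest b hb h2, hab.symm⟩)
      · rw [if_neg h1, if_pos h2] at hab
        rw [h2]
        exact (hall a (mem_fibre.2 ⟨hrest a ha h1, hab⟩)).symm
      · rw [if_neg h1, if_neg h2] at hab
        exact hcl (f a) (hf a (hrest a ha h1)) a (mem_fibre.2 ⟨hrest a ha h1, rfl⟩) b
          (mem_fibre.2 ⟨hrest b hb h2, hab.symm⟩) hne
  exfalso
  push Not at hall
  obtain ⟨z, hz, hxz⟩ := hall
  obtain ⟨j, hj⟩ := exists_ne i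
  obtain ⟨l, m, hli, hlj, hmi, hmj, hlm⟩ := exists_two_others hj.symm
  have hp4 : ∀ m, m ≠ i → f (p m) < 4 := fun m hm =>
    hlt _ (hpU m hm) fun h => hqτ m hm _ h (hpq m)
  have hzU := (mem_fibre.1 hz).1
  have hJ : Indep G {x, q j, z} := (Indep.pair (hqτ j hj z hz)).insert (by
    simpa [hxz] using fun h : G.Adj x (q j) => hq.not_adj_X hC hj.symm hxX h.symm)
  have hJcard : ({x, q j, z} : Finset V).card = 3 := by
    refine Finset.card_eq_three.2 ⟨x, q j, z, hxq.2 j, ?_, ?_, rfl⟩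
    · rintro rfl; exact ((hmemU x).1 hzU).2 hxq.1
    · rintro rfl; exact ((hmemU _).1 hzU).2 (hq _ _ hj.symm)
  let P : ℕ → Finset V := fun c =>
    (fibre U f c).filter fun w => ¬ ((G.Adj x w ∨ G.Adj (q j) w) ∨ G.Adj z w)
  have hP : ∀ c < 4, P c ⊆ fibre U f c := fun c _ => Finset.filter_subset _ _
  have hcount : ∀ c < 4, 4 ≤ (P c).card +
      ((fibre U f c).filter fun w => G.Adj x w ∨ G.Adj (q j) w).card + 1 := fun c hc => by
    have h1 := Finset.card_filter_add_card_filter_not (s := fibre U f c)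
      (fun w => (G.Adj x w ∨ G.Adj (q j) w) ∨ G.Adj z w)
    have h2 : ((fibre U f c).filter (G.Adj z ·)).card ≤ 1 :=
      Finset.card_le_one.2 fun a ha b hb => by
        rw [Finset.mem_filter] at ha hb
        refine (hK c hc).1.eq_of_adj hC (hK c hc).2 (fun h => ?_) ha.1 hb.1 ha.2 hb.2
        have h3 := (mem_fibre.1 hz).2
        have h4 := (mem_fibre.1 h).2
        omega
    rw [(hK c hc).2] at h1
    have hsub : (fibre U f c).filter (fun w => (G.Adj x w ∨ G.Adj (q j) w) ∨ G.Adj z w) ⊆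
        ((fibre U f c).filter fun w => G.Adj x w ∨ G.Adj (q j) w) ∪
          (fibre U f c).filter (G.Adj z ·) := fun w hw => by
      rw [Finset.mem_union, Finset.mem_filter, Finset.mem_filter]
      obtain ⟨h3, h4⟩ := Finset.mem_filter.1 hw
      exact h4.imp (⟨h3, ·⟩) (⟨h3, ·⟩)
    have h3 := (Finset.card_le_card hsub).trans (Finset.card_union_le _ _)
    show 4 ≤ ((fibre U f c).filter
      fun w => ¬ ((G.Adj x w ∨ G.Adj (q j) w) ∨ G.Adj z w)).card + _ + 1
    omega
  have hdom' : ∀ c < 4, ∀ w ∈ (fibre U f c).filter fun w => G.Adj x w ∨ G.Adj (q j) w,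
      w ∈ U ∧ f w = c ∧ ∃ u, G.Adj (q i) u ∧ (u = x ∨ u = q j) ∧ G.Adj u w := fun c _ w hw => by
    obtain ⟨h1, h2⟩ := Finset.mem_filter.1 hw
    refine ⟨(mem_fibre.1 h1).1, (mem_fibre.1 h1).2, ?_⟩
    rcases h2 with h2 | h2
    · exact ⟨x, hxq.1, Or.inl rfl, h2⟩
    · exact ⟨q j, hq _ _ hj.symm, Or.inr rfl, h2⟩
  have hle1 : ∀ c < 4, ((fibre U f c).filter fun w => G.Adj x w ∨ G.Adj (q j) w).card ≤ 1 :=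
    fun c hc => Finset.card_le_one.2 fun a ha b hb => by
      obtain ⟨haU, hac, u, hu, -, hua⟩ := hdom' c hc a ha
      obtain ⟨hbU, hbc, u', hu', -, hub⟩ := hdom' c hc b hb
      exact hdom u u' a b hu hu' haU hbU (hac.trans hbc.symm) (hac ▸ hc) hua hub
  have hzero : ∀ n, n ≠ i → n ≠ j →
      ((fibre U f (f (p n))).filter fun w => G.Adj x w ∨ G.Adj (q j) w).card = 0 :=
    fun n hni hnj => Finset.card_eq_zero.2 (Finset.eq_empty_of_forall_notMem fun a ha => by
      obtain ⟨haU, hac, u, hu, huj, hua⟩ := hdom' _ (hp4 n hni) a ha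
      obtain rfl := hdom u (q n) a (p n) hu (hq _ _ hni.symm) haU (hpU n hni) hac
        (hac ▸ hp4 n hni) hua (hpq n)
      rcases huj with rfl | rfl
      · exact hq.not_adj_XX hC hni.symm hxX (hp n) hua
      · exact hq.not_adj_X hC hnj (hp n) hua)
  have hfne : f (p l) ≠ f (p m) := fun h => hq.X_ne_X hC hlm (hp l) (hp m)
    (hdom (q l) (q m) _ _ (hq _ _ hli.symm) (hq _ _ hmi.symm) (hpU l hli) (hpU m hmi) h
      (hp4 l hli) (hpq l) (hpq m))
  have hsmall : ((Finset.range 4).filter fun c => (P c).card < 3) ⊆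
      Finset.range 4 \ {f (p l), f (p m)} := fun c hc => by
    obtain ⟨hc4, hc3⟩ := Finset.mem_filter.1 hc
    have hcount' := hcount c (Finset.mem_range.1 hc4)
    refine Finset.mem_sdiff.2 ⟨hc4, fun h => ?_⟩
    rcases Finset.mem_insert.1 h with rfl | h
    · have := hzero l hli hlj
      omega
    · rw [Finset.mem_singleton] at h
      subst h
      have := hzero m hmi hmj
      omega
  have hT : HasTransversal G (Finset.range 4) P := by
    refine hasTransversal_four (hK.fewEdges hC hP) (by simp) (fun c hc => ?_)
      ((Finset.card_le_card hsmall).trans ?_)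
    · have h1 := hcount c (Finset.mem_range.1 hc)
      have h2 := hle1 c (Finset.mem_range.1 hc)
      omega
    · rw [Finset.card_sdiff_of_subset, Finset.card_pair hfne, Finset.card_range]
      rw [Finset.insert_subset_iff, Finset.singleton_subset_iff, Finset.mem_range,
        Finset.mem_range]
      exact ⟨hp4 l hli, hp4 m hmi⟩
  have := hα.card_add_le hJ (f := f) hT fun c hc w hw => by
    obtain ⟨h1, h2⟩ := Finset.mem_filter.1 hw
    rw [mem_fibre] at h1
    push Not at h2
    refine ⟨h1.2, ?_, ?_⟩
    · simp only [Finset.mem_insert, Finset.mem_singleton, not_or]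
      refine ⟨?_, ?_, ?_⟩
      · rintro rfl; exact ((hmemU _).1 h1.1).2 hxq.1
      · rintro rfl; exact ((hmemU _).1 h1.1).2 (hq _ _ hj.symm)
      · rintro rfl
        have := (mem_fibre.1 hz).2
        omega
    · simp only [Finset.mem_insert, Finset.mem_singleton]
      rintro u (rfl | rfl | rfl)
      exacts [h2.1.1, h2.1.2, h2.2]
  omega

end SmallPort

section OrderBounds

theorem orderBound_six : OrderBound 6 := by
  obtain ⟨hB, hF⟩ := OrderBound.and_fullCover (le_refl 5)
  intro V _ G hC hα
  by_contra! hn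
  have hδ := hB.five_le_card_nbrs hF (by omega) hC hα hn
  obtain ⟨q, hq⟩ := exists_isK4_of_card k4FreeBound_six hC hα (by omega)
  refine hq.false_of_alpha_six hC hα (fun v => by have := hδ v; omega) (fun i => ?_) (by omega)
  have h1 := hq.card_nbrs i
  have h2 := hδ (q i)
  omega

theorem fullCover_six : FullCover 6 := by
  obtain ⟨hB, hF⟩ := OrderBound.and_fullCover (le_refl 5)
  intro V _ G hC hα hn
  by_cases hδ : ∀ v, 4 ≤ (nbrs G v).card
  · obtain ⟨q, hq⟩ := exists_isK4_of_card k4FreeBound_six hC hα (by omega)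
    by_cases hX : ∀ i, 2 ≤ (portX G q i).card
    · exact (hq.false_of_alpha_six hC hα hδ hX (by omega)).elim
    · push Not at hX
      obtain ⟨i, hi⟩ := hX
      exact hq.cliqueCover_six hC hα hδ hn (i := i) (by omega)
  · push Not at hδ
    obtain ⟨v, hv⟩ := hδ
    have := hB.le_card_nbrs hC hα v
    exact hF.cliqueCover_of_card (by omega) hC hα (v := v) (by omega)

theorem orderBound_seven : OrderBound 7 := by
  intro V _ G hC hα
  by_contra! hn
  obtain ⟨q, hq⟩ := exists_isK4_of_card k4FreeBound_seven hC hα (by omega)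
  exact hq.false_of_alpha_seven hC hα
    (orderBound_six.five_le_card_nbrs fullCover_six le_rfl hC hα hn) hn

end OrderBounds

end Graphs

section Colourings

/-- The graph whose edges are the pairs of colour `1`. -/
def colourGraph {n : ℕ} (c : Sym2 (Fin n) → Fin 2) : SimpleGraph (Fin n) where
  Adj x y := x ≠ y ∧ c s(x, y) = 1
  symm := ⟨fun x y h => ⟨h.1.symm, by rw [Sym2.eq_swap]; exact h.2⟩⟩
  loopless := ⟨fun _ h => h.1 rfl⟩

theorem hasMonoCopy_cycle_of_adj {n : ℕ} {c : Sym2 (Fin n) → Fin 2}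
    (h : ¬ C5Free (colourGraph c)) : HasMonoCopy (SimpleGraph.cycleGraph 5) c 1 := by
  unfold C5Free at h
  push Not at h
  obtain ⟨x, y, z, u, w, h1, h2, h3, h4, h5, n1, n2, n3, n4, n5, -⟩ := h
  have hadj : ∀ i j : Fin 5, (SimpleGraph.cycleGraph 5).Adj i j →
      (colourGraph c).Adj (![x, y, z, u, w] i) (![x, y, z, u, w] j) := by
    intro i j hij
    rw [SimpleGraph.cycleGraph_adj] at hij
    fin_cases i <;> fin_cases j <;>
      first
      | (exfalso; revert hij; decide)
      | assumption
      | (apply SimpleGraph.Adj.symm; assumption)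
  refine ⟨![x, y, z, u, w], ?_, fun i j hij => (hadj i j hij).2⟩
  have := h1.ne
  have := h2.ne
  have := h3.ne
  have := h4.ne
  have := h5.ne
  intro i j hij
  fin_cases i <;> fin_cases j <;> simp_all

theorem hasMonoCopy_top_of_indep {n m : ℕ} {c : Sym2 (Fin n) → Fin 2} {s : Finset (Fin n)}
    (hs : Indep (colourGraph c) s) (hm : m ≤ s.card) :
    HasMonoCopy (⊤ : SimpleGraph (Fin m)) c 0 := by
  obtain ⟨e⟩ := Function.Embedding.nonempty_of_card_le (α := Fin m) (β := {x // x ∈ s})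
    (by simpa using hm)
  refine ⟨fun i => e i, fun i j hij => e.injective (Subtype.ext hij), fun i j hij => ?_⟩
  have hne : (e i : Fin n) ≠ e j := fun h => hij (e.injective (Subtype.ext h))
  have h1 : c s((e i : Fin n), (e j : Fin n)) ≠ 1 := fun h => hs _ (e i).2 _ (e j).2 ⟨hne, h⟩
  show c s((e i : Fin n), (e j : Fin n)) = 0
  revert h1
  generalize c s((e i : Fin n), (e j : Fin n)) = t
  revert t
  decide

/-- Seven disjoint copies of the complete graph on four vertices in colour `1`. -/
def blockColouring : Sym2 (Fin 28) → Fin 2 :=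
  Sym2.lift ⟨fun x y => if x.1 / 4 = y.1 / 4 then 1 else 0, fun x y => by simp only [eq_comm]⟩

theorem blockColouring_mk (x y : Fin 28) :
    blockColouring s(x, y) = if x.1 / 4 = y.1 / 4 then 1 else 0 := rfl

theorem not_hasMonoCopy_top_blockColouring :
    ¬ HasMonoCopy (⊤ : SimpleGraph (Fin 8)) blockColouring 0 := by
  rintro ⟨f, -, hf⟩
  obtain ⟨i, j, hij, h⟩ := Fintype.exists_ne_map_eq_of_card_lt
    (fun i : Fin 8 => (⟨(f i).1 / 4, by omega⟩ : Fin 7)) (by simp)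
  have h1 := hf i j hij
  rw [blockColouring_mk, if_pos (Fin.mk.inj h)] at h1
  exact absurd h1 (by decide)

theorem not_hasMonoCopy_cycle_blockColouring :
    ¬ HasMonoCopy (SimpleGraph.cycleGraph 5) blockColouring 1 := by
  rintro ⟨f, hinj, hf⟩
  have hstep : ∀ i j : Fin 5, (SimpleGraph.cycleGraph 5).Adj i j → (f i).1 / 4 = (f j).1 / 4 := by
    intro i j hij
    have h1 := hf i j hij
    rw [blockColouring_mk] at h1
    by_contra hne
    rw [if_neg hne] at h1
    exact absurd h1 (by decide)
  have h01 := hstep 0 1 (by rw [SimpleGraph.cycleGraph_adj]; decide)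
  have h12 := hstep 1 2 (by rw [SimpleGraph.cycleGraph_adj]; decide)
  have h23 := hstep 2 3 (by rw [SimpleGraph.cycleGraph_adj]; decide)
  have h34 := hstep 3 4 (by rw [SimpleGraph.cycleGraph_adj]; decide)
  have hall : ∀ i, (f i).1 / 4 = (f 0).1 / 4 := by
    intro i
    fin_cases i <;> simp <;> omega
  obtain ⟨i, j, hij, h⟩ := Fintype.exists_ne_map_eq_of_card_lt
    (fun i : Fin 5 => (⟨(f i).1 % 4, by omega⟩ : Fin 4)) (by simp)
  have h1 := Fin.mk.inj h
  have h2 := hall i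
  have h3 := hall j
  exact hij (hinj (Fin.ext (by omega)))

end Colourings

/-- `R(K₈, C₅) = 29`. -/
theorem ramsey_K8_C5 :
    (∀ c : Sym2 (Fin 29) → Fin 2,
      HasMonoCopy (⊤ : SimpleGraph (Fin 8)) c 0 ∨ HasMonoCopy (SimpleGraph.cycleGraph 5) c 1) ∧
    (∃ c : Sym2 (Fin 28) → Fin 2,
      ¬ HasMonoCopy (⊤ : SimpleGraph (Fin 8)) c 0 ∧
      ¬ HasMonoCopy (SimpleGraph.cycleGraph 5) c 1) := by
  refine ⟨fun c => ?_, blockColouring, not_hasMonoCopy_top_blockColouring,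
    not_hasMonoCopy_cycle_blockColouring⟩
  by_cases hC : C5Free (colourGraph c)
  · left
    have hα : ¬ AlphaLE (colourGraph c) 7 := fun hα => by
      simpa using orderBound_seven _ _ hC hα
    unfold AlphaLE at hα
    push Not at hα
    obtain ⟨s, hs, hcard⟩ := hα
    exact hasMonoCopy_top_of_indep hs hcard
  · exact Or.inr (hasMonoCopy_cycle_of_adj hC)
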